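/- arXiv:0911.3359 — 12 statements merged into one kernel-verified Lean document; each statement's English description precedes it below -/
import Mathlib

section
/- Let b, c : (0,∞) → ℝ be measurable functions such that b and c are (essentially) bounded and t ↦ b(t)/√t and t ↦ c(t)/√t belong to L²(0,∞). Fix x > 0 and define f_x(u) = ∫₀^∞ b(t)c(t)e^{−2tx}/(u+t) dt for u > 0. Then: (a) the integral defining f_x(u) converges absolutely and |f_x(u)|² ≤ (∫₀^∞ b(t)²/t dt)·(∫₀^∞ c(t)²/t dt) for every u > 0; and (b) for all u, t > 0 with u ≠ t, ∫₀^∞ (b(u)c(w)e^{−x(u+w)}/(u+w)) · (b(w)c(t)e^{−x(w+t)}/(w+t)) dw = e^{−xu} b(u) · ((f_x(u) − f_x(t))/(t − u)) · c(t) e^{−xt}. In other words, the square of the integral operator on L²(0,∞) with kernel b(s)c(u)e^{−x(s+u)}/(s+u) is the integrable operator with kernel e^{−xu}b(u)·((f_x(u)−f_x(t))/(t−u))·c(t)e^{−xt}. -/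
open MeasureTheory Real Set

/-- The density of `f_x` is `b c k / t` for a factor `k ∈ [0, 1]`, so adding twice `r` times it to
`r² b² / t + c² / t` gives a nonnegative quantity. -/
lemma quadratic_density_nonneg {x u t : ℝ} (hx : 0 < x) (hu : 0 < u) (ht : 0 < t) (p q r : ℝ) :
    0 ≤ p ^ 2 / t * (r * r) + 2 * (p * q * Real.exp (-2 * t * x) / (u + t)) * r + q ^ 2 / t := by
  obtain ⟨k, hk⟩ : ∃ k, k = Real.exp (-2 * t * x) * (t / (u + t)) := ⟨_, rfl⟩
  have hexp : Real.exp (-2 * t * x) ≤ 1 := Real.exp_le_one_iff.2 (by nlinarith [mul_pos ht hx])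
  have hfrac : t / (u + t) ≤ 1 := (div_le_one (by positivity)).2 (by linarith)
  have hk0 : 0 ≤ k := by rw [hk]; positivity
  have hk1 : k ≤ 1 := by
    rw [hk]
    exact mul_le_one₀ hexp (by positivity) hfrac
  have heq : p ^ 2 / t * (r * r) + 2 * (p * q * Real.exp (-2 * t * x) / (u + t)) * r + q ^ 2 / t
      = (k * (p * r + q) ^ 2 + (1 - k) * ((p * r) ^ 2 + q ^ 2)) / t := by
    have hut : u + t ≠ 0 := by positivity
    rw [hk]
    field_simp
    ring
  rw [heq]
  have h1k : 0 ≤ 1 - k := sub_nonneg.2 hk1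
  positivity

lemma integrableOn_density {b c : ℝ → ℝ} (hb : Measurable b) (hc : Measurable c)
    (hb2 : IntegrableOn (fun t => (b t) ^ 2 / t) (Ioi 0))
    (hc2 : IntegrableOn (fun t => (c t) ^ 2 / t) (Ioi 0))
    {x u : ℝ} (hx : 0 < x) (hu : 0 < u) :
    IntegrableOn (fun t => b t * c t * Real.exp (-2 * t * x) / (u + t)) (Ioi 0) := by
  refine Integrable.mono' (hb2.add hc2) (Measurable.aestronglyMeasurable (by fun_prop)) ?_
  filter_upwards [ae_restrict_mem measurableSet_Ioi] with t ht
  have hpos := quadratic_density_nonneg hx hu ht (b t) (c t) 1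
  have hneg := quadratic_density_nonneg hx hu ht (b t) (c t) (-1)
  have hb0 : 0 ≤ (b t) ^ 2 / t := div_nonneg (sq_nonneg _) (le_of_lt ht)
  have hc0 : 0 ≤ (c t) ^ 2 / t := div_nonneg (sq_nonneg _) (le_of_lt ht)
  rw [Real.norm_eq_abs, abs_le, Pi.add_apply]
  constructor <;> linarith

lemma sq_integral_density_le {b c : ℝ → ℝ} (hb : Measurable b) (hc : Measurable c)
    (hb2 : IntegrableOn (fun t => (b t) ^ 2 / t) (Ioi 0))
    (hc2 : IntegrableOn (fun t => (c t) ^ 2 / t) (Ioi 0))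
    {x u : ℝ} (hx : 0 < x) (hu : 0 < u) :
    (∫ t in Ioi (0 : ℝ), b t * c t * Real.exp (-2 * t * x) / (u + t)) ^ 2 ≤
      (∫ t in Ioi (0 : ℝ), (b t) ^ 2 / t) * (∫ t in Ioi (0 : ℝ), (c t) ^ 2 / t) := by
  have hf := integrableOn_density hb hc hb2 hc2 hx hu
  have hquad := discrim_le_zero (a := ∫ t in Ioi (0 : ℝ), (b t) ^ 2 / t)
    (b := 2 * ∫ t in Ioi (0 : ℝ), b t * c t * Real.exp (-2 * t * x) / (u + t))
    (c := ∫ t in Ioi (0 : ℝ), (c t) ^ 2 / t) fun r => by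
      have hb3 := hb2.mul_const (r * r)
      have hf3 := (hf.const_mul 2).mul_const r
      rw [← integral_mul_const, ← integral_const_mul, ← integral_mul_const,
        ← integral_add hb3 hf3, ← integral_add (by exact hb3.add hf3) hc2]
      exact setIntegral_nonneg measurableSet_Ioi fun t ht =>
        quadratic_density_nonneg hx hu ht (b t) (c t) r
  rw [discrim] at hquad
  linarith

/-- the square of the integral operator with kernel
`b(s)c(u)e^{-x(s+u)}/(s+u)` on `L²(0,∞)` is the integrable operator with kernel
`e^{-xu} b(u) ((f_x(u) - f_x(t))/(t-u)) c(t) e^{-xt}`, where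
`f_x(u) = ∫₀^∞ b(t)c(t)e^{-2tx}/(u+t) dt`; moreover `f_x` converges absolutely
and satisfies the Cauchy–Schwarz bound. -/
theorem stmt0 (b c : ℝ → ℝ) (hb_meas : Measurable b) (hc_meas : Measurable c)
    (Mb Mc : ℝ)
    (hbB : ∀ t ∈ Set.Ioi (0:ℝ), |b t| ≤ Mb) (hcB : ∀ t ∈ Set.Ioi (0:ℝ), |c t| ≤ Mc)
    (hb2 : MeasureTheory.IntegrableOn (fun t => (b t)^2 / t) (Set.Ioi 0))
    (hc2 : MeasureTheory.IntegrableOn (fun t => (c t)^2 / t) (Set.Ioi 0))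
    (x : ℝ) (hx : 0 < x) :
    (∀ u ∈ Set.Ioi (0:ℝ),
      MeasureTheory.IntegrableOn
        (fun t => b t * c t * Real.exp (-2 * t * x) / (u + t)) (Set.Ioi 0) ∧
      (∫ t in Set.Ioi (0:ℝ), b t * c t * Real.exp (-2 * t * x) / (u + t))^2 ≤
        (∫ t in Set.Ioi (0:ℝ), (b t)^2 / t) * (∫ t in Set.Ioi (0:ℝ), (c t)^2 / t))
    ∧
    (∀ u t : ℝ, 0 < u → 0 < t → u ≠ t →
      (∫ w in Set.Ioi (0:ℝ),
          (b u * c w * Real.exp (-x * (u + w)) / (u + w)) *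
          (b w * c t * Real.exp (-x * (w + t)) / (w + t)))
        = Real.exp (-x * u) * b u *
          (((∫ s in Set.Ioi (0:ℝ), b s * c s * Real.exp (-2 * s * x) / (u + s)) -
            (∫ s in Set.Ioi (0:ℝ), b s * c s * Real.exp (-2 * s * x) / (t + s))) / (t - u)) *
          (c t * Real.exp (-x * t))) := by
  refine ⟨fun u hu => ⟨integrableOn_density hb_meas hc_meas hb2 hc2 hx hu,
    sq_integral_density_le hb_meas hc_meas hb2 hc2 hx hu⟩, fun u t hu ht hut => ?_⟩
  rw [← integral_sub (integrableOn_density hb_meas hc_meas hb2 hc2 hx hu)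
    (integrableOn_density hb_meas hc_meas hb2 hc2 hx ht), ← integral_div, ← integral_const_mul,
    ← integral_mul_const]
  refine setIntegral_congr_fun measurableSet_Ioi fun w hw => ?_
  have hw : 0 < w := hw
  have huw : u + w ≠ 0 := by positivity
  have hwt : t + w ≠ 0 := by positivity
  have htu : t - u ≠ 0 := sub_ne_zero.2 hut.symm
  have hu_exp : Real.exp (-x * (u + w)) = Real.exp (-x * u) * Real.exp (-x * w) := by
    rw [← Real.exp_add]; ring_nf
  have ht_exp : Real.exp (-x * (t + w)) = Real.exp (-x * w) * Real.exp (-x * t) := by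
    rw [← Real.exp_add]; ring_nf
  have hw_exp : Real.exp (-2 * w * x) = Real.exp (-x * w) * Real.exp (-x * w) := by
    rw [← Real.exp_add]; ring_nf
  simp only [hu_exp, ht_exp, hw_exp, add_comm w t]
  generalize Real.exp (-x * u) = eu
  generalize Real.exp (-x * w) = ew
  generalize Real.exp (-x * t) = et
  field_simp
  ring
end

section
/- Let t > 1, let J = [[0,1],[−1,0]], σ_{1,1} = diag(1,−1), and for ν ∈ {0, 1, t} let W_ν be a real 2×2 matrix with trace zero and det W_ν < 0, and let V_ν be a real 2×2 matrix with J W_ν = V_νᵀ σ_{1,1} V_ν. Let Φ : (t, ∞) → ℝ² be a continuously differentiable function satisfying Φ′(λ) = (W₀/λ + W₁/(λ−1) + W_t/(λ−t)) Φ(λ) for λ > t, such that ∫_t^∞ ‖Φ(λ)‖²/λ dλ < ∞ and Φ(λ) → 0 as λ → ∞. Then for all λ, μ > t with λ ≠ μ, the integral ∫₀^∞ Σ_{ν∈{0,1,t}} ⟨σ_{1,1} V_ν Φ(λ+s), V_ν Φ(μ+s)⟩ / ((λ+s−ν)(μ+s−ν)) ds converges absolutely and equals ⟨J Φ(λ),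 Φ(μ)⟩/(λ − μ). -/
open Matrix MeasureTheory Set Filter

/-- The quadratic form of `JW = Vᵀ σ V` in coordinates, for `W` of trace zero. -/
lemma sigma_form_eq {W V : Matrix (Fin 2) (Fin 2) ℝ} (hTr : W.trace = 0)
    (hV : !![(0:ℝ), 1; -1, 0] * W = Vᵀ * !![(1:ℝ), 0; 0, -1] * V) (x y : Fin 2 → ℝ) :
    ((!![(1:ℝ), 0; 0, -1]).mulVec (V.mulVec x)) ⬝ᵥ (V.mulVec y) =
      W 1 0 * x 0 * y 0 - W 0 0 * (x 0 * y 1 + x 1 * y 0) - W 0 1 * x 1 * y 1 := by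
  have h00 := congrFun (congrFun hV 0) 0
  have h01 := congrFun (congrFun hV 0) 1
  have h10 := congrFun (congrFun hV 1) 0
  have h11 := congrFun (congrFun hV 1) 1
  simp [Matrix.mul_apply, Fin.sum_univ_two] at h00 h01 h10 h11
  rw [Matrix.trace_fin_two] at hTr
  simp [Matrix.mulVec, dotProduct, Fin.sum_univ_two]
  linear_combination (-x 0 * y 0) * h00 - x 0 * y 1 * h01 - x 1 * y 0 * h10
    - x 1 * y 1 * h11 + x 0 * y 1 * hTr

/-- The form `⟨Jx, y⟩` in coordinates. -/
lemma symplectic_form_eq (x y : Fin 2 → ℝ) :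
    ((!![(0:ℝ), 1; -1, 0]).mulVec x) ⬝ᵥ y = x 1 * y 0 - x 0 * y 1 := by
  simp [Matrix.mulVec, dotProduct, Fin.sum_univ_two]
  ring

/-- `(a + s)⁻¹` decays like `s⁻¹` at infinity. -/
lemma inv_const_add_isBigO (a : ℝ) :
    (fun s : ℝ => (a + s)⁻¹) =O[atTop] fun s : ℝ => s⁻¹ := by
  refine Asymptotics.IsBigO.of_bound 2 ?_
  filter_upwards [eventually_gt_atTop (2 * |a|), eventually_gt_atTop 0] with s hs hs0
  have ha := neg_abs_le a
  have hpos : 0 < a + s := by linarith [abs_nonneg a]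
  rw [Real.norm_of_nonneg (by positivity), Real.norm_of_nonneg (by positivity)]
  rw [← div_eq_mul_inv, inv_eq_one_div, div_le_div_iff₀ hpos hs0]
  linarith

/-- factorization of the Tracy–Widom kernel for the Painlevé VI linear
system: `⟨JΦ(λ), Φ(μ)⟩/(λ-μ) = ∫₀^∞ Σ_ν ⟨σ V_ν Φ(λ+s), V_ν Φ(μ+s)⟩/((λ+s-ν)(μ+s-ν)) ds`. -/
theorem stmt3 (t : ℝ) (ht : 1 < t)
    (W V : Fin 3 → Matrix (Fin 2) (Fin 2) ℝ)
    (hTr : ∀ i, (W i).trace = 0) (hDet : ∀ i, (W i).det < 0)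
    (hV : ∀ i, !![(0:ℝ), 1; -1, 0] * W i = (V i)ᵀ * !![(1:ℝ), 0; 0, -1] * V i)
    (Φ : ℝ → Fin 2 → ℝ)
    (hODE : ∀ l : ℝ, t < l →
      HasDerivAt Φ ((l⁻¹ • W 0 + (l - 1)⁻¹ • W 1 + (l - t)⁻¹ • W 2).mulVec (Φ l)) l)
    (hInt : MeasureTheory.IntegrableOn (fun l : ℝ => ‖Φ l‖ ^ 2 / l) (Set.Ioi t))
    (hLim : Filter.Tendsto Φ Filter.atTop (nhds 0)) :
    ∀ lam mu : ℝ, t < lam → t < mu → lam ≠ mu →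
      (MeasureTheory.IntegrableOn
        (fun s : ℝ => ∑ i : Fin 3,
          ((!![(1:ℝ), 0; 0, -1]).mulVec ((V i).mulVec (Φ (lam + s)))) ⬝ᵥ
              ((V i).mulVec (Φ (mu + s))) /
            ((lam + s - ![0, 1, t] i) * (mu + s - ![0, 1, t] i)))
        (Set.Ioi 0)) ∧
      (∫ s in Set.Ioi (0:ℝ), ∑ i : Fin 3,
          ((!![(1:ℝ), 0; 0, -1]).mulVec ((V i).mulVec (Φ (lam + s)))) ⬝ᵥ
              ((V i).mulVec (Φ (mu + s))) /
            ((lam + s - ![0, 1, t] i) * (mu + s - ![0, 1, t] i)))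
        = ((!![(0:ℝ), 1; -1, 0]).mulVec (Φ lam)) ⬝ᵥ (Φ mu) / (lam - mu) := by
  intro lam mu hlam hmu hne
  set v : Fin 3 → ℝ := ![0, 1, t] with hv
  have hvt : ∀ i, v i ≤ t := by
    intro i
    fin_cases i <;> simp [hv] <;> linarith
  set f : ℝ → ℝ := fun s : ℝ => ∑ i : Fin 3,
      ((!![(1:ℝ), 0; 0, -1]).mulVec ((V i).mulVec (Φ (lam + s)))) ⬝ᵥ
          ((V i).mulVec (Φ (mu + s))) /
        ((lam + s - v i) * (mu + s - v i)) with hf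
  have hcomp : ∀ a s : ℝ, t < a → 0 ≤ s → ContinuousAt (fun s => Φ (a + s)) s := by
    intro a s ha hs
    exact ((hODE (a + s) (by linarith)).comp_const_add a s).continuousAt
  have htend : ∀ a : ℝ, Tendsto (fun s => Φ (a + s)) atTop (nhds 0) := fun a =>
    hLim.comp (tendsto_atTop_add_const_left _ a tendsto_id)
  have hfcont : ContinuousOn f (Ici 0) := by
    intro s hs
    rw [mem_Ici] at hs
    have h1 := hcomp lam s hlam hs
    have h2 := hcomp mu s hmu hs
    rw [continuousAt_pi] at h1 h2
    refine ContinuousAt.continuousWithinAt ?_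
    simp only [hf, sigma_form_eq (hTr _) (hV _)]
    refine tendsto_finsetSum _ fun i _ => ?_
    have e1 : ContinuousAt (fun s => Φ (lam + s) 0) s := h1 0
    have e2 : ContinuousAt (fun s => Φ (lam + s) 1) s := h1 1
    have e3 : ContinuousAt (fun s => Φ (mu + s) 0) s := h2 0
    have e4 : ContinuousAt (fun s => Φ (mu + s) 1) s := h2 1
    have hne' : (lam + s - v i) * (mu + s - v i) ≠ 0 := by
      have := hvt i
      exact mul_ne_zero (by linarith) (by linarith)
    refine ContinuousAt.div ?_ (by fun_prop) hne'
    exact (((e1.const_mul (W i 1 0)).mul e3).sub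
      (((e1.mul e4).add (e2.mul e3)).const_mul (W i 0 0))).sub
      ((e2.const_mul (W i 0 1)).mul e4)
  have hfO : f =O[atTop] fun s : ℝ => s ^ (-2 : ℝ) := by
    have hrw : (fun s : ℝ => s ^ (-2 : ℝ)) =ᶠ[atTop] fun s : ℝ => 1 * (s⁻¹ * s⁻¹) := by
      filter_upwards [eventually_gt_atTop 0] with s hs
      rw [Real.rpow_neg hs.le, Real.rpow_two, one_mul, ← mul_inv, sq]
    refine Asymptotics.IsBigO.trans_eventuallyEq ?_ hrw.symm
    refine Asymptotics.IsBigO.fun_sum fun i _ => ?_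
    simp only [sigma_form_eq (hTr _) (hV _), div_eq_mul_inv, mul_inv]
    refine Asymptotics.IsBigO.mul ?_ (Asymptotics.IsBigO.mul ?_ ?_)
    · have h1 := tendsto_pi_nhds.1 (htend lam)
      have h2 := tendsto_pi_nhds.1 (htend mu)
      exact ((((h1 0).const_mul (W i 1 0)).mul (h2 0)).sub
        ((((h1 0).mul (h2 1)).add ((h1 1).mul (h2 0))).const_mul (W i 0 0)) |>.sub
        (((h1 1).const_mul (W i 0 1)).mul (h2 1))).isBigO_one ℝ
    · simpa only [add_sub_right_comm] using inv_const_add_isBigO (lam - v i)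
    · simpa only [add_sub_right_comm] using inv_const_add_isBigO (mu - v i)
  have hfint : IntegrableOn f (Ioi 0) :=
    ((hfcont.locallyIntegrableOn measurableSet_Ici).integrableOn_of_isBigO_atTop hfO
      ⟨Ioi 1, Ioi_mem_atTop 1,
        integrableOn_Ioi_rpow_of_lt (by norm_num) one_pos⟩).mono_set Ioi_subset_Ici_self
  refine ⟨hfint, ?_⟩
  have hderiv : ∀ s ∈ Ici (0:ℝ), HasDerivAt
      (fun s => ((!![(0:ℝ), 1; -1, 0]).mulVec (Φ (lam + s))) ⬝ᵥ (Φ (mu + s)) / (mu - lam))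
      (f s) s := by
    intro s hs
    rw [mem_Ici] at hs
    have h1 := hasDerivAt_pi.1 ((hODE (lam + s) (by linarith)).comp_const_add lam s)
    have h2 := hasDerivAt_pi.1 ((hODE (mu + s) (by linarith)).comp_const_add mu s)
    simp only [symplectic_form_eq]
    refine ((((h1 1).mul (h2 0)).sub ((h1 0).mul (h2 1))).div_const (mu - lam)).congr_deriv ?_
    have hT : ∀ i, W i 1 1 = - W i 0 0 := by
      intro i
      have := hTr i
      rw [Matrix.trace_fin_two] at this
      linarith
    have hml : mu - lam ≠ 0 := sub_ne_zero.2 hne.symm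
    have a0 : lam + s ≠ 0 := by linarith
    have a1 : lam + s - 1 ≠ 0 := by linarith
    have a2 : lam + s - t ≠ 0 := by linarith
    have b0 : mu + s ≠ 0 := by linarith
    have b1 : mu + s - 1 ≠ 0 := by linarith
    have b2 : mu + s - t ≠ 0 := by linarith
    have key : ∀ x y : ℝ, x ≠ 0 → y ≠ 0 → y - x = mu - lam →
        (x * y)⁻¹ = (x⁻¹ - y⁻¹) / (mu - lam) := by
      intro x y hx hy h
      rw [← h] at hml ⊢
      field_simp
    simp only [hf, sigma_form_eq (hTr _) (hV _)]
    simp only [Fin.sum_univ_three, hv, Matrix.mulVec,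
      dotProduct, Fin.sum_univ_two, Matrix.add_apply, Matrix.smul_apply, smul_eq_mul, hT,
      Matrix.cons_val, sub_zero]
    simp only [div_eq_mul_inv _ (_ * _), key _ _ a0 b0 (by ring), key _ _ a1 b1 (by ring),
      key _ _ a2 b2 (by ring)]
    ring
  have hzero : Tendsto
      (fun s => ((!![(0:ℝ), 1; -1, 0]).mulVec (Φ (lam + s))) ⬝ᵥ (Φ (mu + s)) / (mu - lam))
      atTop (nhds 0) := by
    simp only [symplectic_form_eq]
    have h1 := tendsto_pi_nhds.1 (htend lam)
    have h2 := tendsto_pi_nhds.1 (htend mu)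
    simpa using (((h1 1).mul (h2 0)).sub ((h1 0).mul (h2 1))).div_const (mu - lam)
  rw [integral_Ioi_of_hasDerivAt_of_tendsto' hderiv hfint hzero]
  simp only [add_zero, zero_sub]
  rw [← div_neg, neg_sub]
end

section
/- Let J = [[0,1],[−1,0]]. Let T ⊂ ℝ be an open interval and let W_t : T → M₂(ℝ) be a function taking values in real 2×2 matrices with trace zero. Fix λ, μ ∈ ℝ with λ ≠ μ, and suppose Φ(λ, ·), Φ(μ, ·) : T → ℝ² are differentiable in t and satisfy ∂Φ(λ,t)/∂t = −W_t(t) Φ(λ,t)/(λ − t) and ∂Φ(μ,t)/∂t = −W_t(t) Φ(μ,t)/(μ − t), where λ − t ≠ 0 and μ − t ≠ 0 for t ∈ T. Then for all t ∈ T, ∂/∂t [ ⟨J Φ(λ,t), Φ(μ,t)⟩/(λ − μ) ] = ⟨J W_t(t) Φ(λ,t), Φ(μ,t)⟩ / ((λ − t)(μ − t)). In particular, for each t the t-derivative of the kernel is a rank-one expression in (λ, μ), i.e. a finite sum of products of a function of λ and a function of μ. -/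
open Matrix Set

/-- along the deformation equation `∂Φ/∂t = -W_t Φ/(λ-t)` of the
Jimbo–Miwa–Ueno pair, the `t`-derivative of the kernel `⟨JΦ(λ,t),Φ(μ,t)⟩/(λ-μ)`
equals `⟨J W_t Φ(λ,t), Φ(μ,t)⟩/((λ-t)(μ-t))`, a rank-one expression. -/
theorem stmt4 (a b : ℝ) (hab : a < b)
    (W : ℝ → Matrix (Fin 2) (Fin 2) ℝ)
    (hTr : ∀ t ∈ Set.Ioo a b, (W t).trace = 0)
    (lam mu : ℝ) (hlm : lam ≠ mu)
    (hlam : ∀ t ∈ Set.Ioo a b, lam - t ≠ 0) (hmu : ∀ t ∈ Set.Ioo a b, mu - t ≠ 0)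
    (Φl Φm : ℝ → Fin 2 → ℝ)
    (hΦl : ∀ t ∈ Set.Ioo a b,
      HasDerivAt Φl (-(lam - t)⁻¹ • (W t).mulVec (Φl t)) t)
    (hΦm : ∀ t ∈ Set.Ioo a b,
      HasDerivAt Φm (-(mu - t)⁻¹ • (W t).mulVec (Φm t)) t) :
    ∀ t ∈ Set.Ioo a b,
      HasDerivAt
        (fun τ : ℝ => ((!![(0:ℝ), 1; -1, 0]).mulVec (Φl τ)) ⬝ᵥ (Φm τ) / (lam - mu))
        (((!![(0:ℝ), 1; -1, 0] * W t).mulVec (Φl t)) ⬝ᵥ (Φm t) /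
          ((lam - t) * (mu - t)))
        t := by
  intro t ht
  have hl := hasDerivAt_pi.mp (hΦl t ht)
  have hm := hasDerivAt_pi.mp (hΦm t ht)
  have hlt := hlam t ht
  have hmt := hmu t ht
  have hne : lam - mu ≠ 0 := sub_ne_zero.mpr hlm
  have htr : W t 1 1 = -W t 0 0 := by
    have h := hTr t ht
    rw [Matrix.trace_fin_two] at h
    linarith
  have hkernel : (fun τ : ℝ =>
      ((!![(0:ℝ), 1; -1, 0]).mulVec (Φl τ)) ⬝ᵥ (Φm τ) / (lam - mu)) =
      fun τ => (Φl τ 1 * Φm τ 0 - Φl τ 0 * Φm τ 1) / (lam - mu) := by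
    funext τ
    simp [Matrix.mulVec, dotProduct, Fin.sum_univ_two, sub_eq_add_neg]
  rw [hkernel]
  refine ((((hl 1).mul (hm 0)).sub ((hl 0).mul (hm 1))).div_const (lam - mu)).congr_deriv ?_
  simp only [Matrix.mulVec, dotProduct, Fin.sum_univ_two, Pi.smul_apply, smul_eq_mul,
    Matrix.mul_apply, Matrix.of_apply, Matrix.cons_val_zero, Matrix.cons_val_one, htr]
  field_simp
  ring
end

section
/- Let N ≥ 1, let λ₁, …, λ_N be complex numbers with Re λ_j > 0 for all j, let ξ₁, …, ξ_N ∈ ℂ, and set φ(x) = Σ_{j=1}^N ξ_j e^{−λ_j x}. For x > 0 let R_x be the N×N complex matrix with entries (R_x)_{jk} = ξ_j e^{−(λ_j+λ_k)x}/(λ_j + λ_k), let e^{−yA} denote the diagonal matrix diag(e^{−λ_j y}), let B be the column vector (ξ_j)_{j=1}^N and C the row vector (1, …, 1). Let μ ∈ ℂ and x > 0 be such that I + μR_x is invertible, and define T_μ(x, y) = −μ C e^{−xA} (I + μR_x)^{−1} e^{−yA} B for y > 0. Then for all y > 0, T_μ(x, y) + μ φ(x + y) + μ ∫_x^∞ T_μ(x,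 z) φ(z + y) dz = 0. -/
open Matrix MeasureTheory Set

/-- The integral over `(x, ∞)` of a product of two finite exponential sums. -/
theorem integral_Ioi_sum_mul_sum_exp {ι : Type*} [Fintype ι] {l : ι → ℂ}
    (hre : ∀ j, 0 < (l j).re) (a b : ι → ℂ) (x : ℝ) :
    ∫ z in Set.Ioi x, (∑ k, a k * Complex.exp (-l k * (z : ℂ))) *
        (∑ m, b m * Complex.exp (-l m * (z : ℂ))) =
      ∑ k, ∑ m, a k * b m * (Complex.exp (-(l k + l m) * (x : ℂ)) / (l k + l m)) := by
  have hneg : ∀ k m, (-(l k + l m)).re < 0 := fun k m => by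
    have := hre k
    have := hre m
    simp only [Complex.neg_re, Complex.add_re]
    linarith
  have hprod : ∀ z : ℝ, (∑ k, a k * Complex.exp (-l k * (z : ℂ))) *
      (∑ m, b m * Complex.exp (-l m * (z : ℂ))) =
      ∑ k, ∑ m, a k * b m * Complex.exp (-(l k + l m) * (z : ℂ)) := fun z => by
    rw [Finset.sum_mul_sum]
    refine Finset.sum_congr rfl fun k _ => Finset.sum_congr rfl fun m _ => ?_
    rw [neg_add, add_mul, Complex.exp_add]
    ring
  have hint : ∀ k m, IntegrableOn
      (fun z : ℝ => a k * b m * Complex.exp (-(l k + l m) * (z : ℂ))) (Set.Ioi x) :=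
    fun k m => (integrableOn_exp_mul_complex_Ioi (hneg k m) x).const_mul _
  simp_rw [hprod]
  rw [integral_finsetSum _ fun k _ => integrable_finsetSum _ fun m _ => hint k m]
  refine Finset.sum_congr rfl fun k _ => ?_
  rw [integral_finsetSum _ fun m _ => hint k m]
  refine Finset.sum_congr rfl fun m _ => ?_
  rw [integral_const_mul, integral_exp_mul_complex_Ioi (hneg k m), neg_div_neg_eq]

/-- the Gelfand–Levitan-type integral equation
`T_μ(x,y) + μφ(x+y) + μ∫ₓ^∞ T_μ(x,z)φ(z+y) dz = 0` for the finite exponential symbol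
`φ(u) = Σ_j ξ_j e^{-λ_j u}`, where
`T_μ(x,y) = -μ C e^{-xA}(I+μR_x)^{-1}e^{-yA}B`. -/
theorem stmt6 (N : ℕ) (hN : 1 ≤ N) (l ξ : Fin N → ℂ)
    (hre : ∀ j, 0 < (l j).re)
    (μ : ℂ) (x : ℝ) (hx : 0 < x)
    (R : Matrix (Fin N) (Fin N) ℂ)
    (hR : ∀ j k, R j k = ξ j * Complex.exp (-(l j + l k) * (x : ℂ)) / (l j + l k))
    (hinv : IsUnit (1 + μ • R).det)
    (φ : ℝ → ℂ) (hφ : ∀ u : ℝ, φ u = ∑ j, ξ j * Complex.exp (-l j * (u : ℂ)))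
    (T : ℝ → ℂ)
    (hT : ∀ y : ℝ, T y =
      -μ * ((fun _ : Fin N => (1 : ℂ)) ⬝ᵥ
        (((Matrix.diagonal fun j => Complex.exp (-l j * (x : ℂ))) * (1 + μ • R)⁻¹ *
            (Matrix.diagonal fun j => Complex.exp (-l j * (y : ℂ)))).mulVec ξ))) :
    ∀ y : ℝ, 0 < y →
      T y + μ * φ (x + y) + μ * (∫ z in Set.Ioi x, T z * φ (z + y)) = 0 := by
  intro y _
  set M := 1 + μ • R with hM
  set v : Fin N → ℂ := (fun j => Complex.exp (-l j * (x : ℂ))) ᵥ* M⁻¹ with hv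
  have hvM : ∀ m, v m + μ * ∑ k, v k * R k m = Complex.exp (-l m * (x : ℂ)) := fun m => by
    have h : v ᵥ* M = fun j => Complex.exp (-l j * (x : ℂ)) := by
      rw [hv, Matrix.vecMul_vecMul, Matrix.nonsing_inv_mul _ hinv, Matrix.vecMul_one]
    rw [← congrFun h m, hM, Matrix.vecMul_add, Matrix.vecMul_one, Matrix.vecMul_smul]
    rfl
  have hTv : ∀ z : ℝ, T z = ∑ k, -μ * v k * ξ k * Complex.exp (-l k * (z : ℂ)) := fun z => by
    have h1 : (fun _ : Fin N => (1 : ℂ)) ᵥ* (Matrix.diagonal fun j => Complex.exp (-l j * (x : ℂ)))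
        = fun j => Complex.exp (-l j * (x : ℂ)) := by
      ext j
      simp [Matrix.vecMul_diagonal]
    rw [hT, Matrix.dotProduct_mulVec, ← Matrix.vecMul_vecMul, ← Matrix.vecMul_vecMul, h1, ← hv,
      dotProduct, Finset.mul_sum]
    refine Finset.sum_congr rfl fun k _ => ?_
    rw [Matrix.vecMul_diagonal]
    ring
  have hφy : ∀ z : ℝ, φ (z + y) =
      ∑ m, ξ m * Complex.exp (-l m * (y : ℂ)) * Complex.exp (-l m * (z : ℂ)) := fun z => by
    rw [hφ]
    refine Finset.sum_congr rfl fun m _ => ?_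
    rw [Complex.ofReal_add, mul_add, Complex.exp_add]
    ring
  have hI : ∫ z in Set.Ioi x, T z * φ (z + y) =
      ∑ m, -μ * (ξ m * Complex.exp (-l m * (y : ℂ))) * ∑ k, v k * R k m := by
    simp_rw [hTv, hφy]
    rw [integral_Ioi_sum_mul_sum_exp hre, Finset.sum_comm]
    refine Finset.sum_congr rfl fun m _ => ?_
    rw [Finset.mul_sum]
    refine Finset.sum_congr rfl fun k _ => ?_
    rw [hR]
    ring
  rw [hI, hTv, hφy, Finset.mul_sum, Finset.mul_sum, ← Finset.sum_add_distrib,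
    ← Finset.sum_add_distrib]
  refine Finset.sum_eq_zero fun m _ => ?_
  rw [← hvM m]
  ring
end

section
/- Let N ≥ 1, let λ₁, …, λ_N be complex numbers with Re λ_j > 0, let ξ₁, …, ξ_N ∈ ℂ. For x > 0 let R_x be the N×N complex matrix with entries (R_x)_{jk} = ξ_j e^{−(λ_j+λ_k)x}/(λ_j + λ_k), let e^{−xA} = diag(e^{−λ_j x}), B the column vector (ξ_j), and C the row vector (1,…,1). Suppose I − R_x is invertible for all x in an open interval U ⊆ (0,∞). Then for every x ∈ U, the function x ↦ det(I − R_x) is differentiable and d/dx log det(I − R_x) = C e^{−xA}(I − R_x)^{−1} e^{−xA} B; equivalently d/dx det(I − R_x) = det(I − R_x) · C e^{−xA}(I − R_x)^{−1} e^{−xA} B. -/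
open Matrix Set

/-- **Jacobi's formula** for the derivative of a determinant. -/
theorem Matrix.hasDerivAt_det {𝕜 𝔸 n : Type*} [NontriviallyNormedField 𝕜] [NormedCommRing 𝔸]
    [NormedAlgebra 𝕜 𝔸] [Fintype n] [DecidableEq n] {M : 𝕜 → Matrix n n 𝔸} {M' : Matrix n n 𝔸}
    {x : 𝕜} (hM : ∀ i j, HasDerivAt (fun y => M y i j) (M' i j) x) :
    HasDerivAt (fun y => (M y).det) ((M x).adjugate * M').trace x := by
  have key : ((M x).adjugate * M').trace =
      ∑ σ : Equiv.Perm n, ((Equiv.Perm.sign σ : ℤ) : 𝔸) *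
        ∑ i, (∏ j ∈ Finset.univ.erase i, M x (σ j) j) • M' (σ i) i := by
    have col (i : n) : ((M x).adjugate * M') i i = ((M x).updateCol i fun k => M' k i).det := by
      rw [← Matrix.cramer_apply, Matrix.cramer_eq_adjugate_mulVec]
      rfl
    simp only [Matrix.trace, Matrix.diag_apply, col, Matrix.det_apply', Finset.mul_sum]
    rw [Finset.sum_comm]
    refine Finset.sum_congr rfl fun σ _ => Finset.sum_congr rfl fun i _ => ?_
    rw [← Finset.prod_erase_mul _ _ (Finset.mem_univ i), Matrix.updateCol_self, smul_eq_mul]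
    congr 2
    exact Finset.prod_congr rfl fun j hj => Matrix.updateCol_ne (Finset.ne_of_mem_erase hj)
  rw [key]
  simp only [Matrix.det_apply']
  exact HasDerivAt.fun_sum fun σ _ =>
    (HasDerivAt.fun_finsetProd fun i _ => hM (σ i) i).const_mul _

/-- `d/dx log det(I - R_x) = C e^{-xA}(I - R_x)^{-1} e^{-xA} B`,
stated in the equivalent form
`d/dx det(I - R_x) = det(I - R_x) · C e^{-xA}(I - R_x)^{-1} e^{-xA} B`. -/
theorem stmt7 (N : ℕ) (hN : 1 ≤ N) (l ξ : Fin N → ℂ)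
    (hre : ∀ j, 0 < (l j).re)
    (R : ℝ → Matrix (Fin N) (Fin N) ℂ)
    (hR : ∀ (x : ℝ) (j k : Fin N),
      R x j k = ξ j * Complex.exp (-(l j + l k) * (x : ℂ)) / (l j + l k))
    (a b : ℝ) (hab : a < b) (ha : 0 ≤ a)
    (hinv : ∀ x ∈ Set.Ioo a b, IsUnit (1 - R x).det) :
    ∀ x ∈ Set.Ioo a b,
      HasDerivAt (fun y : ℝ => (1 - R y).det)
        ((1 - R x).det *
          ((fun _ : Fin N => (1 : ℂ)) ⬝ᵥ
            (((Matrix.diagonal fun j => Complex.exp (-l j * (x : ℂ))) * (1 - R x)⁻¹ *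
                (Matrix.diagonal fun j => Complex.exp (-l j * (x : ℂ)))).mulVec ξ)))
        x := by
  intro x hx
  set E : Matrix (Fin N) (Fin N) ℂ := Matrix.diagonal fun j => Complex.exp (-l j * (x : ℂ))
    with hE
  set V : Matrix (Fin N) (Fin N) ℂ := Matrix.vecMulVec ξ fun _ => 1 with hV
  have hderiv (j k : Fin N) : HasDerivAt (fun y : ℝ => (1 - R y) j k)
      ((E * V * E) j k) x := by
    have hne : l j + l k ≠ 0 := fun h => by
      have h' := congrArg Complex.re h
      simp only [Complex.add_re, Complex.zero_re] at h'
      linarith [hre j, hre k]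
    have hval : (E * V * E) j k =
        ξ j * Complex.exp (-(l j + l k) * (x : ℂ)) := by
      rw [hE, hV, Matrix.mul_diagonal, Matrix.diagonal_mul, Matrix.vecMulVec_apply,
        show -(l j + l k) * (x : ℂ) = -l j * x + -l k * x by ring, Complex.exp_add]
      ring
    rw [hval]
    simp only [Matrix.sub_apply, hR]
    have hlin : HasDerivAt (fun y : ℝ => -(l j + l k) * (y : ℂ)) (-(l j + l k)) x := by
      simpa using (Complex.ofRealCLM.hasDerivAt (x := x)).const_mul (-(l j + l k))
    refine (((hlin.cexp.const_mul (ξ j)).div_const (l j + l k)).const_sub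
      ((1 : Matrix (Fin N) (Fin N) ℂ) j k)).congr_deriv ?_
    field_simp
  refine (Matrix.hasDerivAt_det hderiv).congr_deriv ?_
  have hadj : (1 - R x).adjugate = (1 - R x).det • (1 - R x)⁻¹ := by
    rw [Matrix.inv_def, smul_smul, Ring.mul_inverse_cancel _ (hinv x hx), one_smul]
  rw [hadj, Matrix.smul_mul, Matrix.trace_smul, smul_eq_mul]
  congr 1
  rw [← Matrix.mul_assoc, Matrix.trace_mul_comm, ← Matrix.mul_assoc, ← Matrix.mul_assoc,
    hV, Matrix.mul_vecMulVec, Matrix.trace_vecMulVec, dotProduct_comm]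
end

section
/- Let N ≥ 1, let λ₁, …, λ_N be complex numbers with Re λ_j > 0, let ξ₁, …, ξ_N ∈ ℂ, and fix x > 0. Let K be the N×N complex matrix with entries K_{jm} = Σ_{k=1}^N ξ_j \overline{ξ_k} e^{−2(λ_j+\overline{λ_k})x} / ((λ_j+\overline{λ_k})(\overline{λ_k}+λ_m)). Then det(I − K) = Σ_{ℓ=0}^N (−1)^ℓ Σ_{S,T ⊆ {1,…,N}, |S|=|T|=ℓ} ( Π_{j∈S} ξ_j e^{−2λ_j x} ) ( Π_{k∈T} \overline{ξ_k} e^{−2\overline{λ_k} x} ) · ( det[ 1/(λ_j + \overline{λ_k}) ]_{j∈S, k∈T} )², where the ℓ = 0 term is 1 and det[1/(λ_j+\overline{λ_k})]_{j∈S,k∈T} is the Cauchy-type determinant of the ℓ×ℓ matrix indexed by S (rows, in increasing order) and T (columns, in increasing order). -/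
open Matrix Finset

section Minors

variable {R n : Type*} [CommRing R]

theorem Matrix.det_one_add_eq_sum_minors [Fintype n] [DecidableEq n] (M : Matrix n n R) :
    (1 + M).det = ∑ S : Finset n, (M.submatrix ((↑) : S → n) ((↑) : S → n)).det := by
  rw [add_comm]
  change (detRowAlternating : (n → R) [⋀^n]→ₗ[R] R)
    ((fun i => M i) + fun i => (1 : Matrix n n R) i) = _
  rw [AlternatingMap.map_add_univ]
  exact Finset.sum_congr rfl fun S _ => det_piecewise_one_eq_submatrix_det M S

theorem Matrix.det_submatrix_coe_eq_orderIsoOfFin [LinearOrder n] (M : Matrix n n R)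
    (S : Finset n) {k : ℕ} (h : S.card = k) :
    (M.submatrix ((↑) : S → n) ((↑) : S → n)).det =
      (M.submatrix (fun p => (S.orderIsoOfFin h p : n))
        (fun p => (S.orderIsoOfFin h p : n))).det :=
  (det_submatrix_equiv_self (S.orderIsoOfFin h).toEquiv _).symm

/-- The Cauchy–Binet formula. -/
theorem Matrix.det_mul_eq_sum_minors [Fintype n] [LinearOrder n] {k : ℕ}
    (A : Matrix (Fin k) n R) (B : Matrix n (Fin k) R) :
    (A * B).det = ∑ T : Finset n, if h : T.card = k then
      (A.submatrix id fun q => (T.orderIsoOfFin h q : n)).det *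
        (B.submatrix (fun q => (T.orderIsoOfFin h q : n)) id).det else 0 := by
  have hAB := coeff_det_one_add_X_smul_eq_sum_minors (A * B) k
  have huniv : (Finset.univ : Finset (Fin k)).powersetCard k = {Finset.univ} := by
    simpa using Finset.powersetCard_self (Finset.univ : Finset (Fin k))
  rw [huniv, Finset.sum_singleton,
    det_submatrix_coe_eq_orderIsoOfFin _ _ (Finset.card_fin k)] at hAB
  have hdet : ((A * B).submatrix
      (fun p => (((Finset.univ : Finset (Fin k)).orderIsoOfFin (Finset.card_fin k) p : Fin k)))
      (fun p => ((Finset.univ : Finset (Fin k)).orderIsoOfFin (Finset.card_fin k) p : Fin k))).det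
      = (A * B).det := by
    rw [← det_submatrix_coe_eq_orderIsoOfFin]
    exact det_submatrix_equiv_self (Equiv.subtypeUnivEquiv Finset.mem_univ) (A * B)
  have hcomm : (1 + (Polynomial.X : Polynomial R) • (A * B).map Polynomial.C).det =
      (1 + (Polynomial.X : Polynomial R) • (B * A).map Polynomial.C).det := by
    rw [Matrix.map_mul, Matrix.map_mul, ← Matrix.smul_mul, det_one_add_mul_comm,
      Matrix.mul_smul]
  rw [← hdet, ← hAB, hcomm, coeff_det_one_add_X_smul_eq_sum_minors,
    ← Finset.powerset_univ, Finset.powersetCard_eq_filter, Finset.sum_filter]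
  refine Finset.sum_congr rfl fun T _ => ?_
  split_ifs with h
  · rw [det_submatrix_coe_eq_orderIsoOfFin _ _ h, mul_comm, ← det_mul]
    rfl
  · rfl

theorem Matrix.det_one_sub_eq_sum_minors [Fintype n] [LinearOrder n] (M : Matrix n n R) :
    (1 - M).det = ∑ k ∈ Finset.range (Fintype.card n + 1), (-1) ^ k *
      ∑ S : Finset n, if h : S.card = k then
        (M.submatrix (fun p => (S.orderIsoOfFin h p : n))
          (fun p => (S.orderIsoOfFin h p : n))).det else 0 := by
  rw [sub_eq_add_neg, det_one_add_eq_sum_minors]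
  simp_rw [Finset.mul_sum]
  rw [Finset.sum_comm]
  refine Finset.sum_congr rfl fun S _ => ?_
  rw [Finset.sum_eq_single S.card]
  · rw [dif_pos rfl, ← det_submatrix_coe_eq_orderIsoOfFin, submatrix_neg, Pi.neg_apply,
      Pi.neg_apply, det_neg, Fintype.card_coe]
  · intro k _ hk
    rw [dif_neg (Ne.symm hk), mul_zero]
  · intro hS
    exact absurd (Finset.mem_range.2 (Nat.lt_succ_of_le (Finset.card_le_univ S))) hS

/-- Minors of `D_a C D_b Cᵀ`, with `D_a`, `D_b` diagonal. -/
theorem Matrix.det_submatrix_diagonal_mul_mul_diagonal_mul_transpose [Fintype n] [LinearOrder n]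
    (a b : n → R) (C : Matrix n n R) (S : Finset n) {k : ℕ} (hS : S.card = k) :
    ((diagonal a * C * (diagonal b * Cᵀ)).submatrix (fun p => (S.orderIsoOfFin hS p : n))
      (fun p => (S.orderIsoOfFin hS p : n))).det =
    ∑ T : Finset n, if hT : T.card = k then
      (∏ j ∈ S, a j) * (∏ j ∈ T, b j) *
        (C.submatrix (fun p => (S.orderIsoOfFin hS p : n))
          (fun q => (T.orderIsoOfFin hT q : n))).det ^ 2 else 0 := by
  have hprod (c : n → R) (U : Finset n) (hU : U.card = k) :
      ∏ j ∈ U, c j = ∏ p, c (U.orderIsoOfFin hU p) := by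
    rw [← Finset.prod_coe_sort]
    exact ((U.orderIsoOfFin hU).toEquiv.prod_comp fun j : U => c j).symm
  rw [← submatrix_mul_equiv _ _ _ (Equiv.refl n), det_mul_eq_sum_minors]
  refine Finset.sum_congr rfl fun T _ => ?_
  split_ifs with hT
  · set C' := C.submatrix (fun p => (S.orderIsoOfFin hS p : n))
      (fun q => (T.orderIsoOfFin hT q : n))
    have hA : ((diagonal a * C).submatrix (fun p => (S.orderIsoOfFin hS p : n))
        (Equiv.refl n)).submatrix id (fun q => (T.orderIsoOfFin hT q : n)) =
        diagonal (fun p => a (S.orderIsoOfFin hS p)) * C' := by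
      ext p q
      simp [C', diagonal_mul]
    have hB : ((diagonal b * Cᵀ).submatrix (Equiv.refl n)
        (fun p => (S.orderIsoOfFin hS p : n))).submatrix
        (fun q => (T.orderIsoOfFin hT q : n)) id =
        diagonal (fun q => b (T.orderIsoOfFin hT q)) * C'ᵀ := by
      ext p q
      simp [C', diagonal_mul]
    rw [hA, hB, det_mul, det_mul, det_diagonal, det_diagonal, det_transpose,
      hprod a S hS, hprod b T hT]
    ring
  · rfl

end Minors

/-- expansion of `det(I - K)`, where `K` is the matrix of the operator
`Γ†Γ` in the exponential basis, as a finite sum of squared Cauchy determinants. -/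
theorem stmt9 (N : ℕ) (hN : 1 ≤ N) (l ξ : Fin N → ℂ)
    (hre : ∀ j, 0 < (l j).re) (x : ℝ) (hx : 0 < x)
    (K : Matrix (Fin N) (Fin N) ℂ)
    (hK : ∀ j m, K j m = ∑ k,
      ξ j * (starRingEnd ℂ) (ξ k) *
        Complex.exp (-2 * (l j + (starRingEnd ℂ) (l k)) * (x : ℂ)) /
        ((l j + (starRingEnd ℂ) (l k)) * ((starRingEnd ℂ) (l k) + l m))) :
    (1 - K).det =
      ∑ ℓ ∈ Finset.range (N + 1), (-1 : ℂ) ^ ℓ *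
        ∑ S : Finset (Fin N), ∑ T : Finset (Fin N),
          (if h : S.card = ℓ ∧ T.card = ℓ then
            (∏ j ∈ S, ξ j * Complex.exp (-2 * l j * (x : ℂ))) *
            (∏ k ∈ T, (starRingEnd ℂ) (ξ k) *
              Complex.exp (-2 * (starRingEnd ℂ) (l k) * (x : ℂ))) *
            (Matrix.det (Matrix.of fun p q : Fin ℓ =>
              1 / (l ((S.orderIsoOfFin h.1 p : Fin N)) +
                (starRingEnd ℂ) (l ((T.orderIsoOfFin h.2 q : Fin N)))))) ^ 2
          else 0) := by
  have hfac : K = diagonal (fun j => ξ j * Complex.exp (-2 * l j * (x : ℂ))) *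
      (Matrix.of fun j k => 1 / (l j + (starRingEnd ℂ) (l k))) *
      (diagonal (fun k => (starRingEnd ℂ) (ξ k) *
        Complex.exp (-2 * (starRingEnd ℂ) (l k) * (x : ℂ))) *
        (Matrix.of fun j k => 1 / (l j + (starRingEnd ℂ) (l k)))ᵀ) := by
    ext j m
    rw [hK, mul_apply]
    refine Finset.sum_congr rfl fun k _ => ?_
    rw [diagonal_mul, diagonal_mul, transpose_apply, of_apply, of_apply,
      mul_add, add_mul, Complex.exp_add, add_comm ((starRingEnd ℂ) (l k)) (l m),
      div_eq_mul_inv, mul_inv]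
    ring
  rw [det_one_sub_eq_sum_minors, Fintype.card_fin]
  refine Finset.sum_congr rfl fun k _ => congrArg _ (Finset.sum_congr rfl fun S _ => ?_)
  split_ifs with hS
  · rw [hfac, det_submatrix_diagonal_mul_mul_diagonal_mul_transpose]
    refine Finset.sum_congr rfl fun T _ => ?_
    by_cases hT : T.card = k
    · rw [dif_pos hT, dif_pos ⟨hS, hT⟩]
      rfl
    · rw [dif_neg hT, dif_neg fun h => hT h.2]
  · exact (Finset.sum_eq_zero fun T _ => dif_neg fun h => hS h.1).symm
end

section
/- Let N ≥ 1 and ν ≥ 1, let λ₁, …, λ_N be complex numbers with Re λ_j > 0, let ξ₁, …, ξ_N ∈ ℂ^ν with components ξ_j^{(r)} = ⟨ξ_j, e_r⟩ for an orthonormal basis (e_r)_{r=1}^ν, and fix x > 0. Let K be the N×N complex matrix with entries K_{jm} = Σ_{k=1}^N ⟨ξ_j, ξ_k⟩ e^{−2(λ_j+\overline{λ_k})x} / ((λ_j+\overline{λ_k})(\overline{λ_k}+λ_m)). Then det(I − K) = Σ (−1)^{|S|} det[ ξ_j^{(r)} e^{−2λ_j x}/(λ_j + \overline{λ_k}) ]_{j∈S;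 (k,r)∈T} · det[ \overline{ξ_k^{(r)}} e^{−2\overline{λ_k} x}/(λ_m + \overline{λ_k}) ]_{m∈S; (k,r)∈T}, where the sum is over all pairs of subsets S ⊆ {1,…,N} and T ⊆ {1,…,N}×{1,…,ν} of equal cardinality, rows are indexed by S and columns by T (each in a fixed linear order), and the empty pair contributes 1. -/
open Matrix Finset

namespace Matrix

variable {R m n : Type*} [CommRing R] [Fintype m] [DecidableEq m]

/-- The determinant of a product of rectangular matrices, expanded by multilinearity in the rows. -/
theorem det_mul_eq_sum_pi [Fintype n] (A : Matrix m n R) (B : Matrix n m R) :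
    (A * B).det = ∑ f : m → n, (∏ i, A i (f i)) * (B.submatrix f id).det := by
  have h : A * B = fun i => ∑ k, A i k • B k := by
    ext i j
    simp [mul_apply]
  rw [h]
  change detRowAlternating.toMultilinearMap _ = _
  rw [MultilinearMap.map_sum]
  refine Finset.sum_congr rfl fun f _ => ?_
  exact MultilinearMap.map_smul_univ _ _ _

theorem det_submatrix_eq_zero_of_not_injective (B : Matrix n m R) {f : m → n}
    (hf : ¬ Function.Injective f) : (B.submatrix f id).det = 0 := by
  obtain ⟨i, j, hij, hne⟩ := Function.not_injective_iff.mp hf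
  exact det_zero_of_row_eq hne (funext fun k => by simp [hij])

variable [Fintype n] [DecidableEq n]

/-- The part of the row expansion of `det (A * B)` indexed by the functions with image `T`. -/
theorem sum_filter_image_eq_det_mul_det (A : Matrix m n R) (B : Matrix n m R) (T : Finset n)
    (e : m ≃ T) :
    ∑ f : m → n with univ.image f = T, (∏ i, A i (f i)) * (B.submatrix f id).det =
      (A.submatrix id fun i => (e i : n)).det * (B.submatrix (fun i => (e i : n)) id).det := by
  have hcard : Fintype.card m = #T := by simpa using Fintype.card_congr e
  rw [← det_transpose (A.submatrix _ _), det_apply', Finset.sum_mul]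
  symm
  refine Finset.sum_bij (fun (σ : Equiv.Perm m) _ i => (e (σ i) : n)) ?_ ?_ ?_ ?_
  · intro σ _
    simp only [mem_filter, mem_univ, true_and]
    ext x
    simp only [mem_image, mem_univ, true_and]
    constructor
    · rintro ⟨i, rfl⟩
      exact (e (σ i)).2
    · intro hx
      exact ⟨σ.symm (e.symm ⟨x, hx⟩), by simp⟩
  · intro σ _ τ _ h
    ext i
    exact e.injective (Subtype.ext (congrFun h i))
  · intro f hf
    have hT : univ.image f = T := by simpa using hf
    have hinj : Function.Injective f := by
      rw [← Set.injOn_univ, ← coe_univ, ← card_image_iff, hT, card_univ, hcard]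
    have hmem (i : m) : f i ∈ T := hT ▸ mem_image_of_mem f (mem_univ i)
    have hg : Function.Injective fun i => e.symm ⟨f i, hmem i⟩ := fun i j hij =>
      hinj (congrArg Subtype.val (e.symm.injective hij))
    exact ⟨Equiv.ofBijective _ (Finite.injective_iff_bijective.mp hg), mem_univ _, by
      ext i
      simp⟩
  · intro σ _
    have h := det_permute σ (B.submatrix (fun i => (e i : n)) id)
    rw [submatrix_submatrix] at h
    change _ = _ * (B.submatrix ((fun i => (e i : n)) ∘ σ) (id ∘ id)).det
    rw [h]
    simp only [transpose_apply, submatrix_apply, id]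
    ring

/-- The **Cauchy–Binet formula**, for an arbitrary choice of enumerations of the subsets. -/
theorem det_mul_eq_sum_finset {k : ℕ} (A : Matrix (Fin k) n R) (B : Matrix n (Fin k) R)
    (e : ∀ T : Finset n, k = #T → Fin k ≃ T) :
    (A * B).det = ∑ T : Finset n, if h : k = #T then
      (A.submatrix id fun i => (e T h i : n)).det *
        (B.submatrix (fun i => (e T h i : n)) id).det else 0 := by
  rw [det_mul_eq_sum_pi, ← Finset.sum_fiberwise _ fun f : Fin k → n => univ.image f]
  refine Finset.sum_congr rfl fun T _ => ?_
  split_ifs with h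
  · exact sum_filter_image_eq_det_mul_det A B T (e T h)
  · refine Finset.sum_eq_zero fun f hf => ?_
    rw [det_submatrix_eq_zero_of_not_injective B, mul_zero]
    intro hinj
    apply h
    rw [← (mem_filter.mp hf).2, card_image_of_injective _ hinj, card_fin]

/-- `det (1 - M)` is the alternating sum of the principal minors of `M`. -/
theorem det_one_sub_eq_sum_minors_s10 (M : Matrix n n R) :
    (1 - M).det = ∑ S : Finset n, (-1) ^ #S *
      (M.submatrix (Subtype.val : S → n) (Subtype.val : S → n)).det := by
  rw [sub_eq_neg_add]
  change detRowAlternating ((-M).row + (1 : Matrix n n R).row) = _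
  rw [AlternatingMap.map_add_univ]
  refine Finset.sum_congr rfl fun S _ => ?_
  refine (det_piecewise_one_eq_submatrix_det (-M) S).trans ?_
  rw [submatrix_neg]
  exact (det_neg _).trans (by rw [Fintype.card_coe])

end Matrix

/-- the vector-symbol (Cauchy–Binet) expansion of `det(I - K)` as a sum
over pairs of subsets `S ⊆ {1,…,N}` and `T ⊆ {1,…,N}×{1,…,ν}` of equal cardinality. -/
theorem stmt10 (N ν : ℕ) (hN : 1 ≤ N) (hν : 1 ≤ ν)
    (l : Fin N → ℂ) (hre : ∀ j, 0 < (l j).re)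
    (ξ : Fin N → Fin ν → ℂ) (x : ℝ) (hx : 0 < x)
    (K : Matrix (Fin N) (Fin N) ℂ)
    (hK : ∀ j m, K j m = ∑ k,
      (∑ r, ξ j r * (starRingEnd ℂ) (ξ k r)) *
        Complex.exp (-2 * (l j + (starRingEnd ℂ) (l k)) * (x : ℂ)) /
        ((l j + (starRingEnd ℂ) (l k)) * ((starRingEnd ℂ) (l k) + l m))) :
    (1 - K).det =
      ∑ S : Finset (Fin N), ∑ T : Finset (Fin N × Fin ν),
        (if h : S.card = T.card then
          (-1 : ℂ) ^ S.card *
          (Matrix.det (Matrix.of fun p q : Fin S.card =>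
            ξ ((S.orderIsoOfFin rfl p : Fin N))
                ((T.equivFin.symm (Fin.cast h q) : Fin N × Fin ν)).2 *
              Complex.exp (-2 * l ((S.orderIsoOfFin rfl p : Fin N)) * (x : ℂ)) /
              (l ((S.orderIsoOfFin rfl p : Fin N)) +
                (starRingEnd ℂ) (l ((T.equivFin.symm (Fin.cast h q) : Fin N × Fin ν)).1)))) *
          (Matrix.det (Matrix.of fun p q : Fin S.card =>
            (starRingEnd ℂ)
                (ξ ((T.equivFin.symm (Fin.cast h q) : Fin N × Fin ν)).1
                  ((T.equivFin.symm (Fin.cast h q) : Fin N × Fin ν)).2) *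
              Complex.exp
                (-2 * (starRingEnd ℂ) (l ((T.equivFin.symm (Fin.cast h q) : Fin N × Fin ν)).1) *
                  (x : ℂ)) /
              (l ((S.orderIsoOfFin rfl p : Fin N)) +
                (starRingEnd ℂ) (l ((T.equivFin.symm (Fin.cast h q) : Fin N × Fin ν)).1))))
        else 0) := by
  have hne (j k : Fin N) : l j + (starRingEnd ℂ) (l k) ≠ 0 := fun h => by
    have := congrArg Complex.re h
    simp only [Complex.add_re, Complex.conj_re, Complex.zero_re] at this
    linarith [hre j, hre k]
  let A : Matrix (Fin N) (Fin N × Fin ν) ℂ := of fun j t =>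
    ξ j t.2 * Complex.exp (-2 * l j * (x : ℂ)) / (l j + (starRingEnd ℂ) (l t.1))
  let B : Matrix (Fin N × Fin ν) (Fin N) ℂ := of fun t m =>
    (starRingEnd ℂ) (ξ t.1 t.2) * Complex.exp (-2 * (starRingEnd ℂ) (l t.1) * (x : ℂ)) /
      (l m + (starRingEnd ℂ) (l t.1))
  have hAB : K = A * B := by
    ext j m
    rw [hK, mul_apply, Fintype.sum_prod_type]
    refine Finset.sum_congr rfl fun k _ => ?_
    rw [Finset.sum_mul, Finset.sum_div]
    refine Finset.sum_congr rfl fun r _ => ?_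
    have hexp : Complex.exp (-2 * (l j + (starRingEnd ℂ) (l k)) * (x : ℂ)) =
        Complex.exp (-2 * l j * (x : ℂ)) * Complex.exp (-2 * (starRingEnd ℂ) (l k) * (x : ℂ)) := by
      rw [← Complex.exp_add]
      ring_nf
    simp only [A, B, of_apply, hexp, add_comm ((starRingEnd ℂ) (l k)) (l m)]
    have h₁ := hne j k
    have h₂ := hne m k
    field_simp
  rw [det_one_sub_eq_sum_minors_s10, hAB]
  refine Finset.sum_congr rfl fun S _ => ?_
  let o := (S.orderIsoOfFin rfl).toEquiv
  rw [← det_submatrix_equiv_self o, submatrix_submatrix,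
    submatrix_mul _ _ _ id _ Function.bijective_id,
    det_mul_eq_sum_finset _ _ fun T h => (finCongr h).trans T.equivFin.symm, Finset.mul_sum]
  refine Finset.sum_congr rfl fun T _ => ?_
  split_ifs with h
  · rw [← det_transpose (submatrix (submatrix B _ _) _ _), ← mul_assoc]
    rfl
  · exact mul_zero _
end

section
/- Let ν > −1. Then there exists a constant C > 0 such that for every finitely supported sequence (a_n)_{n≥0} of complex numbers, ∫₀^∞ | Σ_{n≥0} a_n e^{−(2n+ν+1)x/2} |² dx = Σ_{n≥0} Σ_{m≥0} a_n \overline{a_m} / (n + m + ν + 1) ≤ C Σ_{n≥0} |a_n|². -/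
open MeasureTheory Set

/-- Telescoping bound: `2 / ((s + t)² t)` is dominated by the increment of `-4 / (s + √·)` over
`[u², t²]` when `t² = u² + 1`. -/
lemma inv_add_sq_mul_le_telescope {s t u : ℝ} (hs : 0 < s) (ht : 0 < t) (hu : 0 < u)
    (h : t ^ 2 = u ^ 2 + 1) :
    1 / ((s ^ 2 + t ^ 2) * t) ≤ 4 / (s + u) - 4 / (s + t) := by
  have hut : u ≤ t := by nlinarith
  have hdiff : 1 / (2 * t) ≤ t - u := by
    rw [div_le_iff₀ (by positivity)]
    nlinarith
  calc 1 / ((s ^ 2 + t ^ 2) * t) ≤ 1 / ((s + t) ^ 2 / 2 * t) := by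
        gcongr
        nlinarith [sq_nonneg (s - t)]
    _ = 4 * (1 / (2 * t)) / ((s + t) * (s + t)) := by
        field_simp
        norm_num
    _ ≤ 4 * (t - u) / ((s + u) * (s + t)) := by gcongr
    _ = 4 / (s + u) - 4 / (s + t) := by
        field_simp
        ring

/-- The row sums of the generalized Hilbert matrix against the Schur weight
`m ↦ 1 / √(m + δ)`. -/
lemma sum_range_inv_add_mul_sqrt_le {δ s : ℝ} (hδ : 0 < δ) (hs : 0 < s) (N : ℕ) :
    ∑ m ∈ Finset.range (N + 1), 1 / ((s ^ 2 + (m + δ)) * √(m + δ)) ≤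
      (1 / (2 * δ) + 4) / s - 4 / (s + √(N + δ)) := by
  induction N with
  | zero =>
    simp only [zero_add, Finset.range_one, Finset.sum_singleton, Nat.cast_zero]
    obtain ⟨d, hd, rfl⟩ : ∃ d : ℝ, 0 < d ∧ δ = d ^ 2 :=
      ⟨√δ, Real.sqrt_pos.2 hδ, (Real.sq_sqrt hδ.le).symm⟩
    rw [Real.sqrt_sq hd.le]
    have h1 : 1 / ((s ^ 2 + d ^ 2) * d) ≤ 1 / ((2 * s * d) * d) := by
      gcongr
      nlinarith [sq_nonneg (s - d)]
    have h2 : 1 / ((2 * s * d) * d) = 1 / (2 * d ^ 2) / s := by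
      field_simp
    have h3 : 4 / (s + d) ≤ 4 / s := by
      gcongr
      linarith
    rw [add_div]
    linarith
  | succ N ih =>
    rw [Finset.sum_range_succ]
    have hN : (0 : ℝ) < N + δ := by positivity
    have hN' : (0 : ℝ) < ((N + 1 : ℕ) : ℝ) + δ := by positivity
    have h := inv_add_sq_mul_le_telescope hs (Real.sqrt_pos.2 hN') (Real.sqrt_pos.2 hN) (by
      rw [Real.sq_sqrt hN.le, Real.sq_sqrt hN'.le]
      push_cast
      ring)
    rw [Real.sq_sqrt hN'.le] at h
    linarith

lemma sum_inv_add_mul_sqrt_le {δ s : ℝ} (hδ : 0 < δ) (hs : 0 < s) (S : Finset ℕ) :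
    ∑ m ∈ S, 1 / ((s ^ 2 + (m + δ)) * √(m + δ)) ≤ (1 / (2 * δ) + 4) / s := by
  obtain ⟨N, hN⟩ := S.exists_nat_subset_range
  calc _ ≤ ∑ m ∈ Finset.range (N + 1), 1 / ((s ^ 2 + (m + δ)) * √(m + δ)) := by
        refine Finset.sum_le_sum_of_subset_of_nonneg
          (hN.trans (Finset.range_subset_range.2 N.le_succ)) fun m _ _ ↦ ?_
        positivity
    _ ≤ (1 / (2 * δ) + 4) / s - 4 / (s + √(N + δ)) := sum_range_inv_add_mul_sqrt_le hδ hs N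
    _ ≤ _ := sub_le_self _ (by positivity)

/-- Hilbert's inequality for the kernel `1 / (n + m + 2δ)`, by Schur's test. -/
lemma sum_sum_mul_div_add_le {δ : ℝ} (hδ : 0 < δ) (S : Finset ℕ) (b : ℕ → ℝ) :
    ∑ n ∈ S, ∑ m ∈ S, b n * b m / ((n + δ) + (m + δ)) ≤
      (1 / (2 * δ) + 4) * ∑ n ∈ S, b n ^ 2 := by
  have hpos (n : ℕ) : (0 : ℝ) < n + δ := by positivity
  set F : ℕ → ℕ → ℝ := fun n m ↦
    b n ^ 2 * √(n + δ) * (1 / (((n + δ) + (m + δ)) * √(m + δ))) with hF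
  have hterm (n m : ℕ) : b n * b m / ((n + δ) + (m + δ)) ≤ (F n m + F m n) / 2 := by
    obtain ⟨p, hp, hnp⟩ : ∃ p : ℝ, 0 < p ∧ (n : ℝ) + δ = p ^ 2 :=
      ⟨_, Real.sqrt_pos.2 (hpos n), (Real.sq_sqrt (hpos n).le).symm⟩
    obtain ⟨q, hq, hmq⟩ : ∃ q : ℝ, 0 < q ∧ (m : ℝ) + δ = q ^ 2 :=
      ⟨_, Real.sqrt_pos.2 (hpos m), (Real.sq_sqrt (hpos m).le).symm⟩
    simp only [hF, hnp, hmq, Real.sqrt_sq hp.le, Real.sqrt_sq hq.le]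
    have key : (b n ^ 2 * p * (1 / ((p ^ 2 + q ^ 2) * q)) +
        b m ^ 2 * q * (1 / ((q ^ 2 + p ^ 2) * p))) / 2 - b n * b m / (p ^ 2 + q ^ 2) =
        (b n * p - b m * q) ^ 2 / (2 * (p ^ 2 + q ^ 2) * p * q) := by
      rw [add_comm (q ^ 2)]
      field_simp
      ring
    have : 0 ≤ (b n * p - b m * q) ^ 2 / (2 * (p ^ 2 + q ^ 2) * p * q) := by positivity
    linarith
  calc _ ≤ ∑ n ∈ S, ∑ m ∈ S, (F n m + F m n) / 2 :=
        Finset.sum_le_sum fun n _ ↦ Finset.sum_le_sum fun m _ ↦ hterm n m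
    _ = ∑ n ∈ S, ∑ m ∈ S, F n m := by
        simp_rw [← Finset.sum_div, Finset.sum_add_distrib]
        rw [Finset.sum_comm (f := fun n m ↦ F m n)]
        ring
    _ ≤ ∑ n ∈ S, (1 / (2 * δ) + 4) * b n ^ 2 := by
        refine Finset.sum_le_sum fun n _ ↦ ?_
        have hs := Real.sqrt_pos.2 (hpos n)
        have h := sum_inv_add_mul_sqrt_le hδ hs S
        rw [Real.sq_sqrt (hpos n).le] at h
        rw [← Finset.mul_sum]
        calc _ ≤ b n ^ 2 * √(n + δ) * ((1 / (2 * δ) + 4) / √(n + δ)) := by gcongr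
          _ = _ := by field_simp
    _ = _ := (Finset.mul_sum ..).symm

/-- The `L²(0, ∞)` norm of a finite sum of decaying exponentials. -/
lemma integral_norm_sum_mul_exp_sq {ι : Type*} (S : Finset ι) (a : ι → ℂ) (r : ι → ℝ)
    (hr : ∀ i, 0 < r i) :
    ((∫ x in Ioi (0 : ℝ), ‖∑ i ∈ S, a i * (Real.exp (-r i * x) : ℂ)‖ ^ 2 : ℝ) : ℂ) =
      ∑ i ∈ S, ∑ j ∈ S, a i * (starRingEnd ℂ) (a j) / ((r i + r j : ℝ) : ℂ) := by
  have hexpand (x : ℝ) : ((‖∑ i ∈ S, a i * (Real.exp (-r i * x) : ℂ)‖ ^ 2 : ℝ) : ℂ) =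
      ∑ i ∈ S, ∑ j ∈ S,
        a i * (starRingEnd ℂ) (a j) * (Real.exp (-(r i + r j) * x) : ℂ) := by
    rw [Complex.ofReal_pow, ← Complex.mul_conj', map_sum, Finset.sum_mul_sum]
    refine Finset.sum_congr rfl fun i _ ↦ Finset.sum_congr rfl fun j _ ↦ ?_
    rw [map_mul, Complex.conj_ofReal, neg_add, add_mul, Real.exp_add, Complex.ofReal_mul]
    ring
  have hint (i j : ι) : IntegrableOn (fun x : ℝ ↦
      a i * (starRingEnd ℂ) (a j) * (Real.exp (-(r i + r j) * x) : ℂ)) (Ioi 0) :=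
    (integrableOn_exp_mul_Ioi (by linarith [hr i, hr j]) 0).ofReal.const_mul _
  rw [← integral_complex_ofReal]
  simp_rw [hexpand]
  rw [integral_finsetSum _ fun i _ ↦ integrable_finsetSum _ fun j _ ↦ hint i j]
  refine Finset.sum_congr rfl fun i _ ↦ ?_
  rw [integral_finsetSum _ fun j _ ↦ hint i j]
  refine Finset.sum_congr rfl fun j _ ↦ ?_
  rw [integral_const_mul, integral_complex_ofReal,
    integral_exp_mul_Ioi (by linarith [hr i, hr j]) 0, mul_zero, Real.exp_zero, neg_div_neg_eq,
    Complex.ofReal_div, Complex.ofReal_one, mul_one_div]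

/-- a Hilbert-type inequality: for `ν > -1` there is a constant `C > 0`
such that for every finitely supported complex sequence `(a_n)`,
`∫₀^∞ |Σ a_n e^{-(2n+ν+1)x/2}|² dx = Σ_{n,m} a_n conj(a_m)/(n+m+ν+1) ≤ C Σ |a_n|²`. -/
theorem stmt11 (nu : ℝ) (hnu : -1 < nu) :
    ∃ C : ℝ, 0 < C ∧ ∀ a : ℕ →₀ ℂ,
      ((↑(∫ x in Set.Ioi (0:ℝ),
          ‖∑ n ∈ a.support, a n * (Real.exp (-(2 * (n : ℝ) + nu + 1) * x / 2) : ℂ)‖ ^ 2) : ℂ)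
        = ∑ n ∈ a.support, ∑ m ∈ a.support,
            a n * (starRingEnd ℂ) (a m) / (((n : ℝ) + (m : ℝ) + nu + 1 : ℝ) : ℂ)) ∧
      (∫ x in Set.Ioi (0:ℝ),
          ‖∑ n ∈ a.support, a n * (Real.exp (-(2 * (n : ℝ) + nu + 1) * x / 2) : ℂ)‖ ^ 2)
        ≤ C * ∑ n ∈ a.support, ‖a n‖ ^ 2 := by
  have hδ : 0 < (nu + 1) / 2 := by linarith
  refine ⟨1 / (2 * ((nu + 1) / 2)) + 4, by positivity, fun a ↦ ?_⟩
  have heq := integral_norm_sum_mul_exp_sq a.support a (fun n : ℕ ↦ (n : ℝ) + (nu + 1) / 2)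
    fun n ↦ by positivity
  have hexp (n : ℕ) (x : ℝ) :
      -(2 * (n : ℝ) + nu + 1) * x / 2 = -((n : ℝ) + (nu + 1) / 2) * x := by ring
  have hden (n m : ℕ) : (n : ℝ) + m + nu + 1 = (n + (nu + 1) / 2) + (m + (nu + 1) / 2) := by ring
  simp_rw [hexp, hden]
  refine ⟨heq, ?_⟩
  refine le_trans ?_ (sum_sum_mul_div_add_le hδ a.support fun n ↦ ‖a n‖)
  refine (le_abs_self _).trans ?_
  rw [← Real.norm_eq_abs, ← Complex.norm_real, heq]
  refine norm_sum_le_of_le _ fun n _ ↦ norm_sum_le_of_le _ fun m _ ↦ ?_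
  rw [norm_div, norm_mul, RCLike.norm_conj, Complex.norm_of_nonneg (by positivity)]
end

section
/- Let ℓ ≥ 1, let S = {m₁ > m₂ > … > m_ℓ} and T = {k₁ > k₂ > … > k_ℓ} be finite subsets of {0, 1, 2, …} of equal cardinality ℓ, and let λ be the partition with Frobenius coordinates (m₁, …, m_ℓ | k₁, …, k_ℓ), so that |λ| = ℓ + Σ_{i=1}^ℓ (m_i + k_i). Then det[ 1/( j! · k! · (j + k + 1) ) ]_{j∈S, k∈T} = f^λ / |λ|!, where the ℓ×ℓ determinant has rows indexed by j ∈ S and columns by k ∈ T (each in decreasing order) and f^λ denotes the number of standard Young tableaux of shape λ. -/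
open Matrix Finset

/-- A standard Young tableau of shape `Y`: a bijective filling of the cells of `Y`
by `0, …, |Y| - 1` (normalized to `0` off the diagram) which is strictly increasing
along rows and down columns. -/
def IsStandardYoungTableau (Y : YoungDiagram) (f : ℕ × ℕ → ℕ) : Prop :=
  Set.BijOn f (Y.cells : Set (ℕ × ℕ)) (Set.Iio Y.card) ∧
  (∀ c ∈ Y, ∀ d ∈ Y, c.1 = d.1 → c.2 < d.2 → f c < f d) ∧
  (∀ c ∈ Y, ∀ d ∈ Y, c.2 = d.2 → c.1 < d.1 → f c < f d) ∧
  (∀ c : ℕ × ℕ, c ∉ Y → f c = 0)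

namespace YoungDiagram

/-- The diagram obtained by removing all cells weakly south-east of `c`. -/
def removeAbove (Y : YoungDiagram) (c : ℕ × ℕ) : YoungDiagram where
  cells := Y.cells.filter fun x => ¬ c ≤ x
  isLowerSet := by
    intro x y hyx hx
    simp only [coe_filter, mem_cells, Set.mem_ofPred_eq] at hx ⊢
    exact ⟨Y.isLowerSet hyx hx.1, fun h => hx.2 (h.trans hyx)⟩

theorem mem_removeAbove {Y : YoungDiagram} {c x : ℕ × ℕ} :
    x ∈ Y.removeAbove c ↔ x ∈ Y ∧ ¬ c ≤ x := by
  rw [← mem_cells]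
  simp [removeAbove]

/-- A cell of `Y` with no cell of `Y` directly below it or directly to its right. -/
def IsCorner (Y : YoungDiagram) (c : ℕ × ℕ) : Prop :=
  c ∈ Y ∧ (c.1 + 1, c.2) ∉ Y ∧ (c.1, c.2 + 1) ∉ Y

theorem isCorner_iff {Y : YoungDiagram} {c : ℕ × ℕ} :
    Y.IsCorner c ↔ c ∈ Y ∧ ∀ x ∈ Y, c ≤ x → x = c := by
  obtain ⟨a, b⟩ := c
  constructor
  · rintro ⟨h, h1, h2⟩
    refine ⟨h, ?_⟩
    rintro ⟨p, q⟩ hx hle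
    obtain ⟨hp, hq⟩ := Prod.mk_le_mk.1 hle
    by_contra hne
    rcases hp.lt_or_eq with h' | rfl
    · exact h1 (Y.up_left_mem h' hq hx)
    rcases hq.lt_or_eq with h' | rfl
    · exact h2 (Y.up_left_mem le_rfl h' hx)
    · exact hne rfl
  · rintro ⟨h, hx⟩
    refine ⟨h, fun h' => ?_, fun h' => ?_⟩
    · simpa using hx _ h' (by simp)
    · simpa using hx _ h' (by simp)

theorem IsCorner.mem_removeAbove {Y : YoungDiagram} {c x : ℕ × ℕ} (hc : Y.IsCorner c) :
    x ∈ Y.removeAbove c ↔ x ∈ Y ∧ x ≠ c := by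
  rw [YoungDiagram.mem_removeAbove]
  refine and_congr_right fun hx => not_congr ⟨(isCorner_iff.1 hc).2 x hx, ?_⟩
  rintro rfl
  exact le_rfl

theorem IsCorner.cells_removeAbove {Y : YoungDiagram} {c : ℕ × ℕ} (hc : Y.IsCorner c) :
    (Y.removeAbove c).cells = Y.cells.erase c := by
  ext x
  rw [mem_cells, hc.mem_removeAbove, mem_erase, mem_cells, and_comm]

theorem IsCorner.card_removeAbove {Y : YoungDiagram} {c : ℕ × ℕ} (hc : Y.IsCorner c) :
    (Y.removeAbove c).card + 1 = Y.card := by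
  rw [YoungDiagram.card, hc.cells_removeAbove]
  exact card_erase_add_one ((Y.mem_cells _).2 hc.1)

theorem isCorner_transpose {Y : YoungDiagram} {c : ℕ × ℕ} :
    Y.transpose.IsCorner c ↔ Y.IsCorner c.swap := by
  simp only [IsCorner, mem_transpose, Prod.swap, and_congr_right_iff]
  intro _
  exact and_comm

theorem removeAbove_transpose (Y : YoungDiagram) (c : ℕ × ℕ) :
    Y.transpose.removeAbove c = (Y.removeAbove c.swap).transpose := by
  apply YoungDiagram.ext
  ext x
  rw [mem_cells, mem_cells, mem_removeAbove, mem_transpose, mem_transpose, mem_removeAbove,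
    Prod.swap_le_swap]

end YoungDiagram

namespace IsStandardYoungTableau

open YoungDiagram

variable {Y : YoungDiagram} {f : ℕ × ℕ → ℕ} {c : ℕ × ℕ}

theorem lt_card (hf : IsStandardYoungTableau Y f) (hc : c ∈ Y) : f c < Y.card :=
  hf.1.mapsTo ((Y.mem_cells _).2 hc)

theorem isCorner (hf : IsStandardYoungTableau Y f) (hc : c ∈ Y) (hfc : f c + 1 = Y.card) :
    Y.IsCorner c := by
  refine ⟨hc, fun h => ?_, fun h => ?_⟩
  · have := hf.2.2.1 c hc _ h rfl (by simp)
    have := hf.lt_card h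
    omega
  · have := hf.2.1 c hc _ h rfl (by simp)
    have := hf.lt_card h
    omega

theorem exists_eq_card (hf : IsStandardYoungTableau Y f) (hY : 0 < Y.card) :
    ∃ c ∈ Y, f c + 1 = Y.card := by
  obtain ⟨c, hc, h⟩ := hf.1.surjOn (show Y.card - 1 ∈ Set.Iio Y.card from Nat.sub_one_lt hY.ne')
  exact ⟨c, (Y.mem_cells _).1 hc, by omega⟩

theorem injOn (hf : IsStandardYoungTableau Y f) {d : ℕ × ℕ} (hc : c ∈ Y) (hd : d ∈ Y)
    (h : f c = f d) : c = d :=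
  hf.1.injOn ((Y.mem_cells _).2 hc) ((Y.mem_cells _).2 hd) h

theorem update_zero (hf : IsStandardYoungTableau Y f) (hc : Y.IsCorner c)
    (hfc : f c + 1 = Y.card) :
    IsStandardYoungTableau (Y.removeAbove c) (Function.update f c 0) := by
  have hcard := hc.card_removeAbove
  refine ⟨⟨?_, ?_, ?_⟩, ?_, ?_, ?_⟩
  · intro x hx
    rw [mem_coe, mem_cells, hc.mem_removeAbove] at hx
    rw [Function.update_of_ne hx.2]
    have h1 := hf.lt_card hx.1
    have h2 : f x ≠ f c := fun h => hx.2 (hf.injOn hx.1 hc.1 h)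
    simp only [Set.mem_Iio]
    omega
  · intro x hx y hy hxy
    rw [mem_coe, mem_cells, hc.mem_removeAbove] at hx hy
    rw [Function.update_of_ne hx.2, Function.update_of_ne hy.2] at hxy
    exact hf.injOn hx.1 hy.1 hxy
  · intro v hv
    simp only [Set.mem_Iio] at hv
    obtain ⟨x, hx, rfl⟩ := hf.1.surjOn (show v ∈ Set.Iio Y.card by simp; omega)
    have hne : x ≠ c := by rintro rfl; omega
    refine ⟨x, ?_, Function.update_of_ne hne _ _⟩
    rw [mem_coe, mem_cells, hc.mem_removeAbove]
    exact ⟨(Y.mem_cells _).1 hx, hne⟩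
  · intro x hx y hy
    rw [hc.mem_removeAbove] at hx hy
    rw [Function.update_of_ne hx.2, Function.update_of_ne hy.2]
    exact hf.2.1 x hx.1 y hy.1
  · intro x hx y hy
    rw [hc.mem_removeAbove] at hx hy
    rw [Function.update_of_ne hx.2, Function.update_of_ne hy.2]
    exact hf.2.2.1 x hx.1 y hy.1
  · intro x hx
    rw [hc.mem_removeAbove] at hx
    by_cases h : x = c
    · simp [h]
    · rw [Function.update_of_ne h]
      exact hf.2.2.2 x fun h' => hx ⟨h', h⟩

theorem update_card (hc : Y.IsCorner c) (hf : IsStandardYoungTableau (Y.removeAbove c) f) :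
    IsStandardYoungTableau Y (Function.update f c (Y.card - 1)) := by
  have hcard := hc.card_removeAbove
  have hlt : ∀ x ∈ Y, x ≠ c → f x < Y.card - 1 := fun x hx hne => by
    have := hf.lt_card (hc.mem_removeAbove.2 ⟨hx, hne⟩)
    omega
  have hmono : ∀ x ∈ Y, ∀ y ∈ Y, x ≤ y → x ≠ y → (x ≠ c → y ≠ c → f x < f y) →
      Function.update f c (Y.card - 1) x < Function.update f c (Y.card - 1) y := by
    intro x hx y hy hle hne h
    have hxc : x ≠ c := by
      rintro rfl
      exact hne ((isCorner_iff.1 hc).2 y hy hle).symm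
    rw [Function.update_of_ne hxc]
    by_cases hyc : y = c
    · subst hyc
      rw [Function.update_self]
      exact hlt x hx hxc
    · rw [Function.update_of_ne hyc]
      exact h hxc hyc
  refine ⟨⟨?_, ?_, ?_⟩, ?_, ?_, ?_⟩
  · intro x hx
    rw [mem_coe, mem_cells] at hx
    simp only [Set.mem_Iio]
    by_cases h : x = c
    · subst h
      rw [Function.update_self]
      omega
    · rw [Function.update_of_ne h]
      have := hlt x hx h
      omega
  · intro x hx y hy hxy
    rw [mem_coe, mem_cells] at hx hy
    by_cases h : x = c <;> by_cases h' : y = c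
    · rw [h, h']
    · subst h
      rw [Function.update_self, Function.update_of_ne h'] at hxy
      have := hlt y hy h'
      omega
    · subst h'
      rw [Function.update_self, Function.update_of_ne h] at hxy
      have := hlt x hx h
      omega
    · rw [Function.update_of_ne h, Function.update_of_ne h'] at hxy
      exact hf.injOn (hc.mem_removeAbove.2 ⟨hx, h⟩) (hc.mem_removeAbove.2 ⟨hy, h'⟩) hxy
  · intro v hv
    simp only [Set.mem_Iio] at hv
    by_cases h : v = Y.card - 1
    · exact ⟨c, (Y.mem_cells _).2 hc.1, by rw [Function.update_self, h]⟩
    · obtain ⟨x, hx, rfl⟩ :=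
        hf.1.surjOn (show v ∈ Set.Iio (Y.removeAbove c).card by simp; omega)
      rw [mem_coe, mem_cells, hc.mem_removeAbove] at hx
      exact ⟨x, (Y.mem_cells _).2 hx.1, Function.update_of_ne hx.2 _ _⟩
  · intro x hx y hy h1 h2
    refine hmono x hx y hy ⟨h1.le, h2.le⟩ (by rintro rfl; simp at h2) fun h h' => ?_
    exact hf.2.1 x (hc.mem_removeAbove.2 ⟨hx, h⟩) y (hc.mem_removeAbove.2 ⟨hy, h'⟩) h1 h2
  · intro x hx y hy h1 h2
    refine hmono x hx y hy ⟨h2.le, h1.le⟩ (by rintro rfl; simp at h2) fun h h' => ?_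
    exact hf.2.2.1 x (hc.mem_removeAbove.2 ⟨hx, h⟩) y (hc.mem_removeAbove.2 ⟨hy, h'⟩) h1 h2
  · intro x hx
    have hne : x ≠ c := by
      rintro rfl
      exact hx hc.1
    rw [Function.update_of_ne hne]
    exact hf.2.2.2 x fun h => hx (hc.mem_removeAbove.1 h).1

end IsStandardYoungTableau

namespace YoungDiagram

/-- The number of standard Young tableaux of shape `Y`. -/
noncomputable def numStandard (Y : YoungDiagram) : ℕ :=
  Nat.card {f : ℕ × ℕ → ℕ // IsStandardYoungTableau Y f}

instance finite_isStandardYoungTableau (Y : YoungDiagram) :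
    Finite {f : ℕ × ℕ → ℕ // IsStandardYoungTableau Y f} := by
  refine Finite.of_injective
    (β := {x // x ∈ Y.cells} → Fin Y.card)
    (fun f x => ⟨f.1 x.1, f.2.lt_card ((Y.mem_cells _).1 x.2)⟩) ?_
  intro f g h
  refine Subtype.ext (funext fun x => ?_)
  by_cases hx : x ∈ Y
  · have := congrFun h ⟨x, (Y.mem_cells _).2 hx⟩
    simpa using this
  · rw [f.2.2.2.2 x hx, g.2.2.2.2 x hx]

/-- Removing the largest entry of a tableau whose largest entry lies at the corner `c`. -/
def tableauEquivRemoveAbove {Y : YoungDiagram} {c : ℕ × ℕ} (hc : Y.IsCorner c) :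
    {f : {f : ℕ × ℕ → ℕ // IsStandardYoungTableau Y f} // f.1 c + 1 = Y.card} ≃
      {f : ℕ × ℕ → ℕ // IsStandardYoungTableau (Y.removeAbove c) f} where
  toFun f := ⟨Function.update f.1.1 c 0, f.1.2.update_zero hc f.2⟩
  invFun f := ⟨⟨Function.update f.1 c (Y.card - 1), f.2.update_card hc⟩, by
    have := hc.card_removeAbove
    simp only [Function.update_self]
    omega⟩
  left_inv f := by
    refine Subtype.ext (Subtype.ext ?_)
    have := f.2
    simp only [Function.update_idem]
    rw [show Y.card - 1 = f.1.1 c by omega, Function.update_eq_self]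
  right_inv f := by
    refine Subtype.ext ?_
    have h := f.2.2.2.2 c fun h => (hc.mem_removeAbove.1 h).2 rfl
    simp only [Function.update_idem]
    rw [← h, Function.update_eq_self]

open Classical in
theorem numStandard_eq_sum {Y : YoungDiagram} (hY : 0 < Y.card) :
    Y.numStandard =
      ∑ c ∈ Y.cells, if Y.IsCorner c then (Y.removeAbove c).numStandard else 0 := by
  have : Fintype {f : ℕ × ℕ → ℕ // IsStandardYoungTableau Y f} := Fintype.ofFinite _
  choose g hgY hg using fun f : {f : ℕ × ℕ → ℕ // IsStandardYoungTableau Y f} =>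
    f.2.exists_eq_card hY
  rw [numStandard, Nat.card_eq_fintype_card, ← card_univ,
    card_eq_sum_card_fiberwise (f := g) (t := Y.cells) fun f _ => (Y.mem_cells _).2 (hgY f)]
  refine sum_congr rfl fun c hcY => ?_
  have hfib : ∀ f, g f = c ↔ f.1 c + 1 = Y.card := fun f => by
    constructor
    · rintro rfl
      exact hg f
    · intro h
      have := hg f
      exact f.2.injOn (hgY f) ((Y.mem_cells _).1 hcY) (by omega)
  split_ifs with hc
  · rw [numStandard, ← Nat.card_congr (tableauEquivRemoveAbove hc), Nat.card_eq_fintype_card,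
      Fintype.card_subtype]
    simp only [hfib]
  · rw [card_eq_zero, filter_eq_empty_iff]
    intro f _ h
    exact hc (f.2.isCorner ((Y.mem_cells _).1 hcY) ((hfib f).1 h))

theorem numStandard_of_card_eq_zero {Y : YoungDiagram} (hY : Y.card = 0) :
    Y.numStandard = 1 := by
  have hmem : ∀ c, c ∉ Y := fun c hc => by
    have := card_pos.2 ⟨c, (Y.mem_cells _).2 hc⟩
    exact this.ne' hY
  have hcells : Y.cells = ∅ := card_eq_zero.1 hY
  rw [numStandard, Nat.card_eq_one_iff_unique]
  refine ⟨⟨fun f g => Subtype.ext (funext fun x => ?_)⟩, ⟨⟨fun _ => 0, ?_, ?_, ?_, ?_⟩⟩⟩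
  · rw [f.2.2.2.2 x (hmem x), g.2.2.2.2 x (hmem x)]
  · rw [hY, hcells]
    simp [Set.BijOn, Set.SurjOn, Set.MapsTo]
  · exact fun c hc => absurd hc (hmem c)
  · exact fun c hc => absurd hc (hmem c)
  · exact fun _ _ => rfl

end YoungDiagram

/-- The entry of the determinant, which is `1 / n!` times the number of standard Young tableaux
of the hook with arm length `p` and leg length `q`. -/
noncomputable def hookEntry (p q : ℕ) : ℝ :=
  (1 : ℝ) / ((Nat.factorial p : ℝ) * (Nat.factorial q : ℝ) * ((p : ℝ) + (q : ℝ) + 1))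

/-- The matrix of hook entries with rows indexed by arms and columns indexed by legs. -/
noncomputable def hookMatrix {l : ℕ} (m k : Fin l → ℕ) : Matrix (Fin l) (Fin l) ℝ :=
  Matrix.of fun a b => hookEntry (m a) (k b)

theorem hookEntry_recurrence (p q : ℕ) :
    ((if p = 0 then 0 else hookEntry (p - 1) q) + if q = 0 then 0 else hookEntry p (q - 1)) +
      (if p = 0 ∧ q = 0 then 1 else 0) = ((p : ℝ) + q + 1) * hookEntry p q := by
  rcases p with _ | p <;> rcases q with _ | q
  · simp [hookEntry]
  · simp [hookEntry, Nat.factorial_succ]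
    have : (Nat.factorial q : ℝ) ≠ 0 := by positivity
    field_simp
  · simp [hookEntry, Nat.factorial_succ]
    have : (Nat.factorial p : ℝ) ≠ 0 := by positivity
    field_simp
  · simp [hookEntry, Nat.factorial_succ]
    have : (Nat.factorial p : ℝ) ≠ 0 := by positivity
    have : (Nat.factorial q : ℝ) ≠ 0 := by positivity
    field_simp
    ring

theorem Matrix.det_updateRow_eq_sum_adjugate {n R : Type*} [Fintype n] [DecidableEq n]
    [CommRing R] (A : Matrix n n R) (i : n) (v : n → R) :
    (A.updateRow i v).det = ∑ j, A.adjugate j i * v j := by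
  rw [← cramer_transpose_apply, cramer_eq_adjugate_mulVec, ← adjugate_transpose]
  rfl

theorem Matrix.det_updateCol_eq_sum_adjugate {n R : Type*} [Fintype n] [DecidableEq n]
    [CommRing R] (A : Matrix n n R) (i : n) (v : n → R) :
    (A.updateCol i v).det = ∑ j, A.adjugate i j * v j := by
  rw [← cramer_apply, cramer_eq_adjugate_mulVec]
  rfl

theorem hookMatrix_update_left {l : ℕ} (m k : Fin l → ℕ) (i : Fin l) (p : ℕ) :
    hookMatrix (Function.update m i p) k =
      (hookMatrix m k).updateRow i fun b => hookEntry p (k b) := by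
  ext a b
  by_cases h : a = i
  · subst h
    simp [hookMatrix]
  · simp [hookMatrix, h]

theorem hookMatrix_update_right {l : ℕ} (m k : Fin l → ℕ) (i : Fin l) (p : ℕ) :
    hookMatrix m (Function.update k i p) =
      (hookMatrix m k).updateCol i fun a => hookEntry (m a) p := by
  ext a b
  by_cases h : b = i
  · subst h
    simp [hookMatrix]
  · simp [hookMatrix, h]

theorem det_hookMatrix_recurrence {l : ℕ} (m k : Fin l → ℕ) :
    ((∑ i, if m i = 0 then 0 else (hookMatrix (Function.update m i (m i - 1)) k).det) +
      ∑ i, if k i = 0 then 0 else (hookMatrix m (Function.update k i (k i - 1))).det) +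
      (∑ i, ∑ j, if m i = 0 ∧ k j = 0 then (hookMatrix m k).adjugate j i else 0) =
    (l + ∑ i, (m i + k i) : ℕ) * (hookMatrix m k).det := by
  set A := hookMatrix m k with hA
  have h1 : ∀ i, (if m i = 0 then 0 else (hookMatrix (Function.update m i (m i - 1)) k).det) =
      ∑ j, A.adjugate j i * if m i = 0 then 0 else hookEntry (m i - 1) (k j) := fun i => by
    split_ifs
    · simp
    · rw [hookMatrix_update_left, Matrix.det_updateRow_eq_sum_adjugate]
  have h2 : ∀ j, (if k j = 0 then 0 else (hookMatrix m (Function.update k j (k j - 1))).det) =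
      ∑ i, A.adjugate j i * if k j = 0 then 0 else hookEntry (m i) (k j - 1) := fun j => by
    split_ifs
    · simp
    · rw [hookMatrix_update_right, Matrix.det_updateCol_eq_sum_adjugate]
  have hrow : ∀ i, ∑ j, A.adjugate j i * A i j = A.det := fun i => by
    have := congrFun (congrFun (Matrix.mul_adjugate A) i) i
    simp only [Matrix.mul_apply, Matrix.smul_apply, Matrix.one_apply_eq, smul_eq_mul,
      mul_one] at this
    rw [← this]
    exact sum_congr rfl fun j _ => mul_comm _ _
  have hcol : ∀ j, ∑ i, A.adjugate j i * A i j = A.det := fun j => by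
    have := congrFun (congrFun (Matrix.adjugate_mul A) j) j
    simpa only [Matrix.mul_apply, Matrix.smul_apply, Matrix.one_apply_eq, smul_eq_mul,
      mul_one] using this
  simp_rw [h1, h2]
  rw [sum_comm (f := fun j i => A.adjugate j i * if k j = 0 then 0 else hookEntry (m i) (k j - 1)),
    ← sum_add_distrib, ← sum_add_distrib]
  have hentry : ∀ i, ((∑ j, A.adjugate j i * if m i = 0 then 0 else hookEntry (m i - 1) (k j)) +
      ∑ j, A.adjugate j i * if k j = 0 then 0 else hookEntry (m i) (k j - 1)) +
      (∑ j, if m i = 0 ∧ k j = 0 then A.adjugate j i else 0) =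
      ((m i : ℝ) + 1) * A.det + ∑ j, (k j : ℝ) * (A.adjugate j i * A i j) := fun i => by
    rw [← hrow i, mul_sum, ← sum_add_distrib, ← sum_add_distrib, ← sum_add_distrib]
    refine sum_congr rfl fun j _ => ?_
    have := hookEntry_recurrence (m i) (k j)
    have hAij : A i j = hookEntry (m i) (k j) := rfl
    rw [hAij]
    have hE : (if m i = 0 ∧ k j = 0 then A.adjugate j i else 0) =
        A.adjugate j i * if m i = 0 ∧ k j = 0 then 1 else 0 := by simp
    rw [hE]
    linear_combination (A.adjugate j i) * this
  rw [sum_congr rfl fun i _ => hentry i, sum_add_distrib, sum_comm]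
  simp_rw [← mul_sum, hcol, ← sum_mul]
  rw [← add_mul]
  congr 1
  push_cast
  simp only [sum_add_distrib, sum_const, card_univ, Fintype.card_fin, nsmul_eq_mul, mul_one]
  ring

namespace YoungDiagram

/-- `Y` has Frobenius coordinates `(m 0, m 1, … | k 0, k 1, …)`. -/
def HasFrobenius {l : ℕ} (m k : Fin l → ℕ) (Y : YoungDiagram) : Prop :=
  ∀ i j : ℕ, (i, j) ∈ Y ↔
    ((∃ hi : i < l, i ≤ j ∧ j ≤ i + m ⟨i, hi⟩) ∨
      (∃ hj : j < l, j < i ∧ i ≤ j + k ⟨j, hj⟩))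

theorem _root_.StrictAnti.add_le_add_of_fin {l : ℕ} {m : Fin l → ℕ} (hm : StrictAnti m)
    {a b : ℕ} (ha : a < l) (hb : b < l) (hab : a ≤ b) :
    b + m ⟨b, hb⟩ ≤ a + m ⟨a, ha⟩ := by
  induction b, hab using Nat.le_induction with
  | base => exact le_rfl
  | succ b hab ih =>
    have h1 := ih (by omega)
    have h2 : m ⟨b + 1, hb⟩ < m ⟨b, by omega⟩ := hm (Fin.mk_lt_mk.2 (by omega))
    omega

namespace HasFrobenius

variable {l : ℕ} {m k : Fin l → ℕ} {Y : YoungDiagram}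

theorem transpose (hY : HasFrobenius m k Y) : HasFrobenius k m Y.transpose := by
  intro i j
  rw [mem_transpose, Prod.swap_prod_mk, hY]
  constructor
  · rintro (⟨hj, h1, h2⟩ | ⟨hi, h1, h2⟩)
    · rcases h1.lt_or_eq with h | rfl
      · exact .inr ⟨hj, h, h2⟩
      · exact .inl ⟨hj, le_rfl, by omega⟩
    · exact .inl ⟨hi, h1.le, h2⟩
  · rintro (⟨hj, h1, h2⟩ | ⟨hi, h1, h2⟩)
    · rcases h1.lt_or_eq with h | rfl
      · exact .inr ⟨hj, h, h2⟩
      · exact .inl ⟨hj, le_rfl, by omega⟩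
    · exact .inl ⟨hi, h1.le, h2⟩

theorem mem_arm (hY : HasFrobenius m k Y) (i : Fin l) : ((i : ℕ), i + m i) ∈ Y :=
  (hY _ _).2 (.inl ⟨i.2, by omega, le_rfl⟩)

theorem eq_arm_of_isCorner (hY : HasFrobenius m k Y) {i j : ℕ} (hc : Y.IsCorner (i, j))
    (hij : i ≤ j) : ∃ hi : i < l, j = i + m ⟨i, hi⟩ := by
  rcases (hY i j).1 hc.1 with ⟨hi, -, h⟩ | ⟨-, h, -⟩
  · refine ⟨hi, h.antisymm ?_⟩
    by_contra! hlt
    exact hc.2.2 ((hY _ _).2 (.inl ⟨hi, by simp only; omega, by simp only; omega⟩))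
  · omega

theorem strictAnti_update (hm : StrictAnti m) (hY : HasFrobenius m k Y) {i : Fin l}
    (hmi : 0 < m i) (hc : Y.IsCorner ((i : ℕ), i + m i)) :
    StrictAnti (Function.update m i (m i - 1)) := by
  intro a b hab
  by_cases hb : b = i
  · subst hb
    have := hm hab
    rw [Function.update_self, Function.update_of_ne hab.ne]
    omega
  by_cases ha : a = i
  · subst ha
    rw [Function.update_self, Function.update_of_ne hb]
    have hlt : (a : ℕ) < b := hab
    have hmab := hm hab
    by_contra! hle
    have hl : (a : ℕ) + 1 < l := by omega
    have h := hm.add_le_add_of_fin hl b.2 hlt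
    simp only [Fin.eta] at h
    exact hc.2.1 ((hY _ _).2 (.inl ⟨hl, by simp only; omega, by simp only; omega⟩))
  · rw [Function.update_of_ne hb, Function.update_of_ne ha]
    exact hm hab

theorem isCorner_arm (hY : HasFrobenius m k Y) {i : Fin l}
    (hmi : 0 < m i) (hm' : StrictAnti (Function.update m i (m i - 1))) :
    Y.IsCorner ((i : ℕ), i + m i) := by
  refine ⟨hY.mem_arm i, fun h => ?_, fun h => ?_⟩
  · rcases (hY _ _).1 h with ⟨hi, h1, h2⟩ | ⟨-, h1, -⟩
    · have := hm' (show i < ⟨i + 1, hi⟩ from Fin.mk_lt_mk.2 (by omega))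
      rw [Function.update_self, Function.update_of_ne (by simp [Fin.ext_iff])] at this
      simp only at h2
      omega
    · simp only at h1
      omega
  · rcases (hY _ _).1 h with ⟨hi, h1, h2⟩ | ⟨-, h1, -⟩
    · simp only [Fin.eta] at h2
      omega
    · simp only at h1
      omega

theorem removeAbove_arm (hY : HasFrobenius m k Y) {i : Fin l}
    (hmi : 0 < m i) (hm' : StrictAnti (Function.update m i (m i - 1))) :
    HasFrobenius (Function.update m i (m i - 1)) k (Y.removeAbove ((i : ℕ), i + m i)) := by
  intro p q
  rw [(hY.isCorner_arm hmi hm').mem_removeAbove, hY p q, or_and_right]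
  refine or_congr ⟨?_, ?_⟩ ⟨?_, ?_⟩
  · rintro ⟨⟨hp, h1, h2⟩, hne⟩
    refine ⟨hp, h1, ?_⟩
    by_cases h : (⟨p, hp⟩ : Fin l) = i
    · subst h
      have : q ≠ p + m ⟨p, hp⟩ := fun h => hne (by simp [h])
      rw [Function.update_self]
      omega
    · rwa [Function.update_of_ne h]
  · rintro ⟨hp, h1, h2⟩
    by_cases h : (⟨p, hp⟩ : Fin l) = i
    · subst h
      rw [Function.update_self] at h2
      refine ⟨⟨hp, h1, by omega⟩, fun h => ?_⟩
      simp only [Prod.mk.injEq, true_and] at h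
      omega
    · rw [Function.update_of_ne h] at h2
      refine ⟨⟨hp, h1, h2⟩, fun h' => h (Fin.ext ?_)⟩
      exact (Prod.mk.inj h').1
  · exact fun h => h.1
  · rintro ⟨hq, h1, h2⟩
    refine ⟨⟨hq, h1, h2⟩, fun h => ?_⟩
    have := Prod.mk.inj h
    omega

theorem eq_zero_of_isCorner_diag (hY : HasFrobenius m k Y) {i : Fin l}
    (hc : Y.IsCorner ((i : ℕ), (i : ℕ))) : m i = 0 ∧ k i = 0 := by
  constructor
  · by_contra h
    exact hc.2.2 ((hY _ _).2 (.inl ⟨i.2, by simp, by simp only [Fin.eta]; omega⟩))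
  · by_contra h
    exact hc.2.1 ((hY _ _).2 (.inr ⟨i.2, by simp, by simp only [Fin.eta]; omega⟩))

theorem isCorner_diag (hY : HasFrobenius m k Y) {i : Fin l}
    (hmi : m i = 0) (hki : k i = 0) : Y.IsCorner ((i : ℕ), (i : ℕ)) := by
  refine ⟨by simpa [hmi] using hY.mem_arm i, fun h => ?_, fun h => ?_⟩
  · rcases (hY _ _).1 h with ⟨-, h1, -⟩ | ⟨_, -, h2⟩
    · simp only at h1
      omega
    · simp only [Fin.eta] at h2
      omega
  · rcases (hY _ _).1 h with ⟨_, -, h2⟩ | ⟨-, h1, -⟩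
    · simp only [Fin.eta] at h2
      omega
    · simp only at h1
      omega

end HasFrobenius

theorem eq_last_of_strictAnti_of_eq_zero {l : ℕ} {m : Fin (l + 1) → ℕ} (hm : StrictAnti m)
    {i : Fin (l + 1)} (hi : m i = 0) : i = Fin.last l := by
  by_contra h
  have := hm (Fin.lt_last_iff_ne_last.2 h)
  omega

theorem HasFrobenius.removeAbove_diag {l : ℕ} {m k : Fin (l + 1) → ℕ} {Y : YoungDiagram}
    (hY : HasFrobenius m k Y) (hm : StrictAnti m) {i : Fin (l + 1)}
    (hmi : m i = 0) (hki : k i = 0) :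
    HasFrobenius (m ∘ i.succAbove) (k ∘ i.succAbove)
      (Y.removeAbove ((i : ℕ), (i : ℕ))) := by
  intro p q
  rw [(hY.isCorner_diag hmi hki).mem_removeAbove, hY p q, or_and_right]
  obtain rfl := eq_last_of_strictAnti_of_eq_zero hm hmi
  simp only [Fin.succAbove_last, Function.comp_apply, Fin.castSucc_mk, Fin.val_last, ne_eq,
    Prod.mk.injEq]
  have hmi' : m ⟨l, Nat.lt_succ_self l⟩ = 0 := hmi
  have hki' : k ⟨l, Nat.lt_succ_self l⟩ = 0 := hki
  refine or_congr ⟨?_, ?_⟩ ⟨?_, ?_⟩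
  · rintro ⟨⟨hp, h1, h2⟩, hne⟩
    rcases (Nat.lt_succ_iff.1 hp).lt_or_eq with h | rfl
    · exact ⟨h, h1, h2⟩
    · omega
  · rintro ⟨hp, h1, h2⟩
    exact ⟨⟨by omega, h1, h2⟩, by omega⟩
  · rintro ⟨⟨hp, h1, h2⟩, hne⟩
    rcases (Nat.lt_succ_iff.1 hp).lt_or_eq with h | rfl
    · exact ⟨h, h1, h2⟩
    · omega
  · rintro ⟨hp, h1, h2⟩
    exact ⟨⟨by omega, h1, h2⟩, by omega⟩

theorem HasFrobenius.card_eq {l : ℕ} {m k : Fin l → ℕ} {Y : YoungDiagram}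
    (hY : HasFrobenius m k Y) : Y.card = l + ∑ i, (m i + k i) := by
  have hcard : Fintype.card (Σ i : Fin l, Fin (m i + 1) ⊕ Fin (k i)) =
      l + ∑ i, (m i + k i) := by
    simp [sum_add_distrib]
    ring
  rw [← hcard, ← card_univ, YoungDiagram.card]
  symm
  refine card_bij (fun x _ => Sum.elim
    (fun t : Fin (m x.1 + 1) => ((x.1 : ℕ), (x.1 : ℕ) + (t : ℕ)))
    (fun t : Fin (k x.1) => ((x.1 : ℕ) + 1 + (t : ℕ), (x.1 : ℕ))) x.2) ?_ ?_ ?_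
  · rintro ⟨i, t | t⟩ -
    · exact (Y.mem_cells _).2 ((hY _ _).2 (.inl ⟨i.2, by omega, by simp only [Fin.eta]; omega⟩))
    · exact (Y.mem_cells _).2 ((hY _ _).2 (.inr ⟨i.2, by omega, by simp only [Fin.eta]; omega⟩))
  · rintro ⟨i, s | s⟩ - ⟨j, t | t⟩ - h
    · obtain ⟨h1, h2⟩ := Prod.mk.inj h
      simp only at h1 h2
      obtain rfl := Fin.ext h1
      obtain rfl : s = t := Fin.ext (by omega)
      rfl
    · obtain ⟨h1, h2⟩ := Prod.mk.inj h
      simp only at h1 h2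
      omega
    · obtain ⟨h1, h2⟩ := Prod.mk.inj h
      simp only at h1 h2
      omega
    · obtain ⟨h1, h2⟩ := Prod.mk.inj h
      simp only at h1 h2
      obtain rfl := Fin.ext h2
      obtain rfl : s = t := Fin.ext (by omega)
      rfl
  · rintro ⟨p, q⟩ hpq
    rcases (hY p q).1 ((Y.mem_cells _).1 hpq) with ⟨hp, h1, h2⟩ | ⟨hq, h1, h2⟩
    · exact ⟨⟨⟨p, hp⟩, .inl ⟨q - p, by omega⟩⟩, mem_univ _, by simp; omega⟩
    · exact ⟨⟨⟨q, hq⟩, .inr ⟨p - (q + 1), by omega⟩⟩, mem_univ _, by simp; omega⟩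

theorem HasFrobenius.sum_arm {l : ℕ} {m k : Fin l → ℕ} {Y : YoungDiagram}
    (hY : HasFrobenius m k Y) {g : ℕ × ℕ → ℝ} (hg : ∀ c, ¬ Y.IsCorner c → g c = 0) :
    (∑ i, if m i = 0 then 0 else g ((i : ℕ), i + m i)) =
      ∑ c ∈ Y.cells with c.1 < c.2, g c := by
  simp_rw [← ite_not (p := m _ = 0)]
  rw [← sum_filter]
  refine sum_of_injOn (fun i : Fin l => ((i : ℕ), (i : ℕ) + m i)) ?_ ?_ ?_ fun _ _ => rfl
  · intro i _ j _ h
    exact Fin.ext (Prod.mk.inj h).1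
  · intro i hi
    simp only [coe_filter, Set.mem_ofPred_eq, mem_univ, true_and, mem_cells] at hi ⊢
    exact ⟨hY.mem_arm i, by omega⟩
  · rintro ⟨p, q⟩ hpq hne
    simp only [mem_filter] at hpq
    refine hg _ fun hc => hne ?_
    obtain ⟨hp, rfl⟩ := hY.eq_arm_of_isCorner hc hpq.2.le
    refine ⟨⟨p, hp⟩, ?_, rfl⟩
    simp only [coe_filter, Set.mem_ofPred_eq, mem_univ, true_and]
    omega

theorem HasFrobenius.sum_diag {l : ℕ} {m k : Fin l → ℕ} {Y : YoungDiagram}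
    (hY : HasFrobenius m k Y) {g : ℕ × ℕ → ℝ} (hg : ∀ c, ¬ Y.IsCorner c → g c = 0) :
    (∑ i : Fin l, if m i = 0 ∧ k i = 0 then g ((i : ℕ), (i : ℕ)) else 0) =
      ∑ c ∈ Y.cells with c.1 = c.2, g c := by
  rw [← sum_filter]
  refine sum_of_injOn (fun i : Fin l => ((i : ℕ), (i : ℕ))) ?_ ?_ ?_ fun _ _ => rfl
  · intro i _ j _ h
    exact Fin.ext (Prod.mk.inj h).1
  · intro i hi
    simp only [coe_filter, Set.mem_ofPred_eq, mem_univ, true_and, mem_cells] at hi ⊢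
    simpa [hi.1] using hY.mem_arm i
  · rintro ⟨p, q⟩ hpq hne
    simp only [mem_filter] at hpq
    obtain ⟨-, rfl⟩ := hpq
    refine hg _ fun hc => hne ?_
    obtain ⟨hp, -⟩ := hY.eq_arm_of_isCorner hc le_rfl
    refine ⟨⟨p, hp⟩, ?_, rfl⟩
    simp only [coe_filter, Set.mem_ofPred_eq, mem_univ, true_and]
    exact hY.eq_zero_of_isCorner_diag (i := ⟨p, hp⟩) hc

theorem HasFrobenius.sum_cells {l : ℕ} {m k : Fin l → ℕ} {Y : YoungDiagram}
    (hY : HasFrobenius m k Y) {g : ℕ × ℕ → ℝ} (hg : ∀ c, ¬ Y.IsCorner c → g c = 0) :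
    ∑ c ∈ Y.cells, g c =
      (∑ i, if m i = 0 then 0 else g ((i : ℕ), i + m i)) +
      (∑ i, if k i = 0 then 0 else g (i + k i, (i : ℕ))) +
      ∑ i : Fin l, if m i = 0 ∧ k i = 0 then g ((i : ℕ), (i : ℕ)) else 0 := by
  have hleg := hY.transpose.sum_arm (g := g ∘ Prod.swap)
    fun c hc => hg _ fun h => hc (isCorner_transpose.2 h)
  have hswap : ∑ c ∈ Y.transpose.cells with c.1 < c.2, (g ∘ Prod.swap) c =
      ∑ c ∈ Y.cells with c.2 < c.1, g c := by
    refine sum_nbij' Prod.swap Prod.swap ?_ ?_ ?_ ?_ ?_ <;> simp [mem_transpose]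
  rw [hswap] at hleg
  simp only [Function.comp_apply, Prod.swap_prod_mk] at hleg
  rw [hY.sum_arm hg, hleg, hY.sum_diag hg,
    ← sum_filter_add_sum_filter_not Y.cells (fun c => c.1 < c.2), add_assoc,
    ← sum_filter_add_sum_filter_not (Y.cells.filter fun c => ¬ c.1 < c.2) (fun c => c.2 < c.1),
    filter_filter, filter_filter]
  congr 2 <;> refine sum_congr (filter_congr fun c _ => ?_) fun _ _ => rfl <;> omega

end YoungDiagram

open YoungDiagram

theorem det_hookMatrix_eq_zero_left {l : ℕ} {m k : Fin l → ℕ} (h : ¬ Function.Injective m) :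
    (hookMatrix m k).det = 0 := by
  simp only [Function.Injective, not_forall] at h
  obtain ⟨i, j, hij, hne⟩ := h
  exact Matrix.det_zero_of_row_eq hne (funext fun b => by simp [hookMatrix, hij])

theorem det_hookMatrix_swap {l : ℕ} (m k : Fin l → ℕ) :
    (hookMatrix k m).det = (hookMatrix m k).det := by
  rw [← Matrix.det_transpose]
  congr 1
  ext a b
  simp only [hookMatrix, Matrix.transpose_apply, Matrix.of_apply, hookEntry]
  ring

theorem StrictAnti.update_pred_of_injective {l : ℕ} {m : Fin l → ℕ} (hm : StrictAnti m)
    {i : Fin l} (h : Function.Injective (Function.update m i (m i - 1))) :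
    StrictAnti (Function.update m i (m i - 1)) := by
  refine Antitone.strictAnti_of_injective (fun a b hab => ?_) h
  rcases hab.lt_or_eq with hab | rfl
  · have h1 := hm hab
    by_cases hb : b = i
    · subst hb
      rw [Function.update_self, Function.update_of_ne hab.ne]
      omega
    · rw [Function.update_of_ne hb]
      by_cases ha : a = i
      · subst ha
        rw [Function.update_self]
        omega
      · rw [Function.update_of_ne ha]
        omega
  · rfl

theorem Matrix.adjugate_apply_self_eq_det_submatrix {l : ℕ} {R : Type*} [CommRing R]
    (A : Matrix (Fin (l + 1)) (Fin (l + 1)) R) (i : Fin (l + 1)) :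
    A.adjugate i i = (A.submatrix i.succAbove i.succAbove).det := by
  rw [adjugate_fin_succ_eq_det_submatrix, Even.neg_one_pow ⟨_, rfl⟩, one_mul]

namespace YoungDiagram

/-- The contribution of the cell `c` to the branching rule for the number of standard Young
tableaux of shape `Y`, divided by `(|Y| - 1)!`. -/
noncomputable def branch (Y : YoungDiagram) (c : ℕ × ℕ) : ℝ :=
  open Classical in
  if Y.IsCorner c then
    ((Y.removeAbove c).numStandard : ℝ) / ((Y.removeAbove c).card.factorial : ℝ) else 0

theorem numStandard_div_factorial {Y : YoungDiagram} (hY : 0 < Y.card) :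
    (Y.card : ℝ) * ((Y.numStandard : ℝ) / (Y.card.factorial : ℝ)) =
      ∑ c ∈ Y.cells, Y.branch c := by
  classical
  obtain ⟨n, hn⟩ := Nat.exists_eq_succ_of_ne_zero hY.ne'
  have hbranch : ∀ c, Y.branch c =
      ((if Y.IsCorner c then (Y.removeAbove c).numStandard else 0 : ℕ) : ℝ) /
        (n.factorial : ℝ) := fun c => by
    rw [branch]
    split_ifs with hc
    · have := hc.card_removeAbove
      rw [show (Y.removeAbove c).card = n by omega]
    · simp
  simp_rw [hbranch]
  rw [← sum_div, ← Nat.cast_sum, numStandard_eq_sum hY, hn, Nat.factorial_succ]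
  have : (n.factorial : ℝ) ≠ 0 := by positivity
  push_cast
  field_simp

theorem HasFrobenius.branch_arm {l : ℕ} {m k : Fin l → ℕ} {Y : YoungDiagram}
    (hY : HasFrobenius m k Y) (hm : StrictAnti m) {i : Fin l} (hmi : m i ≠ 0)
    (ih : ∀ m' : Fin l → ℕ, StrictAnti m' → ∀ Z : YoungDiagram, Z.card < Y.card →
      HasFrobenius m' k Z →
        (hookMatrix m' k).det = (Z.numStandard : ℝ) / (Z.card.factorial : ℝ)) :
    Y.branch ((i : ℕ), i + m i) = (hookMatrix (Function.update m i (m i - 1)) k).det := by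
  rw [branch]
  split_ifs with hc
  · have hm' := hY.strictAnti_update hm (Nat.pos_of_ne_zero hmi) hc
    have hlt := hc.card_removeAbove
    exact (ih _ hm' _ (by omega) (hY.removeAbove_arm (Nat.pos_of_ne_zero hmi) hm')).symm
  · refine (det_hookMatrix_eq_zero_left fun hinj => hc ?_).symm
    exact hY.isCorner_arm (Nat.pos_of_ne_zero hmi) (hm.update_pred_of_injective hinj)

theorem HasFrobenius.branch_leg {l : ℕ} {m k : Fin l → ℕ} {Y : YoungDiagram}
    (hY : HasFrobenius m k Y) (hk : StrictAnti k) {i : Fin l} (hki : k i ≠ 0)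
    (ih : ∀ k' : Fin l → ℕ, StrictAnti k' → ∀ Z : YoungDiagram, Z.card < Y.card →
      HasFrobenius m k' Z →
        (hookMatrix m k').det = (Z.numStandard : ℝ) / (Z.card.factorial : ℝ)) :
    Y.branch (i + k i, (i : ℕ)) = (hookMatrix m (Function.update k i (k i - 1))).det := by
  have hpos := Nat.pos_of_ne_zero hki
  rw [branch]
  split_ifs with hc
  · have hk' := hY.transpose.strictAnti_update hk hpos (isCorner_transpose.2 hc)
    have hlt := hc.card_removeAbove
    have hZ := hY.transpose.removeAbove_arm hpos hk'
    rw [removeAbove_transpose] at hZ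
    have hZ' := hZ.transpose
    rw [transpose_transpose, Prod.swap_prod_mk] at hZ'
    exact (ih _ hk' _ (by omega) hZ').symm
  · rw [← det_hookMatrix_swap]
    refine (det_hookMatrix_eq_zero_left fun hinj => hc ?_).symm
    exact isCorner_transpose.1
      (hY.transpose.isCorner_arm hpos (hk.update_pred_of_injective hinj))

theorem HasFrobenius.branch_diag {l : ℕ} {m k : Fin l → ℕ} {Y : YoungDiagram}
    (hY : HasFrobenius m k Y) (hm : StrictAnti m) (hk : StrictAnti k) {i : Fin l}
    (hmi : m i = 0) (hki : k i = 0)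
    (ih : ∀ (l' : ℕ) (m' k' : Fin l' → ℕ), StrictAnti m' → StrictAnti k' →
      ∀ Z : YoungDiagram, Z.card < Y.card → HasFrobenius m' k' Z →
        (hookMatrix m' k').det = (Z.numStandard : ℝ) / (Z.card.factorial : ℝ)) :
    Y.branch ((i : ℕ), (i : ℕ)) = (hookMatrix m k).adjugate i i := by
  have hc := hY.isCorner_diag hmi hki
  have hlt := hc.card_removeAbove
  rw [branch, if_pos hc]
  obtain _ | l := l
  · exact i.elim0
  rw [Matrix.adjugate_apply_self_eq_det_submatrix]
  have hi : StrictMono i.succAbove := Fin.strictMono_succAbove i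
  exact (ih l _ _ (hm.comp_strictMono hi) (hk.comp_strictMono hi) _ (by omega)
    (hY.removeAbove_diag hm hmi hki)).symm

theorem HasFrobenius.det_hookMatrix {l : ℕ} {m k : Fin l → ℕ} {Y : YoungDiagram}
    (hm : StrictAnti m) (hk : StrictAnti k) (hY : HasFrobenius m k Y) :
    (hookMatrix m k).det = (Y.numStandard : ℝ) / (Y.card.factorial : ℝ) := by
  induction hn : Y.card using Nat.strong_induction_on generalizing l m k Y with
  | _ n ih =>
  subst hn
  have ih' : ∀ (l' : ℕ) (m' k' : Fin l' → ℕ), StrictAnti m' → StrictAnti k' →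
      ∀ Z : YoungDiagram, Z.card < Y.card → HasFrobenius m' k' Z →
        (hookMatrix m' k').det = (Z.numStandard : ℝ) / (Z.card.factorial : ℝ) :=
    fun l' m' k' hm' hk' Z hlt hZ => ih _ hlt hm' hk' hZ rfl
  rcases Nat.eq_zero_or_pos Y.card with h0 | hpos
  · have hcard := hY.card_eq
    obtain rfl : l = 0 := by omega
    rw [numStandard_of_card_eq_zero h0, h0]
    simp
  have hsum := hY.sum_cells (g := Y.branch) fun c hc => if_neg hc
  have hrec := det_hookMatrix_recurrence m k
  rw [← hY.card_eq] at hrec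
  have hdiag : ∀ i : Fin l,
      (∑ j, if m i = 0 ∧ k j = 0 then (hookMatrix m k).adjugate j i else 0) =
      if m i = 0 ∧ k i = 0 then Y.branch ((i : ℕ), (i : ℕ)) else 0 := fun i => by
    rw [sum_eq_single i]
    · refine ite_congr rfl (fun h => ?_) fun _ => rfl
      exact (hY.branch_diag hm hk h.1 h.2 ih').symm
    · intro j _ hji
      refine if_neg fun h => hji ?_
      obtain _ | l := l
      · exact i.elim0
      rw [eq_last_of_strictAnti_of_eq_zero hm h.1, eq_last_of_strictAnti_of_eq_zero hk h.2]
    · simp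
  have harm : ∀ i : Fin l, (if m i = 0 then 0 else Y.branch ((i : ℕ), i + m i)) =
      if m i = 0 then 0 else (hookMatrix (Function.update m i (m i - 1)) k).det := fun i =>
    ite_congr rfl (fun _ => rfl) fun h =>
      hY.branch_arm hm h fun m' hm' => ih' l m' k hm' hk
  have hleg : ∀ i : Fin l, (if k i = 0 then 0 else Y.branch (i + k i, (i : ℕ))) =
      if k i = 0 then 0 else (hookMatrix m (Function.update k i (k i - 1))).det := fun i =>
    ite_congr rfl (fun _ => rfl) fun h =>
      hY.branch_leg hk h fun k' hk' => ih' l m k' hm hk'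
  simp_rw [hdiag] at hrec
  simp_rw [harm, hleg] at hsum
  rw [hrec, ← numStandard_div_factorial hpos] at hsum
  exact (mul_left_cancel₀ (Nat.cast_ne_zero.2 hpos.ne') hsum).symm

end YoungDiagram

/-- if `λ` is the partition with Frobenius coordinates
`(m₁,…,m_ℓ | k₁,…,k_ℓ)`, then `det[1/(j!·k!·(j+k+1))]_{j∈S,k∈T} = f^λ/|λ|!`,
where `f^λ` is the number of standard Young tableaux of shape `λ`. -/
theorem stmt12 (l : ℕ) (hl : 1 ≤ l) (m k : Fin l → ℕ)
    (hm : StrictAnti m) (hk : StrictAnti k)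
    (Y : YoungDiagram)
    (hY : ∀ i j : ℕ, (i, j) ∈ Y ↔
      ((∃ hi : i < l, i ≤ j ∧ j ≤ i + m ⟨i, hi⟩) ∨
       (∃ hj : j < l, j < i ∧ i ≤ j + k ⟨j, hj⟩))) :
    Y.card = l + ∑ i, (m i + k i) ∧
    Matrix.det (Matrix.of fun a b : Fin l =>
        (1 : ℝ) / ((Nat.factorial (m a) : ℝ) * (Nat.factorial (k b) : ℝ) *
          ((m a : ℝ) + (k b : ℝ) + 1)))
      = (Nat.card {f : ℕ × ℕ → ℕ // IsStandardYoungTableau Y f} : ℝ) /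
          (Nat.factorial Y.card : ℝ) := by
  exact ⟨HasFrobenius.card_eq hY, HasFrobenius.det_hookMatrix hm hk hY⟩
end

section
/- For every x > 0, the doubly indexed sum Σ_{(S,T)} (−1)^{|S|} ( det[ 1/( j! · k! · (j + k + 1) ) ]_{j∈S, k∈T} )² · exp( −x( Σ_{j∈S}(2j+1) + Σ_{k∈T}(2k+1) ) ), taken over all pairs (S, T) of finite subsets of {0,1,2,…} of equal cardinality (including the empty pair, which contributes 1), converges absolutely and equals Σ_λ (−1)^{ℓ(λ)} ( f^λ / |λ|! )² e^{−2|λ| x}, where the right-hand sum is over all partitions λ (including the empty partition, contributing 1), ℓ(λ) is the number of parts in the Frobenius decomposition of λ (i.e. the number of diagonal boxes of λ), and f^λ is the number of standard Young tableaux of shape λ. -/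
open Matrix Finset

/-- A standard filling of a finite set `A` of cells: a bijection onto `0, …, |A| - 1`, extended by
`0`, strictly increasing along rows and columns. -/
def IsStandardFilling (A : Finset (ℕ × ℕ)) (f : ℕ × ℕ → ℕ) : Prop :=
  Set.BijOn f (A : Set (ℕ × ℕ)) (Set.Iio A.card) ∧
  (∀ c ∈ A, ∀ d ∈ A, c.1 = d.1 → c.2 < d.2 → f c < f d) ∧
  (∀ c ∈ A, ∀ d ∈ A, c.2 = d.2 → c.1 < d.1 → f c < f d) ∧
  (∀ c : ℕ × ℕ, c ∉ A → f c = 0)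

/-- The number of standard fillings of a finite set of cells. -/
noncomputable def standardFillingCount (A : Finset (ℕ × ℕ)) : ℕ :=
  Nat.card {f : ℕ × ℕ → ℕ // IsStandardFilling A f}

/-- The cells of `A` that are last both in their row and in their column. -/
def cornerCells (A : Finset (ℕ × ℕ)) : Finset (ℕ × ℕ) :=
  A.filter fun c => ∀ d ∈ A, ¬(c.1 = d.1 ∧ c.2 < d.2) ∧ ¬(c.2 = d.2 ∧ c.1 < d.1)

namespace IsStandardFilling

variable {A : Finset (ℕ × ℕ)} {f g : ℕ × ℕ → ℕ} {c : ℕ × ℕ}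

theorem update_of_erase (hc : c ∈ cornerCells A) (hg : IsStandardFilling (A.erase c) g) :
    IsStandardFilling A (Function.update g c (A.card - 1)) := by
  obtain ⟨hb, hr, hcol, h0⟩ := hg
  obtain ⟨hcA, hmax⟩ := Finset.mem_filter.1 hc
  have hlt : ∀ d ∈ A, d ≠ c → g d < A.card - 1 := fun d hd hdc => by
    have := hb.mapsTo (Finset.mem_coe.2 (Finset.mem_erase.2 ⟨hdc, hd⟩))
    rwa [Set.mem_Iio, Finset.card_erase_of_mem hcA] at this
  have hpos : 0 < A.card := Finset.card_pos.2 ⟨c, hcA⟩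
  refine ⟨⟨?_, ?_, ?_⟩, ?_, ?_, ?_⟩
  · intro d hd
    by_cases hdc : d = c
    · subst hdc; simpa using hpos
    · have := hlt d hd hdc
      simp [Function.update_of_ne hdc]; omega
  · intro d hd e he hde
    by_cases hdc : d = c <;> by_cases hec : e = c
    · rw [hdc, hec]
    · subst hdc
      have := hlt e he hec
      simp [Function.update_of_ne hec] at hde; omega
    · subst hec
      have := hlt d hd hdc
      simp [Function.update_of_ne hdc] at hde; omega
    · rw [Function.update_of_ne hdc, Function.update_of_ne hec] at hde
      exact hb.injOn (Finset.mem_coe.2 (Finset.mem_erase.2 ⟨hdc, hd⟩))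
        (Finset.mem_coe.2 (Finset.mem_erase.2 ⟨hec, he⟩)) hde
  · intro n hn
    rw [Set.mem_Iio] at hn
    by_cases h : n = A.card - 1
    · exact ⟨c, hcA, by simp [h]⟩
    · obtain ⟨d, hd, rfl⟩ := hb.surjOn (show n ∈ Set.Iio (A.erase c).card by
        rw [Set.mem_Iio, Finset.card_erase_of_mem hcA]; omega)
      have hd' := Finset.mem_erase.1 (Finset.mem_coe.1 hd)
      exact ⟨d, hd'.2, Function.update_of_ne hd'.1 _ _⟩
  · intro d hd e he h1 h2
    have hdc : d ≠ c := by
      rintro rfl; exact (hmax e he).1 ⟨h1, h2⟩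
    rw [Function.update_of_ne hdc]
    by_cases hec : e = c
    · subst hec; simpa using hlt d hd hdc
    · rw [Function.update_of_ne hec]
      exact hr d (Finset.mem_erase.2 ⟨hdc, hd⟩) e (Finset.mem_erase.2 ⟨hec, he⟩) h1 h2
  · intro d hd e he h1 h2
    have hdc : d ≠ c := by
      rintro rfl; exact (hmax e he).2 ⟨h1, h2⟩
    rw [Function.update_of_ne hdc]
    by_cases hec : e = c
    · subst hec; simpa using hlt d hd hdc
    · rw [Function.update_of_ne hec]
      exact hcol d (Finset.mem_erase.2 ⟨hdc, hd⟩) e (Finset.mem_erase.2 ⟨hec, he⟩) h1 h2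
  · intro d hd
    have hdc : d ≠ c := by rintro rfl; exact hd hcA
    rw [Function.update_of_ne hdc]
    exact h0 d fun h => hd (Finset.mem_erase.1 h).2

theorem mem_cornerCells (hf : IsStandardFilling A f) (hcA : c ∈ A) (hfc : f c = A.card - 1) :
    c ∈ cornerCells A := by
  obtain ⟨hb, hr, hcol, -⟩ := hf
  refine Finset.mem_filter.2 ⟨hcA, fun d hd => ?_⟩
  have hlt : f d < A.card := hb.mapsTo (Finset.mem_coe.2 hd)
  refine ⟨fun h => ?_, fun h => ?_⟩
  · have := hr c hcA d hd h.1 h.2; omega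
  · have := hcol c hcA d hd h.1 h.2; omega

theorem erase (hf : IsStandardFilling A f) (hcA : c ∈ A) (hfc : f c = A.card - 1) :
    IsStandardFilling (A.erase c) (Function.update f c 0) := by
  obtain ⟨hb, hr, hcol, h0⟩ := hf
  have hmem : ∀ d ∈ A.erase c, d ≠ c ∧ d ∈ A := fun d hd => Finset.mem_erase.1 hd
  refine ⟨⟨?_, ?_, ?_⟩, ?_, ?_, ?_⟩
  · intro d hd
    obtain ⟨hdc, hd⟩ := hmem d hd
    have h1 : f d < A.card := hb.mapsTo (Finset.mem_coe.2 hd)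
    have h2 : f d ≠ f c := fun h => hdc (hb.injOn hd hcA h)
    rw [Set.mem_Iio, Finset.card_erase_of_mem hcA, Function.update_of_ne hdc]
    omega
  · intro d hd e he h
    obtain ⟨hdc, hd⟩ := hmem d hd
    obtain ⟨hec, he⟩ := hmem e he
    rw [Function.update_of_ne hdc, Function.update_of_ne hec] at h
    exact hb.injOn hd he h
  · intro n hn
    rw [Set.mem_Iio, Finset.card_erase_of_mem hcA] at hn
    obtain ⟨d, hd, rfl⟩ := hb.surjOn (show n ∈ Set.Iio A.card by rw [Set.mem_Iio]; omega)
    have hdc : d ≠ c := by rintro rfl; omega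
    exact ⟨d, Finset.mem_coe.2 (Finset.mem_erase.2 ⟨hdc, hd⟩), Function.update_of_ne hdc _ _⟩
  · intro d hd e he h1 h2
    obtain ⟨hdc, hd⟩ := hmem d hd
    obtain ⟨hec, he⟩ := hmem e he
    rw [Function.update_of_ne hdc, Function.update_of_ne hec]
    exact hr d hd e he h1 h2
  · intro d hd e he h1 h2
    obtain ⟨hdc, hd⟩ := hmem d hd
    obtain ⟨hec, he⟩ := hmem e he
    rw [Function.update_of_ne hdc, Function.update_of_ne hec]
    exact hcol d hd e he h1 h2
  · intro d hd
    by_cases hdc : d = c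
    · subst hdc; simp
    · rw [Function.update_of_ne hdc]
      exact h0 d fun h => hd (Finset.mem_erase.2 ⟨hdc, h⟩)

/-- A standard filling, as an embedding of its cells into `Fin |A|`. -/
def toEmbedding (hf : IsStandardFilling A f) : A ↪ Fin A.card where
  toFun c := ⟨f c, hf.1.mapsTo c.2⟩
  inj' c d h := Subtype.ext (hf.1.injOn c.2 d.2 (congrArg Fin.val h))

theorem toEmbedding_injective :
    Function.Injective fun f : {f : ℕ × ℕ → ℕ // IsStandardFilling A f} => f.2.toEmbedding := by
  intro f g h
  refine Subtype.ext (funext fun c => ?_)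
  by_cases hc : c ∈ A
  · exact congrArg Fin.val (DFunLike.congr_fun h ⟨c, hc⟩)
  · rw [f.2.2.2.2 c hc, g.2.2.2.2 c hc]

instance : Finite {f : ℕ × ℕ → ℕ // IsStandardFilling A f} :=
  Finite.of_injective _ toEmbedding_injective

end IsStandardFilling

theorem standardFillingCount_le_factorial (A : Finset (ℕ × ℕ)) :
    standardFillingCount A ≤ A.card.factorial := by
  refine (Nat.card_le_card_of_injective _
    (IsStandardFilling.toEmbedding_injective (A := A))).trans ?_
  simp [Nat.card_eq_fintype_card, Fintype.card_embedding_eq, Nat.descFactorial_self]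

theorem standardFillingCount_empty : standardFillingCount ∅ = 1 := by
  have : Unique {f : ℕ × ℕ → ℕ // IsStandardFilling ∅ f} :=
    { default := ⟨fun _ => 0, by simp [IsStandardFilling, Set.BijOn, Set.SurjOn, Set.MapsTo]⟩
      uniq := fun f => Subtype.ext (funext fun c => f.2.2.2.2 c (by simp)) }
  exact Nat.card_unique

theorem standardFillingCount_eq_sum {A : Finset (ℕ × ℕ)} (hA : A.Nonempty) :
    standardFillingCount A = ∑ c ∈ cornerCells A, standardFillingCount (A.erase c) := by
  let Ψ : (Σ c : cornerCells A, {g : ℕ × ℕ → ℕ // IsStandardFilling (A.erase c.1) g}) →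
      {f : ℕ × ℕ → ℕ // IsStandardFilling A f} :=
    fun p => ⟨Function.update p.2.1 p.1.1 (A.card - 1), p.2.2.update_of_erase p.1.2⟩
  have hΨ : Function.Bijective Ψ := by
    constructor
    · rintro ⟨⟨c, hc⟩, g, hg⟩ ⟨⟨d, hd⟩, g', hg'⟩ h
      have hF : Function.update g c (A.card - 1) = Function.update g' d (A.card - 1) :=
        congrArg Subtype.val h
      have hcd : c = d := by
        refine (hg.update_of_erase hc).1.injOn (Finset.mem_filter.1 hc).1
          (Finset.mem_filter.1 hd).1 ?_
        conv_rhs => rw [hF]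
        simp
      subst hcd
      have : g = g' := by
        funext e
        by_cases he : e = c
        · subst he
          rw [hg.2.2.2 e (by simp), hg'.2.2.2 e (by simp)]
        · simpa [Function.update_of_ne he] using congrFun hF e
      subst this
      rfl
    · rintro ⟨f, hf⟩
      have hpos := Finset.card_pos.2 hA
      obtain ⟨c, hc, hfc⟩ := hf.1.surjOn (show A.card - 1 ∈ Set.Iio A.card by
        rw [Set.mem_Iio]; omega)
      refine ⟨⟨⟨c, hf.mem_cornerCells hc hfc⟩, _, hf.erase hc hfc⟩, Subtype.ext ?_⟩
      simp [Ψ, ← hfc]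
  rw [standardFillingCount, ← Nat.card_congr (Equiv.ofBijective Ψ hΨ), Nat.card_sigma]
  exact Finset.sum_coe_sort (cornerCells A) fun c => standardFillingCount (A.erase c)

/-- The number of elements of `S` that are at least `d`. -/
def tailCount (S : Finset ℕ) (d : ℕ) : ℕ := (S.filter (d ≤ ·)).card

theorem tailCount_zero (S : Finset ℕ) : tailCount S 0 = S.card := by simp [tailCount]

theorem tailCount_eq_succ_add (S : Finset ℕ) (d : ℕ) :
    tailCount S d = tailCount S (d + 1) + if d ∈ S then 1 else 0 := by
  have h : ∀ x, (if d ≤ x then 1 else 0) = (if d + 1 ≤ x then 1 else 0) + if x = d then 1 else 0 :=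
    fun x => by split_ifs <;> omega
  simp only [tailCount, Finset.card_filter]
  rw [Finset.sum_congr rfl fun x _ => h x, Finset.sum_add_distrib]
  simp

theorem tailCount_antitone (S : Finset ℕ) : Antitone (tailCount S) :=
  antitone_nat_of_succ_le fun d => by rw [tailCount_eq_succ_add S d]; omega

theorem tailCount_le_card (S : Finset ℕ) (d : ℕ) : tailCount S d ≤ S.card :=
  Finset.card_filter_le _ _

theorem le_sup_of_tailCount_pos {S : Finset ℕ} {d : ℕ} (h : 0 < tailCount S d) :
    d ≤ S.sup id := by
  obtain ⟨x, hx⟩ := Finset.card_pos.1 h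
  obtain ⟨hxS, hdx⟩ := Finset.mem_filter.1 hx
  exact hdx.trans (Finset.le_sup (f := id) hxS)

/-- Replacing `m` by `m - 1` in a set containing `m`. -/
def lowerElement (S : Finset ℕ) (m : ℕ) : Finset ℕ := insert (m - 1) (S.erase m)

theorem tailCount_lowerElement {S : Finset ℕ} {m : ℕ} (hm : m ∈ S) (hm1 : 1 ≤ m)
    (hm' : m - 1 ∉ S) (d : ℕ) :
    tailCount S d = tailCount (lowerElement S m) d + if d = m then 1 else 0 := by
  have h1 : m - 1 ∉ S.erase m := fun h => hm' (Finset.mem_erase.1 h).2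
  simp only [tailCount, Finset.card_filter]
  conv_lhs => rw [← Finset.insert_erase hm]
  rw [lowerElement, Finset.sum_insert h1, Finset.sum_insert (by simp)]
  split_ifs <;> omega

theorem card_lowerElement {S : Finset ℕ} {m : ℕ} (hm : m ∈ S) (hm' : m - 1 ∉ S) :
    (lowerElement S m).card = S.card := by
  rw [lowerElement, Finset.card_insert_of_notMem fun h => hm' (Finset.mem_erase.1 h).2,
    Finset.card_erase_add_one hm]

theorem tailCount_erase_zero {S : Finset ℕ} (h : 0 ∈ S) (d : ℕ) :
    tailCount S d = tailCount (S.erase 0) d + if d = 0 then 1 else 0 := by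
  simp only [tailCount, Finset.card_filter]
  conv_lhs => rw [← Finset.insert_erase h]
  rw [Finset.sum_insert (by simp)]
  split_ifs <;> omega

theorem eq_of_tailCount_eq {S S' : Finset ℕ} (h : ∀ d, tailCount S d = tailCount S' d) :
    S = S' := by
  ext d
  have h1 := tailCount_eq_succ_add S d
  have h2 := tailCount_eq_succ_add S' d
  rw [h d, h (d + 1)] at h1
  split_ifs at h1 h2 with a b b <;> first | omega | simp [a, b]

/-- The cells of the diagram with Frobenius coordinates `S` (arms) and `T` (legs): the number of
cells `(i, j)` with `j - i = d ≥ 0` is the number of elements of `S` that are at least `d`, and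
symmetrically for `T` below the diagonal. -/
def frobeniusCells (S T : Finset ℕ) : Finset (ℕ × ℕ) :=
  (Finset.range (S.card + T.card + S.sup id + T.sup id + 1) ×ˢ
    Finset.range (S.card + T.card + S.sup id + T.sup id + 1)).filter fun c =>
      (c.1 ≤ c.2 → c.1 < tailCount S (c.2 - c.1)) ∧ (c.2 ≤ c.1 → c.2 < tailCount T (c.1 - c.2))

theorem mem_frobeniusCells {S T : Finset ℕ} {i j : ℕ} :
    (i, j) ∈ frobeniusCells S T ↔
      (i ≤ j → i < tailCount S (j - i)) ∧ (j ≤ i → j < tailCount T (i - j)) := by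
  simp only [frobeniusCells, Finset.mem_filter, Finset.mem_product, Finset.mem_range,
    and_iff_right_iff_imp]
  rintro ⟨h1, h2⟩
  rcases le_total i j with hij | hij
  · have h := h1 hij
    have h3 := tailCount_le_card S (j - i)
    have h4 := le_sup_of_tailCount_pos (by omega : 0 < tailCount S (j - i))
    omega
  · have h := h2 hij
    have h3 := tailCount_le_card T (i - j)
    have h4 := le_sup_of_tailCount_pos (by omega : 0 < tailCount T (i - j))
    omega

theorem mk_mem_frobeniusCells_swap {S T : Finset ℕ} {i j : ℕ} :
    (i, j) ∈ frobeniusCells S T ↔ (j, i) ∈ frobeniusCells T S := by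
  rw [mem_frobeniusCells, mem_frobeniusCells, and_comm]

theorem add_mem_frobeniusCells {S T : Finset ℕ} (hST : S.card = T.card) {i d : ℕ} :
    (i, i + d) ∈ frobeniusCells S T ↔ i < tailCount S d := by
  rw [mem_frobeniusCells]
  constructor
  · intro h; simpa using h.1 (by omega)
  · intro h
    refine ⟨fun _ => by simpa using h, fun h' => ?_⟩
    obtain rfl : d = 0 := by omega
    rw [tailCount_zero] at h
    simp [tailCount_zero]; omega

theorem add_mem_frobeniusCells' {S T : Finset ℕ} (hST : S.card = T.card) {j d : ℕ} :
    (j + d, j) ∈ frobeniusCells S T ↔ j < tailCount T d := by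
  rw [mk_mem_frobeniusCells_swap, add_mem_frobeniusCells hST.symm]

theorem mem_frobeniusCells_of_succ_right {S T : Finset ℕ} (hST : S.card = T.card) {i j : ℕ}
    (h : (i, j + 1) ∈ frobeniusCells S T) : (i, j) ∈ frobeniusCells S T := by
  rcases le_or_gt i j with hij | hij
  · obtain ⟨d, rfl⟩ := Nat.exists_eq_add_of_le hij
    rw [add_assoc, add_mem_frobeniusCells hST] at h
    rw [add_mem_frobeniusCells hST]
    exact h.trans_le (tailCount_antitone S (by omega))
  · obtain ⟨d, rfl⟩ := Nat.exists_eq_add_of_lt hij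
    rw [show j + d + 1 = j + 1 + d by omega, add_mem_frobeniusCells' hST] at h
    rw [add_assoc, add_mem_frobeniusCells' hST]
    have := tailCount_eq_succ_add T d
    split_ifs at this <;> omega

theorem mem_frobeniusCells_of_succ_left {S T : Finset ℕ} (hST : S.card = T.card) {i j : ℕ}
    (h : (i + 1, j) ∈ frobeniusCells S T) : (i, j) ∈ frobeniusCells S T := by
  rw [mk_mem_frobeniusCells_swap] at h ⊢
  exact mem_frobeniusCells_of_succ_right hST.symm h

theorem frobeniusCells_down {S T : Finset ℕ} (hST : S.card = T.card) {i j i' j' : ℕ}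
    (hi : i ≤ i') (hj : j ≤ j') (h : (i', j') ∈ frobeniusCells S T) :
    (i, j) ∈ frobeniusCells S T := by
  have h1 : (i, j') ∈ frobeniusCells S T := by
    induction i', hi using Nat.le_induction with
    | base => exact h
    | succ n _ ih => exact ih (mem_frobeniusCells_of_succ_left hST h)
  clear h
  induction j', hj using Nat.le_induction with
  | base => exact h1
  | succ n _ ih => exact ih (mem_frobeniusCells_of_succ_right hST h1)

theorem mk_mem_cornerCells {S T : Finset ℕ} (hST : S.card = T.card) {i j : ℕ} :
    (i, j) ∈ cornerCells (frobeniusCells S T) ↔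
      (i, j) ∈ frobeniusCells S T ∧ (i + 1, j) ∉ frobeniusCells S T ∧
        (i, j + 1) ∉ frobeniusCells S T := by
  rw [cornerCells, Finset.mem_filter]
  refine and_congr_right fun _ => ⟨fun h => ⟨fun h1 => ?_, fun h1 => ?_⟩, fun h d hd => ?_⟩
  · exact (h _ h1).2 ⟨rfl, by simp⟩
  · exact (h _ h1).1 ⟨rfl, by simp⟩
  · obtain ⟨d1, d2⟩ := d
    constructor
    · rintro ⟨h1, h2⟩
      simp only at h1 h2
      subst h1
      exact h.2 (frobeniusCells_down hST le_rfl h2 hd)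
    · rintro ⟨h1, h2⟩
      simp only at h1 h2
      subst h1
      exact h.1 (frobeniusCells_down hST h2 le_rfl hd)

theorem mk_mem_cornerCells_swap {S T : Finset ℕ} (hST : S.card = T.card) {i j : ℕ} :
    (i, j) ∈ cornerCells (frobeniusCells S T) ↔ (j, i) ∈ cornerCells (frobeniusCells T S) := by
  rw [mk_mem_cornerCells hST, mk_mem_cornerCells hST.symm, mk_mem_frobeniusCells_swap,
    mk_mem_frobeniusCells_swap (i := i + 1), mk_mem_frobeniusCells_swap (j := j + 1)]
  tauto

theorem mem_cornerCells_above_iff {S T : Finset ℕ} (hST : S.card = T.card) {i d : ℕ} :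
    (i, i + (d + 1)) ∈ cornerCells (frobeniusCells S T) ↔
      d + 1 ∈ S ∧ d ∉ S ∧ i = tailCount S (d + 2) := by
  rw [mk_mem_cornerCells hST, show i + (d + 1) = i + 1 + d by omega, add_mem_frobeniusCells hST,
    show i + 1 + d = i + (d + 1) by omega, add_mem_frobeniusCells hST,
    show i + (d + 1) + 1 = i + (d + 2) by omega, add_mem_frobeniusCells hST]
  have h1 := tailCount_eq_succ_add S d
  have h2 : tailCount S (d + 1) = tailCount S (d + 2) + _ := tailCount_eq_succ_add S (d + 1)
  by_cases hd : d ∈ S <;> by_cases hd' : d + 1 ∈ S <;>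
    simp only [hd, hd', if_true, if_false, not_true, not_false_iff, true_and, false_and, and_false,
      iff_false] at h1 h2 ⊢ <;> omega

theorem mem_cornerCells_diag_iff {S T : Finset ℕ} (hST : S.card = T.card) {i : ℕ} :
    (i, i) ∈ cornerCells (frobeniusCells S T) ↔ 0 ∈ S ∧ 0 ∈ T ∧ i + 1 = S.card := by
  have e := add_mem_frobeniusCells hST (i := i) (d := 0)
  rw [add_zero] at e
  rw [mk_mem_cornerCells hST, add_mem_frobeniusCells hST, add_mem_frobeniusCells' hST, e]
  have h1 := tailCount_eq_succ_add S 0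
  have h2 := tailCount_eq_succ_add T 0
  rw [tailCount_zero, zero_add] at h1 h2
  rw [tailCount_zero]
  by_cases hS : 0 ∈ S <;> by_cases hT : 0 ∈ T <;>
    simp only [hS, hT, if_true, if_false, true_and, false_and, and_false, iff_false] at h1 h2 ⊢ <;>
    omega

theorem frobeniusCells_erase_above {S T : Finset ℕ} (hST : S.card = T.card) {d : ℕ}
    (hd : d + 1 ∈ S) (hd' : d ∉ S) :
    (frobeniusCells S T).erase (tailCount S (d + 2), tailCount S (d + 2) + (d + 1)) =
      frobeniusCells (lowerElement S (d + 1)) T := by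
  ext ⟨i, j⟩
  have hN := tailCount_lowerElement hd (by omega) (by simpa using hd')
  have h2 : tailCount S (d + 1) = tailCount S (d + 2) + _ := tailCount_eq_succ_add S (d + 1)
  rw [if_pos hd] at h2
  rw [Finset.mem_erase]
  rcases le_or_gt i j with hij | hij
  · obtain ⟨e, rfl⟩ := Nat.exists_eq_add_of_le hij
    rw [add_mem_frobeniusCells hST, add_mem_frobeniusCells
      ((card_lowerElement hd (by simpa using hd')).trans hST), hN e]
    by_cases he : e = d + 1
    · subst he
      have := hN (d + 1)
      simp only [if_true] at this ⊢
      simp only [ne_eq, Prod.mk.injEq]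
      omega
    · simp only [he, if_false, ne_eq, Prod.mk.injEq]
      omega
  · simp only [mem_frobeniusCells, ne_eq, Prod.mk.injEq]
    constructor
    · exact fun h => ⟨fun h' => absurd h' (by omega), h.2.2⟩
    · exact fun h => ⟨by omega, fun h' => absurd h' (by omega), h.2⟩

theorem frobeniusCells_erase_below {S T : Finset ℕ} (hST : S.card = T.card) {d : ℕ}
    (hd : d + 1 ∈ T) (hd' : d ∉ T) :
    (frobeniusCells S T).erase (tailCount T (d + 2) + (d + 1), tailCount T (d + 2)) =
      frobeniusCells S (lowerElement T (d + 1)) := by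
  ext ⟨i, j⟩
  rw [mk_mem_frobeniusCells_swap (T := lowerElement T (d + 1)),
    ← frobeniusCells_erase_above hST.symm hd hd', Finset.mem_erase, Finset.mem_erase,
    mk_mem_frobeniusCells_swap]
  simp [and_comm]

theorem frobeniusCells_erase_diag {S T : Finset ℕ} (hST : S.card = T.card)
    (hS : 0 ∈ S) (hT : 0 ∈ T) :
    (frobeniusCells S T).erase (S.card - 1, S.card - 1) =
      frobeniusCells (S.erase 0) (T.erase 0) := by
  ext ⟨i, j⟩
  have hc : (S.erase 0).card = (T.erase 0).card := by
    rw [Finset.card_erase_of_mem hS, Finset.card_erase_of_mem hT, hST]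
  have hpos := Finset.card_pos.2 ⟨0, hS⟩
  have h0 := tailCount_zero S
  rw [Finset.mem_erase]
  rcases le_total i j with hij | hij
  · obtain ⟨e, rfl⟩ := Nat.exists_eq_add_of_le hij
    rw [add_mem_frobeniusCells hST, add_mem_frobeniusCells hc, tailCount_erase_zero hS e]
    have := tailCount_erase_zero hS 0
    by_cases he : e = 0
    · subst he
      simp only [if_true, ne_eq, Prod.mk.injEq] at this ⊢
      omega
    · simp only [he, if_false, ne_eq, Prod.mk.injEq]
      omega
  · obtain ⟨e, rfl⟩ := Nat.exists_eq_add_of_le hij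
    rw [add_mem_frobeniusCells' hST, add_mem_frobeniusCells' hc, tailCount_erase_zero hT e]
    have h0' := tailCount_zero T
    have := tailCount_erase_zero hT 0
    by_cases he : e = 0
    · subst he
      simp only [if_true, ne_eq, Prod.mk.injEq] at this ⊢
      omega
    · simp only [he, if_false, ne_eq, Prod.mk.injEq]
      omega

/-- The elements `m ≥ 1` of `S` that can be replaced by `m - 1`. -/
def lowerableElements (S : Finset ℕ) : Finset ℕ := S.filter fun m => 1 ≤ m ∧ m - 1 ∉ S

theorem sum_cornerCells {S T : Finset ℕ} (hST : S.card = T.card) (F : Finset (ℕ × ℕ) → ℝ) :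
    ∑ c ∈ cornerCells (frobeniusCells S T), F ((frobeniusCells S T).erase c) =
      ∑ m ∈ lowerableElements S, F (frobeniusCells (lowerElement S m) T) +
      ∑ k ∈ lowerableElements T, F (frobeniusCells S (lowerElement T k)) +
      if 0 ∈ S ∧ 0 ∈ T then F (frobeniusCells (S.erase 0) (T.erase 0)) else 0 := by
  rw [← Finset.sum_filter_add_sum_filter_not _ (fun c : ℕ × ℕ => c.1 < c.2),
    ← Finset.sum_filter_add_sum_filter_not
      ((cornerCells (frobeniusCells S T)).filter fun c => ¬ c.1 < c.2) (fun c => c.2 < c.1),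
    add_assoc]
  congr 1
  · refine (Finset.sum_bij (fun m _ => (tailCount S (m + 1), tailCount S (m + 1) + m))
      ?_ ?_ ?_ ?_).symm
    · intro m hm
      obtain ⟨hm, hm1, hm'⟩ := Finset.mem_filter.1 hm
      obtain ⟨d, rfl⟩ := Nat.exists_eq_add_of_le' hm1
      rw [Finset.mem_filter, mem_cornerCells_above_iff hST]
      exact ⟨⟨hm, hm', rfl⟩, by simp only; omega⟩
    · intro m _ m' _ h
      simp only [Prod.mk.injEq] at h
      omega
    · rintro ⟨i, j⟩ hc
      obtain ⟨hc, hij⟩ := Finset.mem_filter.1 hc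
      obtain ⟨d, rfl⟩ : ∃ d, j = i + d + 1 := Nat.exists_eq_add_of_lt hij
      rw [add_assoc, mem_cornerCells_above_iff hST] at hc
      refine ⟨d + 1, Finset.mem_filter.2 ⟨hc.1, by omega, hc.2.1⟩, ?_⟩
      rw [hc.2.2]; rfl
    · intro m hm
      obtain ⟨hm, hm1, hm'⟩ := Finset.mem_filter.1 hm
      obtain ⟨d, rfl⟩ := Nat.exists_eq_add_of_le' hm1
      rw [frobeniusCells_erase_above hST hm hm']
  congr 1
  · refine (Finset.sum_bij (fun m _ => (tailCount T (m + 1) + m, tailCount T (m + 1)))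
      ?_ ?_ ?_ ?_).symm
    · intro m hm
      obtain ⟨hm, hm1, hm'⟩ := Finset.mem_filter.1 hm
      obtain ⟨d, rfl⟩ := Nat.exists_eq_add_of_le' hm1
      rw [Finset.mem_filter, Finset.mem_filter, mk_mem_cornerCells_swap hST,
        mem_cornerCells_above_iff hST.symm]
      exact ⟨⟨⟨hm, hm', rfl⟩, by simp only; omega⟩, by simp only; omega⟩
    · intro m _ m' _ h
      simp only [Prod.mk.injEq] at h
      omega
    · rintro ⟨i, j⟩ hc
      obtain ⟨hc, hij⟩ := Finset.mem_filter.1 hc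
      obtain ⟨d, rfl⟩ : ∃ d, i = j + d + 1 := Nat.exists_eq_add_of_lt hij
      have hc := (Finset.mem_filter.1 hc).1
      rw [mk_mem_cornerCells_swap hST, add_assoc, mem_cornerCells_above_iff hST.symm] at hc
      refine ⟨d + 1, Finset.mem_filter.2 ⟨hc.1, by omega, hc.2.1⟩, ?_⟩
      rw [hc.2.2]; rfl
    · intro m hm
      obtain ⟨hm, hm1, hm'⟩ := Finset.mem_filter.1 hm
      obtain ⟨d, rfl⟩ := Nat.exists_eq_add_of_le' hm1
      rw [frobeniusCells_erase_below hST hm hm']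
  · have hdiag : ∀ c ∈ ((cornerCells (frobeniusCells S T)).filter
        fun c => ¬ c.1 < c.2).filter (fun c => ¬ c.2 < c.1),
        0 ∈ S ∧ 0 ∈ T ∧ c = (S.card - 1, S.card - 1) := by
      rintro ⟨i, j⟩ hc
      simp only [Finset.mem_filter] at hc
      obtain rfl : i = j := by omega
      have := (mem_cornerCells_diag_iff hST).1 hc.1.1
      refine ⟨this.1, this.2.1, ?_⟩
      rw [← this.2.2]; rfl
    split_ifs with h
    · rw [Finset.sum_eq_single (S.card - 1, S.card - 1), frobeniusCells_erase_diag hST h.1 h.2]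
      · intro c hc hne
        exact absurd (hdiag c hc).2.2 hne
      · intro hc
        refine absurd ?_ hc
        have := Finset.card_pos.2 ⟨0, h.1⟩
        simp only [Finset.mem_filter, mem_cornerCells_diag_iff hST]
        exact ⟨⟨⟨h.1, h.2, by omega⟩, by omega⟩, by omega⟩
    · exact Finset.sum_eq_zero fun c hc => absurd ⟨(hdiag c hc).1, (hdiag c hc).2.1⟩ h

/-- The matrix with entries `1 / (j! k! (j + k + 1))` at rows `j = m a` and columns `k = k b`. -/
noncomputable def frobeniusMatrix {l : ℕ} (m k : Fin l → ℕ) : Matrix (Fin l) (Fin l) ℝ :=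
  Matrix.of fun a b => (1 : ℝ) / ((Nat.factorial (m a) : ℝ) * (Nat.factorial (k b) : ℝ) *
    ((m a : ℝ) + (k b : ℝ) + 1))

theorem sum_add_sum_mul_det {l : ℕ} (M : Matrix (Fin l) (Fin l) ℝ) (u v : Fin l → ℝ) :
    (∑ a, u a + ∑ b, v b) * M.det = ∑ a, ∑ b, (u a + v b) * M a b * M.adjugate b a := by
  simp only [add_mul, Finset.sum_add_distrib]
  congr 1
  · rw [Finset.sum_mul]
    refine Finset.sum_congr rfl fun a _ => ?_
    rw [det_eq_sum_mul_adjugate_row M a, Finset.mul_sum]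
    simp only [mul_assoc]
  · rw [Finset.sum_comm, Finset.sum_mul]
    refine Finset.sum_congr rfl fun b _ => ?_
    rw [det_eq_sum_mul_adjugate_col M b, Finset.mul_sum]
    simp only [mul_assoc]

theorem sum_mul_adjugate_row {l : ℕ} (M : Matrix (Fin l) (Fin l) ℝ) (a : Fin l) (r : Fin l → ℝ) :
    ∑ b, r b * M.adjugate b a = (M.updateRow a r).det := by
  rw [det_eq_sum_mul_adjugate_row _ a]
  simp [adjugate_apply]

theorem sum_mul_adjugate_col {l : ℕ} (M : Matrix (Fin l) (Fin l) ℝ) (b : Fin l) (r : Fin l → ℝ) :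
    ∑ a, r a * M.adjugate b a = (M.updateCol b r).det := by
  rw [← det_transpose, ← updateRow_transpose, ← sum_mul_adjugate_row]
  simp only [← adjugate_transpose, transpose_apply]

theorem frobenius_entry_recurrence (j k : ℕ) :
    ((j : ℝ) + 1 + k) * (1 / ((j.factorial : ℝ) * (k.factorial : ℝ) * ((j : ℝ) + k + 1))) =
      (if 1 ≤ j then
        1 / (((j - 1).factorial : ℝ) * (k.factorial : ℝ) * (((j - 1 : ℕ) : ℝ) + k + 1)) else 0) +
      (if 1 ≤ k then
        1 / ((j.factorial : ℝ) * ((k - 1).factorial : ℝ) * ((j : ℝ) + ((k - 1 : ℕ) : ℝ) + 1))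
        else 0) + (if j = 0 ∧ k = 0 then 1 else 0) := by
  rcases j with _ | j <;> rcases k with _ | k
  · norm_num
  all_goals
    simp [Nat.factorial_succ]
    field_simp
    try ring

theorem frobeniusMatrix_det_recurrence {l : ℕ} (m k : Fin l → ℕ) :
    ((∑ a, (m a + 1) + ∑ b, k b : ℕ) : ℝ) * (frobeniusMatrix m k).det =
      ∑ a, (if 1 ≤ m a then (frobeniusMatrix (Function.update m a (m a - 1)) k).det else 0) +
      ∑ b, (if 1 ≤ k b then (frobeniusMatrix m (Function.update k b (k b - 1))).det else 0) +
      ∑ a, ∑ b, (if m a = 0 ∧ k b = 0 then (frobeniusMatrix m k).adjugate b a else 0) := by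
  have key := sum_add_sum_mul_det (frobeniusMatrix m k) (fun a => (m a : ℝ) + 1) (fun b => k b)
  push_cast
  rw [key]
  have hentry : ∀ a b, ((m a : ℝ) + 1 + k b) * frobeniusMatrix m k a b =
      (if 1 ≤ m a then frobeniusMatrix (Function.update m a (m a - 1)) k a b else 0) +
      (if 1 ≤ k b then frobeniusMatrix m (Function.update k b (k b - 1)) a b else 0) +
      (if m a = 0 ∧ k b = 0 then 1 else 0) := fun a b => by
    simpa [frobeniusMatrix] using frobenius_entry_recurrence (m a) (k b)
  simp only [hentry, add_mul, Finset.sum_add_distrib]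
  congr 1
  · congr 1
    · refine Finset.sum_congr rfl fun a _ => ?_
      split_ifs
      · rw [sum_mul_adjugate_row]
        congr 1
        ext a' b
        by_cases h : a' = a
        · subst h; simp
        · simp [h, frobeniusMatrix]
      · simp
    · rw [Finset.sum_comm]
      refine Finset.sum_congr rfl fun b _ => ?_
      split_ifs
      · rw [sum_mul_adjugate_col]
        congr 1
        ext a b'
        by_cases h : b' = b
        · subst h; simp
        · simp [h, frobeniusMatrix]
      · simp
  · simp only [ite_mul, one_mul, zero_mul]

theorem frobeniusMatrix_det_eq_zero_of_not_injective {l : ℕ} {m k : Fin l → ℕ}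
    (h : ¬ Function.Injective m) :
    (frobeniusMatrix m k).det = 0 := by
  simp only [Function.Injective, not_forall] at h
  obtain ⟨a, b, hab, hne⟩ := h
  exact det_zero_of_row_eq hne (by ext c; simp [frobeniusMatrix, hab])

theorem frobeniusMatrix_det_comm {l : ℕ} (m k : Fin l → ℕ) :
    (frobeniusMatrix k m).det = (frobeniusMatrix m k).det := by
  rw [← det_transpose]
  congr 1
  ext a b
  simp [frobeniusMatrix]
  ring

theorem frobeniusMatrix_adjugate_zero {l : ℕ} (m k : Fin (l + 1) → ℕ) :
    (frobeniusMatrix m k).adjugate 0 0 =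
      (frobeniusMatrix (fun a => m a.succ) (fun b => k b.succ)).det := by
  rw [adjugate_fin_succ_eq_det_submatrix]
  simp only [Fin.val_zero, add_zero, pow_zero, one_mul, Fin.succAbove_zero]
  rfl

theorem strictMono_update_sub_one {l : ℕ} {m : Fin l → ℕ} (hm : StrictMono m) {a : Fin l}
    (h1 : 1 ≤ m a) (h : ∀ b, m b ≠ m a - 1) :
    StrictMono (Function.update m a (m a - 1)) := by
  intro i j hij
  have hlt := hm hij
  by_cases hi : i = a
  · subst hi
    rw [Function.update_self, Function.update_of_ne hij.ne']
    omega
  · by_cases hj : j = a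
    · subst hj
      rw [Function.update_self, Function.update_of_ne hi]
      have := h i
      omega
    · rwa [Function.update_of_ne hi, Function.update_of_ne hj]

theorem image_update_sub_one {l : ℕ} {m : Fin l → ℕ} (hm : StrictMono m) (a : Fin l) :
    univ.image (Function.update m a (m a - 1)) = lowerElement (univ.image m) (m a) := by
  ext x
  simp only [lowerElement, mem_image, mem_univ, true_and, mem_insert, mem_erase]
  constructor
  · rintro ⟨b, rfl⟩
    by_cases hb : b = a
    · subst hb; simp
    · rw [Function.update_of_ne hb]
      exact Or.inr ⟨hm.injective.ne hb, b, rfl⟩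
  · rintro (rfl | ⟨h, b, rfl⟩)
    · exact ⟨a, by simp⟩
    · exact ⟨b, Function.update_of_ne (fun hb => h (by rw [hb])) _ _⟩

theorem sum_update_sub_one {l : ℕ} {m : Fin l → ℕ} {a : Fin l} (h1 : 1 ≤ m a) :
    ∑ b, Function.update m a (m a - 1) b + 1 = ∑ b, m b := by
  rw [Finset.sum_update_of_mem (mem_univ a), Finset.sdiff_singleton_eq_erase,
    ← Finset.add_sum_erase univ m (mem_univ a)]
  omega

/-- Rewrites a sum over lowerable elements of the image of `m` as a sum over the indices, given
that the summand agrees with one that vanishes when `m` cannot be lowered at the index. -/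
theorem sum_lowerableElements_image {l : ℕ} {m : Fin l → ℕ} (hm : StrictMono m) (G : ℕ → ℝ)
    (H : Fin l → ℝ) (hGH : ∀ a, 1 ≤ m a → (∀ b, m b ≠ m a - 1) → G (m a) = H a)
    (h0 : ∀ a, 1 ≤ m a → (∃ b, m b = m a - 1) → H a = 0) :
    ∑ x ∈ lowerableElements (univ.image m), G x = ∑ a, if 1 ≤ m a then H a else 0 := by
  rw [lowerableElements, Finset.sum_filter, Finset.sum_image hm.injective.injOn]
  refine Finset.sum_congr rfl fun a _ => ?_
  by_cases h1 : 1 ≤ m a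
  · by_cases h : ∃ b, m b = m a - 1
    · rw [if_neg (by simpa [h1] using h), if_pos h1, h0 a h1 h]
    · have h' : ∀ b, m b ≠ m a - 1 := fun b hb => h ⟨b, hb⟩
      rw [if_pos ⟨h1, by simpa using h'⟩, if_pos h1, hGH a h1 h']
  · simp [h1]

theorem not_injective_update_sub_one {l : ℕ} {m : Fin l → ℕ} {a : Fin l}
    (h1 : 1 ≤ m a) (h : ∃ b, m b = m a - 1) :
    ¬ Function.Injective (Function.update m a (m a - 1)) := by
  obtain ⟨b, hb⟩ := h
  have hba : b ≠ a := by rintro rfl; omega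
  intro hi
  exact hba (hi (by rw [Function.update_of_ne hba, Function.update_self, hb]))

theorem image_succ_eq_erase_zero {l : ℕ} {m : Fin (l + 1) → ℕ} (hm : StrictMono m)
    (h0 : m 0 = 0) : univ.image (fun a : Fin l => m a.succ) = (univ.image m).erase 0 := by
  ext x
  simp only [mem_image, mem_univ, true_and, mem_erase]
  constructor
  · rintro ⟨a, rfl⟩
    have := hm (Fin.succ_pos a)
    exact ⟨by omega, _, rfl⟩
  · rintro ⟨hx, a, rfl⟩
    obtain ⟨b, rfl⟩ := Fin.exists_succ_eq.2 (show a ≠ 0 by rintro rfl; exact hx h0)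
    exact ⟨b, rfl⟩

theorem cornerCells_nonempty {A : Finset (ℕ × ℕ)} (hA : A.Nonempty) : (cornerCells A).Nonempty := by
  obtain ⟨c, hc, hmax⟩ := Finset.exists_max_image A (fun c => c.1 + c.2) hA
  refine ⟨c, Finset.mem_filter.2 ⟨hc, fun d hd => ?_⟩⟩
  have := hmax d hd
  omega

theorem card_image_eq_of_strictMono {l : ℕ} {m : Fin l → ℕ} (hm : StrictMono m) :
    (univ.image m).card = l := by
  rw [Finset.card_image_of_injective _ hm.injective, Finset.card_univ, Fintype.card_fin]

theorem zero_of_strictMono_eq_zero {l : ℕ} {m : Fin (l + 1) → ℕ} (hm : StrictMono m)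
    {a : Fin (l + 1)} (h : m a = 0) : a = 0 := by
  by_contra ha
  have := hm (Fin.pos_of_ne_zero ha)
  omega

theorem zero_mem_image_iff {l : ℕ} {m : Fin (l + 1) → ℕ} (hm : StrictMono m) :
    0 ∈ univ.image m ↔ m 0 = 0 := by
  simp only [mem_image, mem_univ, true_and]
  exact ⟨fun ⟨a, ha⟩ => zero_of_strictMono_eq_zero hm ha ▸ ha, fun h => ⟨0, h⟩⟩

/-- If `F` equals `C` times the Frobenius determinant on all diagrams of weight `n`, then summing
`F` over the corner removals of a diagram of weight `n + 1` gives `C * (n + 1)` times its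
determinant. -/
theorem sum_cornerCells_image {l : ℕ} {m k : Fin (l + 1) → ℕ} (hm : StrictMono m)
    (hk : StrictMono k) {n : ℕ} (hn : ∑ a, (m a + 1) + ∑ b, k b = n + 1)
    (F : Finset (ℕ × ℕ) → ℝ) (C : ℝ)
    (hF : ∀ (l' : ℕ) (m' k' : Fin l' → ℕ), StrictMono m' → StrictMono k' →
      ∑ a, (m' a + 1) + ∑ b, k' b = n →
      F (frobeniusCells (univ.image m') (univ.image k')) = C * (frobeniusMatrix m' k').det) :
    ∑ c ∈ cornerCells (frobeniusCells (univ.image m) (univ.image k)),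
      F ((frobeniusCells (univ.image m) (univ.image k)).erase c) =
      C * ((n + 1 : ℕ) * (frobeniusMatrix m k).det) := by
  have hcard : (univ.image m).card = (univ.image k).card := by
    rw [card_image_eq_of_strictMono hm, card_image_eq_of_strictMono hk]
  rw [← hn, frobeniusMatrix_det_recurrence, mul_add, mul_add, Finset.mul_sum, Finset.mul_sum,
    sum_cornerCells hcard]
  simp only [mul_ite, mul_zero]
  congr 1
  · congr 1
    · refine sum_lowerableElements_image hm _ _ (fun a h1 h => ?_) (fun a h1 h => ?_)
      · rw [← image_update_sub_one hm]
        refine hF _ _ _ (strictMono_update_sub_one hm h1 h) hk ?_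
        have := sum_update_sub_one h1
        simp only [Finset.sum_add_distrib] at hn ⊢
        omega
      · rw [frobeniusMatrix_det_eq_zero_of_not_injective (not_injective_update_sub_one h1 h),
          mul_zero]
    · refine sum_lowerableElements_image hk _ _ (fun a h1 h => ?_) (fun a h1 h => ?_)
      · rw [← image_update_sub_one hk]
        refine hF _ _ _ hm (strictMono_update_sub_one hk h1 h) ?_
        have := sum_update_sub_one h1
        omega
      · rw [← frobeniusMatrix_det_comm,
          frobeniusMatrix_det_eq_zero_of_not_injective (not_injective_update_sub_one h1 h), mul_zero]
  · simp only [zero_mem_image_iff hm, zero_mem_image_iff hk]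
    rw [Finset.sum_eq_single 0, Finset.sum_eq_single 0]
    · split_ifs with h
      · rw [← image_succ_eq_erase_zero hm h.1, ← image_succ_eq_erase_zero hk h.2,
          frobeniusMatrix_adjugate_zero]
        refine hF _ _ _ (hm.comp (Fin.strictMono_succ)) (hk.comp (Fin.strictMono_succ)) ?_
        rw [Fin.sum_univ_succ, Fin.sum_univ_succ, h.1, h.2] at hn
        omega
      · simp
    · intro b _ hb
      rw [if_neg fun h => hb (zero_of_strictMono_eq_zero hk h.2)]
    · simp
    · intro a _ ha
      exact Finset.sum_eq_zero fun b _ =>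
        if_neg fun h => ha (zero_of_strictMono_eq_zero hm h.1)
    · simp

theorem frobeniusCells_empty : frobeniusCells ∅ ∅ = ∅ := by
  ext ⟨i, j⟩
  rw [mem_frobeniusCells]
  simp [tailCount]
  omega

theorem frobeniusCells_image_nonempty {l : ℕ} {m k : Fin (l + 1) → ℕ} (hm : StrictMono m)
    (hk : StrictMono k) : (frobeniusCells (univ.image m) (univ.image k)).Nonempty := by
  have h : (univ.image m).card = (univ.image k).card := by
    rw [card_image_eq_of_strictMono hm, card_image_eq_of_strictMono hk]
  refine ⟨(0, 0 + 0), (add_mem_frobeniusCells h).2 ?_⟩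
  rw [tailCount_zero, card_image_eq_of_strictMono hm]
  omega

theorem frobeniusCells_image_card_and_count (n : ℕ) : ∀ (l : ℕ) (m k : Fin l → ℕ), StrictMono m →
    StrictMono k → ∑ a, (m a + 1) + ∑ b, k b = n →
      (frobeniusCells (univ.image m) (univ.image k)).card = n ∧
      (standardFillingCount (frobeniusCells (univ.image m) (univ.image k)) : ℝ) =
        n.factorial * (frobeniusMatrix m k).det := by
  induction n with
  | zero =>
    intro l m k hm hk hn
    obtain rfl : l = 0 := by
      simp only [Finset.sum_add_distrib, Finset.sum_const, Finset.card_univ, Fintype.card_fin,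
        smul_eq_mul, mul_one] at hn
      omega
    simp [frobeniusCells_empty, standardFillingCount_empty]
  | succ n ih =>
    intro l m k hm hk hn
    rcases l with _ | l
    · simp at hn
    have hne := frobeniusCells_image_nonempty hm hk
    constructor
    · have h := sum_cornerCells_image hm hk hn (fun A => if A.card = n then 0 else 1) 0
        fun l' m' k' hm' hk' hn' => by simp [(ih l' m' k' hm' hk' hn').1]
      rw [zero_mul, Finset.sum_eq_zero_iff_of_nonneg fun c _ => by positivity] at h
      obtain ⟨c, hc⟩ := cornerCells_nonempty hne
      have hcn := h c hc
      have hcA := (Finset.mem_filter.1 hc).1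
      have hpos := Finset.card_pos.2 hne
      rw [Finset.card_erase_of_mem hcA] at hcn
      simp at hcn
      omega
    · have h := sum_cornerCells_image hm hk hn (fun A => (standardFillingCount A : ℝ)) n.factorial
        fun l' m' k' hm' hk' hn' => (ih l' m' k' hm' hk' hn').2
      rw [standardFillingCount_eq_sum hne, Nat.cast_sum, h, Nat.factorial_succ]
      push_cast
      ring

theorem exists_tailCount_eq {a : ℕ → ℕ} (h1 : ∀ d, a (d + 1) ≤ a d)
    (h2 : ∀ d, a d ≤ a (d + 1) + 1) {B : ℕ} (hB : ∀ d, B ≤ d → a d = 0) :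
    ∃ S : Finset ℕ, ∀ d, tailCount S d = a d := by
  let S := (Finset.range B).filter fun d => a (d + 1) < a d
  have hrec : ∀ d, a d = a (d + 1) + if d ∈ S then 1 else 0 := fun d => by
    have := h1 d
    have := h2 d
    by_cases hd : d < B
    · simp only [S, Finset.mem_filter, Finset.mem_range, hd, true_and]
      split_ifs <;> omega
    · have := hB d (by omega)
      simp only [S, Finset.mem_filter, Finset.mem_range, hd, false_and, if_false]
      omega
  have hS : ∀ d, B ≤ d → tailCount S d = 0 := fun d hd => by
    rw [tailCount, Finset.card_eq_zero, Finset.filter_eq_empty_iff]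
    intro x hx
    have := Finset.mem_range.1 (Finset.mem_filter.1 hx).1
    omega
  refine ⟨S, fun d => ?_⟩
  rcases le_total B d with hd | hd
  · rw [hB d hd, hS d hd]
  · induction hd using Nat.decreasingInduction with
    | self => rw [hB B le_rfl, hS B le_rfl]
    | of_succ d _ ih => rw [hrec d, tailCount_eq_succ_add, ih]

theorem YoungDiagram.exists_tailCount_diagonals (Y : YoungDiagram) :
    ∃ S : Finset ℕ, ∀ i d, (i, i + d) ∈ Y ↔ i < tailCount S d := by
  have hex : ∀ d, ∃ i, (i, i + d) ∉ Y := fun d => by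
    obtain ⟨i, hi⟩ := Y.exists_notMem_col 0
    exact ⟨i, fun h => hi (Y.up_left_mem le_rfl (by omega) h)⟩
  have hiff : ∀ i d, (i, i + d) ∈ Y ↔ i < Nat.find (hex d) := fun i d => by
    rw [Nat.lt_find_iff]
    constructor
    · exact fun h j hj => not_not.2 (Y.up_left_mem hj (by omega) h)
    · exact fun h => not_not.1 (h i le_rfl)
  obtain ⟨B, hB⟩ := Y.exists_notMem_row 0
  obtain ⟨S, hS⟩ := exists_tailCount_eq (a := fun d => Nat.find (hex d)) (B := B)
    (fun d => le_of_forall_lt fun i hi =>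
      (hiff i d).1 (Y.up_left_mem le_rfl (by omega) ((hiff i (d + 1)).2 hi)))
    (fun d => by
      by_contra! h
      have hmem := (hiff _ d).2 h
      have := (hiff _ (d + 1)).1 (Y.up_left_mem (i1 := Nat.find (hex (d + 1)))
        (by omega) (by omega) hmem)
      omega)
    (fun d hd => by
      rw [Nat.find_eq_zero, zero_add]
      exact fun h => hB (Y.up_left_mem le_rfl hd h))
  exact ⟨S, fun i d => by rw [hiff, hS]⟩

/-- The Young diagram with Frobenius coordinates given by two finite sets of equal cardinality. -/
def frobeniusDiagram (p : {p : Finset ℕ × Finset ℕ // p.1.card = p.2.card}) : YoungDiagram where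
  cells := frobeniusCells p.1.1 p.1.2
  isLowerSet := fun ⟨_, _⟩ ⟨_, _⟩ h hc => frobeniusCells_down p.2 h.1 h.2 hc

theorem frobeniusDiagram_bijective : Function.Bijective frobeniusDiagram := by
  constructor
  · rintro ⟨⟨S, T⟩, h⟩ ⟨⟨S', T'⟩, h'⟩ heq
    have hc : frobeniusCells S T = frobeniusCells S' T' := congrArg YoungDiagram.cells heq
    have hS : S = S' := eq_of_tailCount_eq fun d => eq_of_forall_lt_iff fun i => by
      rw [← add_mem_frobeniusCells h, ← add_mem_frobeniusCells h', hc]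
    have hT : T = T' := eq_of_tailCount_eq fun d => eq_of_forall_lt_iff fun i => by
      rw [← add_mem_frobeniusCells' h, ← add_mem_frobeniusCells' h', hc]
    subst hS hT
    rfl
  · intro Y
    obtain ⟨S, hS⟩ := Y.exists_tailCount_diagonals
    obtain ⟨T, hT⟩ := Y.transpose.exists_tailCount_diagonals
    simp only [YoungDiagram.mem_transpose, Prod.swap_prod_mk] at hT
    have hcard : S.card = T.card := by
      rw [← tailCount_zero, ← tailCount_zero]
      exact eq_of_forall_lt_iff fun i => by rw [← hS, ← hT]; rfl
    refine ⟨⟨(S, T), hcard⟩, YoungDiagram.ext (Finset.ext fun ⟨i, j⟩ => ?_)⟩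
    change (i, j) ∈ frobeniusCells S T ↔ (i, j) ∈ Y
    rcases le_total i j with hij | hij
    · obtain ⟨d, rfl⟩ := Nat.exists_eq_add_of_le hij
      rw [add_mem_frobeniusCells hcard, hS]
    · obtain ⟨d, rfl⟩ := Nat.exists_eq_add_of_le hij
      rw [add_mem_frobeniusCells' hcard, hT]

theorem card_diagonal_frobeniusDiagram
    (p : {p : Finset ℕ × Finset ℕ // p.1.card = p.2.card}) :
    Nat.card {i : ℕ | (i, i) ∈ frobeniusDiagram p} = p.1.1.card := by
  have : {i : ℕ | (i, i) ∈ frobeniusDiagram p} = (Finset.range p.1.1.card : Set ℕ) := by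
    ext i
    rw [Finset.coe_range, Set.mem_Iio, ← tailCount_zero, ← add_mem_frobeniusCells p.2]
    rfl
  rw [this]
  simp

/-- The determinant attached to a pair of finite sets of equal cardinality. -/
noncomputable def frobeniusDet (p : {p : Finset ℕ × Finset ℕ // p.1.card = p.2.card}) : ℝ :=
  Matrix.det (Matrix.of fun a b : Fin p.val.1.card =>
          (1 : ℝ) / ((Nat.factorial ((p.val.1.orderIsoOfFin rfl a : ℕ)) : ℝ) *
            (Nat.factorial ((p.val.2.orderIsoOfFin p.prop.symm b : ℕ)) : ℝ) *
            (((p.val.1.orderIsoOfFin rfl a : ℕ) : ℝ) +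
              ((p.val.2.orderIsoOfFin p.prop.symm b : ℕ) : ℝ) + 1)))

theorem frobeniusDiagram_card_and_count
    (p : {p : Finset ℕ × Finset ℕ // p.1.card = p.2.card}) :
    ∑ j ∈ p.1.1, (2 * j + 1) + ∑ k ∈ p.1.2, (2 * k + 1) = 2 * (frobeniusDiagram p).card ∧
    frobeniusDet p =
      (Nat.card {f : ℕ × ℕ → ℕ // IsStandardYoungTableau (frobeniusDiagram p) f} : ℝ) /
      ((frobeniusDiagram p).card.factorial : ℝ) := by
  obtain ⟨⟨S, T⟩, h⟩ := p
  have h : S.card = T.card := h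
  have hsum : ∀ (U : Finset ℕ) (hU : U.card = S.card) (f : ℕ → ℕ),
      ∑ a, f (U.orderEmbOfFin hU a) = ∑ j ∈ U, f j := fun U hU f => by
    conv_rhs => rw [← U.image_orderEmbOfFin_univ hU]
    rw [Finset.sum_image (U.orderEmbOfFin hU).injective.injOn]
  obtain ⟨h1, h2⟩ := frobeniusCells_image_card_and_count _ _ (S.orderEmbOfFin rfl)
    (T.orderEmbOfFin h.symm) (S.orderEmbOfFin rfl).strictMono (T.orderEmbOfFin h.symm).strictMono rfl
  rw [hsum S rfl (fun j => j + 1), hsum T h.symm (fun j => j)] at h1 h2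
  rw [Finset.image_orderEmbOfFin_univ, Finset.image_orderEmbOfFin_univ] at h1 h2
  rw [← h1] at h2
  have h1' : (frobeniusDiagram ⟨(S, T), h⟩).card = _ := h1
  constructor
  · rw [h1']
    simp only [Finset.sum_add_distrib, Finset.sum_const, smul_eq_mul, mul_one]
    rw [← Finset.mul_sum, ← Finset.mul_sum]
    omega
  · rw [eq_div_iff (by positivity), mul_comm]
    exact h2.symm

theorem abs_frobeniusDet_le_one (p : {p : Finset ℕ × Finset ℕ // p.1.card = p.2.card}) :
    |frobeniusDet p| ≤ 1 := by
  rw [(frobeniusDiagram_card_and_count p).2, abs_of_nonneg (by positivity),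
    div_le_one (by positivity)]
  exact_mod_cast standardFillingCount_le_factorial (frobeniusDiagram p).cells

theorem summable_exp_odd_finset {x : ℝ} (hx : 0 < x) :
    Summable fun S : Finset ℕ => ∏ j ∈ S, Real.exp (-x * (2 * j + 1)) := by
  refine summable_finsetProd_of_summable_nonneg (fun j => (Real.exp_pos _).le) ?_
  have h := (Real.summable_exp_nat_mul_iff.2 (show -(2 * x) < 0 by linarith)).mul_left
    (Real.exp (-x))
  refine h.congr fun j => ?_
  rw [← Real.exp_add]
  congr 1
  ring

theorem summable_frobeniusDet {x : ℝ} (hx : 0 < x) :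
    Summable fun p : {p : Finset ℕ × Finset ℕ // p.1.card = p.2.card} =>
      (-1 : ℝ) ^ p.val.1.card * frobeniusDet p ^ 2 *
        Real.exp (-x * (((∑ j ∈ p.val.1, (2 * j + 1)) +
          (∑ k ∈ p.val.2, (2 * k + 1)) : ℕ) : ℝ)) := by
  have h := summable_exp_odd_finset hx
  have h2 := (h.mul_of_nonneg h (fun S => Finset.prod_nonneg fun _ _ => (Real.exp_pos _).le)
    (fun S => Finset.prod_nonneg fun _ _ => (Real.exp_pos _).le)).comp_injective
    (Subtype.val_injective (p := fun p : Finset ℕ × Finset ℕ => p.1.card = p.2.card))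
  refine Summable.of_norm_bounded h2 fun p => ?_
  have hdet : frobeniusDet p ^ 2 ≤ 1 := (sq_le_one_iff_abs_le_one _).2 (abs_frobeniusDet_le_one p)
  have hexp : Real.exp (-x * (((∑ j ∈ p.val.1, (2 * j + 1)) +
      (∑ k ∈ p.val.2, (2 * k + 1)) : ℕ) : ℝ)) =
      (∏ j ∈ p.1.1, Real.exp (-x * (2 * j + 1))) * ∏ j ∈ p.1.2, Real.exp (-x * (2 * j + 1)) := by
    rw [← Real.exp_sum, ← Real.exp_sum, ← Real.exp_add, ← Finset.mul_sum, ← Finset.mul_sum,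
      ← mul_add]
    push_cast
    rfl
  rw [norm_mul, norm_mul, norm_pow, norm_neg, norm_one, one_pow, one_mul, Real.norm_eq_abs,
    Real.norm_eq_abs, abs_of_nonneg (sq_nonneg _), Real.abs_exp, hexp]
  exact mul_le_of_le_one_left (by positivity) hdet

/-- the expansion of the hard-edge Bessel `τ`-function: the absolutely
convergent sum over pairs `(S,T)` of finite subsets of `ℕ` of equal cardinality of
`(-1)^{|S|} det[1/(j!k!(j+k+1))]² e^{-x(Σ_{j∈S}(2j+1)+Σ_{k∈T}(2k+1))}` equals
`Σ_λ (-1)^{ℓ(λ)} (f^λ/|λ|!)² e^{-2|λ|x}` over all partitions `λ`. -/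
theorem stmt13 (x : ℝ) (hx : 0 < x) :
    Summable (fun p : {p : Finset ℕ × Finset ℕ // p.1.card = p.2.card} =>
      (-1 : ℝ) ^ p.val.1.card *
        (Matrix.det (Matrix.of fun a b : Fin p.val.1.card =>
          (1 : ℝ) / ((Nat.factorial ((p.val.1.orderIsoOfFin rfl a : ℕ)) : ℝ) *
            (Nat.factorial ((p.val.2.orderIsoOfFin p.prop.symm b : ℕ)) : ℝ) *
            (((p.val.1.orderIsoOfFin rfl a : ℕ) : ℝ) +
              ((p.val.2.orderIsoOfFin p.prop.symm b : ℕ) : ℝ) + 1)))) ^ 2 *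
        Real.exp (-x * (((∑ j ∈ p.val.1, (2 * j + 1)) +
          (∑ k ∈ p.val.2, (2 * k + 1)) : ℕ) : ℝ))) ∧
    (∑' p : {p : Finset ℕ × Finset ℕ // p.1.card = p.2.card},
      (-1 : ℝ) ^ p.val.1.card *
        (Matrix.det (Matrix.of fun a b : Fin p.val.1.card =>
          (1 : ℝ) / ((Nat.factorial ((p.val.1.orderIsoOfFin rfl a : ℕ)) : ℝ) *
            (Nat.factorial ((p.val.2.orderIsoOfFin p.prop.symm b : ℕ)) : ℝ) *
            (((p.val.1.orderIsoOfFin rfl a : ℕ) : ℝ) +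
              ((p.val.2.orderIsoOfFin p.prop.symm b : ℕ) : ℝ) + 1)))) ^ 2 *
        Real.exp (-x * (((∑ j ∈ p.val.1, (2 * j + 1)) +
          (∑ k ∈ p.val.2, (2 * k + 1)) : ℕ) : ℝ)))
    = ∑' Y : YoungDiagram,
        (-1 : ℝ) ^ (Nat.card {i : ℕ | (i, i) ∈ Y}) *
          ((Nat.card {f : ℕ × ℕ → ℕ // IsStandardYoungTableau Y f} : ℝ) /
            (Nat.factorial Y.card : ℝ)) ^ 2 *
          Real.exp (-2 * (Y.card : ℝ) * x) := by
  refine ⟨summable_frobeniusDet hx, ?_⟩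
  rw [← (Equiv.ofBijective _ frobeniusDiagram_bijective).tsum_eq]
  refine tsum_congr fun p => ?_
  change (-1 : ℝ) ^ p.val.1.card * frobeniusDet p ^ 2 * _ = _
  rw [Equiv.ofBijective_apply, card_diagonal_frobeniusDiagram,
    (frobeniusDiagram_card_and_count p).2, (frobeniusDiagram_card_and_count p).1]
  congr 2
  push_cast
  ring
end

section
/- Let K > 0 and let β ∈ ℂ with Re β > 0, and set λ_n = (2πin + β)/(2K) for n ∈ ℤ. Then there exists a constant C > 0 such that for every finitely supported sequence (a_n)_{n∈ℤ} of complex numbers, C^{−1} Σ_{n∈ℤ} |a_n|² ≤ ∫₀^∞ | Σ_{n∈ℤ} a_n e^{−λ_n x} |² dx ≤ C Σ_{n∈ℤ} |a_n|². That is, (e^{−λ_n x})_{n∈ℤ} is a Riesz basic sequence in L²(0, ∞). -/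
open MeasureTheory Set Complex

/-- Parseval's identity for trigonometric polynomials on `[0, T]`. -/
theorem integral_norm_sq_trigPoly {T : ℝ} (hT : 0 < T) (s : Finset ℤ) (a : ℤ → ℂ) :
    ∫ x in (0:ℝ)..T, ‖∑ n ∈ s, a n * cexp (-(2 * Real.pi * I * n / T) * x)‖ ^ 2 =
      T * ∑ n ∈ s, ‖a n‖ ^ 2 := by
  have hT' : (T : ℂ) ≠ 0 := by exact_mod_cast hT.ne'
  have hexpand (x : ℝ) :
      ((‖∑ n ∈ s, a n * cexp (-(2 * Real.pi * I * n / T) * x)‖ ^ 2 : ℝ) : ℂ) =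
        ∑ n ∈ s, ∑ m ∈ s, a n * (starRingEnd ℂ) (a m) *
          cexp ((2 * Real.pi * I * (m - n) / T) * x) := by
    push_cast
    rw [← Complex.mul_conj', map_sum, Finset.sum_mul_sum]
    refine Finset.sum_congr rfl fun n _ => Finset.sum_congr rfl fun m _ => ?_
    rw [map_mul, ← Complex.exp_conj, mul_mul_mul_comm, ← Complex.exp_add]
    congr 2
    simp only [map_mul, map_neg, map_div₀, Complex.conj_ofReal, Complex.conj_I, map_ofNat,
      map_intCast]
    ring
  have horth (n m : ℤ) : ∫ x in (0:ℝ)..T, cexp ((2 * Real.pi * I * (m - n) / T) * x) =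
      if n = m then (T : ℂ) else 0 := by
    split_ifs with h
    · simp [h]
    · have hmn : (m : ℂ) - n ≠ 0 := sub_ne_zero.2 (by exact_mod_cast Ne.symm h)
      have hc : 2 * Real.pi * I * (m - n) / T ≠ 0 :=
        div_ne_zero (mul_ne_zero Complex.two_pi_I_ne_zero hmn) hT'
      rw [integral_exp_mul_complex hc, div_mul_cancel₀ _ hT']
      have : cexp (2 * Real.pi * I * (m - n)) = 1 :=
        Complex.exp_eq_one_iff.2 ⟨m - n, by push_cast; ring⟩
      simp [this]
  apply Complex.ofReal_injective
  rw [← intervalIntegral.integral_ofReal]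
  simp_rw [hexpand]
  rw [intervalIntegral.integral_finsetSum
    fun n _ => Continuous.intervalIntegrable (by fun_prop) _ _]
  push_cast
  rw [Finset.mul_sum]
  refine Finset.sum_congr rfl fun n hn => ?_
  rw [intervalIntegral.integral_finsetSum
    fun m _ => Continuous.intervalIntegrable (by fun_prop) _ _]
  simp_rw [intervalIntegral.integral_const_mul, horth]
  simp [hn, Complex.mul_conj', mul_comm]

/-- The integral over `(0, ∞)` of a periodic function against a decaying exponential reduces, by a
geometric series, to an integral over one period. -/
theorem integral_Ioi_exp_mul_periodic {T c : ℝ} (hT : 0 < T) (hc : 0 < c) {g : ℝ → ℝ}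
    (hg : Continuous g) (hper : Function.Periodic g T) :
    (1 - Real.exp (-c * T)) * ∫ x in Ioi (0:ℝ), Real.exp (-c * x) * g x =
      ∫ x in (0:ℝ)..T, Real.exp (-c * x) * g x := by
  have hint : IntegrableOn (fun x => Real.exp (-c * x) * g x) (Ioi 0) := by
    obtain ⟨M, hM⟩ := (hper.compact_of_continuous hT.ne' hg).isBounded.exists_norm_le
    exact Integrable.mul_bdd (c := M) (integrableOn_exp_mul_Ioi (neg_lt_zero.2 hc) 0)
      hg.aestronglyMeasurable (ae_of_all _ fun x => hM _ (mem_range_self x))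
  have hshift : ∫ x in Ioi T, Real.exp (-c * x) * g x =
      Real.exp (-c * T) * ∫ x in Ioi (0:ℝ), Real.exp (-c * x) * g x := by
    have h := (measurePreserving_add_right volume T).setIntegral_preimage_emb
      (measurableEmbedding_addRight T) (fun x => Real.exp (-c * x) * g x) (Ioi T)
    rw [preimage_add_const_Ioi, sub_self] at h
    rw [← h, ← integral_const_mul]
    refine integral_congr_ae (ae_of_all _ fun x => ?_)
    simp only [hper x, mul_add, Real.exp_add]
    ring
  have hsplit := intervalIntegral.integral_interval_add_Ioi hint
    (hint.mono_set (Ioi_subset_Ioi hT.le))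
  linarith

/-- Two-sided comparison of an exponentially weighted integral over one period with the
unweighted one. -/
theorem integral_exp_mul_bounds {T c : ℝ} (hT : 0 < T) (hc : 0 < c) {g : ℝ → ℝ}
    (hg : Continuous g) (hg0 : ∀ x, 0 ≤ g x) :
    Real.exp (-c * T) * ∫ x in (0:ℝ)..T, g x ≤ ∫ x in (0:ℝ)..T, Real.exp (-c * x) * g x ∧
      ∫ x in (0:ℝ)..T, Real.exp (-c * x) * g x ≤ ∫ x in (0:ℝ)..T, g x := by
  constructor
  · rw [← intervalIntegral.integral_const_mul]
    refine intervalIntegral.integral_mono_on hT.le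
      (Continuous.intervalIntegrable (by fun_prop) _ _)
      (Continuous.intervalIntegrable (by fun_prop) _ _) fun x hx => ?_
    exact mul_le_mul_of_nonneg_right (Real.exp_le_exp.2 (by nlinarith [hx.2])) (hg0 x)
  · refine intervalIntegral.integral_mono_on hT.le
      (Continuous.intervalIntegrable (by fun_prop) _ _)
      (Continuous.intervalIntegrable (by fun_prop) _ _) fun x hx => ?_
    exact mul_le_of_le_one_left (hg0 x) (Real.exp_le_one_iff.2 (by nlinarith [hx.1]))

/-- `(e^{-λ_n x})_{n∈ℤ}`, with `λ_n = (2πin + β)/(2K)` and `Re β > 0`,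
is a Riesz basic sequence in `L²(0,∞)`: there is `C > 0` so that for every finitely
supported `(a_n)`, `C⁻¹ Σ|a_n|² ≤ ∫₀^∞ |Σ a_n e^{-λ_n x}|² dx ≤ C Σ|a_n|²`. -/
theorem stmt17 (K : ℝ) (hK : 0 < K) (β : ℂ) (hβ : 0 < β.re) :
    ∃ C : ℝ, 0 < C ∧ ∀ a : ℤ →₀ ℂ,
      C⁻¹ * (∑ n ∈ a.support, ‖a n‖ ^ 2) ≤
        (∫ x in Set.Ioi (0:ℝ),
          ‖∑ n ∈ a.support,
            a n * Complex.exp (-((2 * Real.pi * Complex.I * n + β) / (2 * K)) * x)‖ ^ 2) ∧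
      (∫ x in Set.Ioi (0:ℝ),
          ‖∑ n ∈ a.support,
            a n * Complex.exp (-((2 * Real.pi * Complex.I * n + β) / (2 * K)) * x)‖ ^ 2)
        ≤ C * ∑ n ∈ a.support, ‖a n‖ ^ 2 := by
  set T : ℝ := 2 * K with hTdef
  set c : ℝ := β.re / K with hcdef
  have hT : 0 < T := by positivity
  have hc : 0 < c := by positivity
  set q : ℝ := Real.exp (-c * T) with hq
  have hq0 : 0 < q := Real.exp_pos _
  have hq1 : 0 < 1 - q := by
    have : q < 1 := Real.exp_lt_one_iff.2 (by nlinarith [mul_pos hc hT])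
    linarith
  refine ⟨T / (1 - q) + (1 - q) / (q * T), by positivity, fun a => ?_⟩
  set S := ∑ n ∈ a.support, ‖a n‖ ^ 2 with hS
  have hS0 : 0 ≤ S := by positivity
  set g : ℝ → ℝ := fun x =>
    ‖∑ n ∈ a.support, a n * cexp (-(2 * Real.pi * I * n / T) * x)‖ ^ 2 with hgdef
  have hg : Continuous g := by fun_prop
  have hper : Function.Periodic g T := by
    intro x
    simp only [hgdef]
    congr 2
    refine Finset.sum_congr rfl fun n _ => ?_
    have hT' : (T : ℂ) ≠ 0 := by exact_mod_cast hT.ne'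
    congr 1
    refine Complex.exp_eq_exp_iff_exists_int.2 ⟨-n, ?_⟩
    push_cast
    field_simp
    ring
  have hfactor (x : ℝ) : ‖∑ n ∈ a.support,
      a n * cexp (-((2 * Real.pi * I * n + β) / (2 * K)) * x)‖ ^ 2 = Real.exp (-c * x) * g x := by
    have hsum : ∑ n ∈ a.support, a n * cexp (-((2 * Real.pi * I * n + β) / (2 * K)) * x) =
        cexp (((-(x / T) : ℝ) : ℂ) * β) *
          ∑ n ∈ a.support, a n * cexp (-(2 * Real.pi * I * n / T) * x) := by
      rw [Finset.mul_sum]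
      refine Finset.sum_congr rfl fun n _ => ?_
      rw [mul_left_comm, ← Complex.exp_add]
      congr 2
      rw [hTdef]
      push_cast
      ring
    rw [hsum, norm_mul, mul_pow, Complex.norm_exp, Complex.re_ofReal_mul, ← Real.exp_nat_mul]
    congr 2
    rw [hTdef, hcdef]
    push_cast
    field_simp
  simp_rw [hfactor]
  have hI := integral_Ioi_exp_mul_periodic hT hc hg hper
  obtain ⟨hlow, hupp⟩ := integral_exp_mul_bounds hT hc hg fun x => sq_nonneg _
  rw [← hI, integral_norm_sq_trigPoly hT, ← hS, ← hq] at hlow hupp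
  set J := ∫ x in Ioi (0:ℝ), Real.exp (-c * x) * g x
  have hA : 0 < T / (1 - q) := by positivity
  have hB : 0 < (1 - q) / (q * T) := by positivity
  constructor
  · calc (T / (1 - q) + (1 - q) / (q * T))⁻¹ * S ≤ ((1 - q) / (q * T))⁻¹ * S := by
          gcongr
          linarith
      _ = q * (T * S) / (1 - q) := by field_simp
      _ ≤ J := by rw [div_le_iff₀ hq1]; linarith
  · calc J ≤ T * S / (1 - q) := by rw [le_div_iff₀ hq1]; linarith
      _ = T / (1 - q) * S := by ring
      _ ≤ _ := by gcongr; linarith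
end

section
/- Let K > 0 and β ∈ ℂ with Re β > 0, set λ_n = (2πin + β)/(2K) for n ∈ ℤ, and for N ≥ 1 let D_N = det[ 1/(λ_j + \overline{λ_k}) ]_{j,k=1}^N. Then D_N > 0 for all N and D_N^{1/N} → K/ sinh(Re β) as N → ∞. -/
open Matrix Filter

/-- The recursion behind Cauchy's determinant formula: peeling off the first row and column. -/
theorem Matrix.det_cauchy_succ {F : Type*} [Field F] {n : ℕ} (x y : Fin (n + 1) → F)
    (h : ∀ i j, x i + y j ≠ 0) :
    (of fun i j => 1 / (x i + y j)).det =
      1 / (x 0 + y 0) *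
        (∏ i : Fin n, (x i.succ - x 0) * (y i.succ - y 0) /
          ((x i.succ + y 0) * (x 0 + y i.succ))) *
        (of fun i j : Fin n => 1 / (x i.succ + y j.succ)).det := by
  set B : Matrix (Fin (n + 1)) (Fin (n + 1)) F := of fun i j =>
    Fin.cases (1 / (x 0 + y j)) (fun i => (x i.succ - x 0) / (x i.succ + y 0) *
      ((y j - y 0) / (x 0 + y j) * (1 / (x i.succ + y j)))) i with hB
  have hdet : (of fun i j => 1 / (x i + y j)).det = B.det := by
    refine det_eq_of_forall_row_eq_smul_add_const
      (Fin.cases 0 fun i => (x 0 + y 0) / (x i.succ + y 0)) 0 rfl fun i j => ?_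
    induction i using Fin.cases with
    | zero => simp [hB]
    | succ i =>
      have h1 := h i.succ j
      have h2 := h i.succ 0
      have h3 := h 0 j
      simp only [hB, of_apply, Fin.cases_zero, Fin.cases_succ]
      field_simp
      ring
  have hsub : B.submatrix (Fin.succAbove 0) Fin.succ = of fun i j : Fin n =>
      (x i.succ - x 0) / (x i.succ + y 0) *
        (of (fun i j : Fin n => (y j.succ - y 0) / (x 0 + y j.succ) *
          (of fun i j : Fin n => 1 / (x i.succ + y j.succ)) i j)) i j := by
    ext i j
    simp [hB]
  rw [hdet, det_succ_column_zero, Fin.sum_univ_succ, Finset.sum_eq_zero, hsub,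
    det_mul_column (fun i : Fin n => (x i.succ - x 0) / (x i.succ + y 0)),
    det_mul_row (fun j : Fin n => (y j.succ - y 0) / (x 0 + y j.succ)), ← mul_assoc (∏ i, _),
    ← Finset.prod_mul_distrib]
  · simp only [hB, of_apply, Fin.cases_zero, div_mul_div_comm, Fin.val_zero, pow_zero, one_mul,
      add_zero, mul_assoc]
  · intro i _
    simp [hB]

/-- A determinant of a Toeplitz matrix of Cauchy type, as a product. -/
theorem det_toeplitz_cauchy {K b : ℝ} (hK : 0 < K) (hb : 0 < b) (N : ℕ) :
    (of fun j k : Fin N => 1 / ((b + Real.pi * Complex.I * ((j : ℕ) - (k : ℕ) : ℂ)) / K)).det =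
      ((∏ n ∈ Finset.range N, K / b *
        (∏ d ∈ Finset.range n, (1 + (b / (Real.pi * (d + 1))) ^ 2))⁻¹ : ℝ) : ℂ) := by
  have hK' : (K : ℂ) ≠ 0 := by exact_mod_cast hK.ne'
  have hb' : (b : ℂ) ≠ 0 := by exact_mod_cast hb.ne'
  have hpi : (Real.pi : ℂ) ≠ 0 := by exact_mod_cast Real.pi_ne_zero
  have hne : ∀ t : ℝ, (b : ℂ) + t * Complex.I ≠ 0 := fun t ht => by
    simpa [hb.ne'] using congrArg Complex.re ht
  set x : ℕ → ℂ := fun j => (b / 2 + Real.pi * Complex.I * j) / K with hx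
  set y : ℕ → ℂ := fun k => (b / 2 - Real.pi * Complex.I * k) / K with hy
  have hxy : ∀ j k : ℕ, x j + y k = (b + Real.pi * Complex.I * ((j : ℂ) - k)) / K := fun j k => by
    simp only [hx, hy]
    ring
  have hxy0 : ∀ j k : ℕ, x j + y k ≠ 0 := fun j k => by
    rw [hxy]
    refine div_ne_zero ?_ hK'
    convert hne (Real.pi * (j - k)) using 2
    push_cast
    ring
  simp only [← hxy]
  induction N with
  | zero => simp
  | succ n ih =>
    rw [det_cauchy_succ (fun j : Fin (n + 1) => x j) (fun k : Fin (n + 1) => y k)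
      fun i j => hxy0 i j]
    have hshift : (of fun i j : Fin n => 1 / (x (i.succ : Fin (n + 1)) + y (j.succ : Fin (n + 1)))) =
        of fun i j : Fin n => 1 / (x i + y j) := by
      ext i j
      simp only [of_apply, hxy, Fin.val_succ]
      push_cast
      ring
    rw [hshift, ih, Finset.prod_range_succ, mul_comm]
    push_cast
    rw [← Finset.prod_inv_distrib, ← Fin.prod_univ_eq_prod_range
      (fun d : ℕ => (1 + ((b : ℂ) / (Real.pi * (d + 1))) ^ 2)⁻¹)]
    congr 2
    · simp [hx, hy]
      field_simp
      ring
    · refine Finset.prod_congr rfl fun d _ => ?_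
      have hd : ((d : ℕ) : ℂ) + 1 ≠ 0 := by exact_mod_cast (d : ℕ).succ_ne_zero
      have hsq : (b : ℂ) ^ 2 + (Real.pi * ((d : ℕ) + 1)) ^ 2 ≠ 0 := by
        have : 0 < b ^ 2 + (Real.pi * ((d : ℕ) + 1)) ^ 2 := by positivity
        exact_mod_cast this.ne'
      have hnum : (x (d.succ : Fin (n + 1)) - x (0 : Fin (n + 1))) *
          (y (d.succ : Fin (n + 1)) - y (0 : Fin (n + 1))) =
          (Real.pi * ((d : ℕ) + 1)) ^ 2 / (K : ℂ) ^ 2 := by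
        simp only [hx, hy, Fin.val_succ, Fin.val_zero]
        push_cast
        linear_combination (-(Real.pi * ((d : ℕ) + 1)) ^ 2 / (K : ℂ) ^ 2) * Complex.I_sq
      have hden : (x (d.succ : Fin (n + 1)) + y (0 : Fin (n + 1))) *
          (x (0 : Fin (n + 1)) + y (d.succ : Fin (n + 1))) =
          ((b : ℂ) ^ 2 + (Real.pi * ((d : ℕ) + 1)) ^ 2) / (K : ℂ) ^ 2 := by
        simp only [hxy, Fin.val_succ, Fin.val_zero]
        push_cast
        linear_combination (-(Real.pi * ((d : ℕ) + 1)) ^ 2 / (K : ℂ) ^ 2) * Complex.I_sq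
      rw [hnum, hden]
      have hsum : 1 + ((b : ℂ) / (Real.pi * ((d : ℕ) + 1))) ^ 2 =
          ((b : ℂ) ^ 2 + (Real.pi * ((d : ℕ) + 1)) ^ 2) / (Real.pi * ((d : ℕ) + 1)) ^ 2 := by
        field_simp
        ring
      rw [hsum, inv_div, div_div_div_cancel_right₀ (pow_ne_zero 2 hK')]

/-- Euler's product for the hyperbolic sine. -/
theorem Real.tendsto_euler_sinh_prod {b : ℝ} (hb : b ≠ 0) :
    Tendsto (fun n : ℕ => ∏ d ∈ Finset.range n, (1 + (b / (Real.pi * (d + 1))) ^ 2)) atTop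
      (nhds (Real.sinh b / b)) := by
  have hb' : (b : ℂ) ≠ 0 := by exact_mod_cast hb
  have hpi : (Real.pi : ℂ) ≠ 0 := by exact_mod_cast Real.pi_ne_zero
  have h := tendsto_euler_sin_prod' (x := b / Real.pi * Complex.I)
    (mul_ne_zero (div_ne_zero hb' hpi) Complex.I_ne_zero)
  have harg : (Real.pi : ℂ) * (b / Real.pi * Complex.I) = b * Complex.I := by
    field_simp
  rw [harg, Complex.sin_mul_I, mul_div_mul_right _ _ Complex.I_ne_zero] at h
  refine (Complex.continuous_re.continuousAt.tendsto.comp h).congr' (.of_forall fun n => ?_) |>.trans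
    (le_of_eq ?_)
  · rw [Function.comp_apply, ← Complex.ofReal_re (∏ d ∈ Finset.range n, _)]
    congr 1
    push_cast
    refine Finset.prod_congr rfl fun d _ => ?_
    simp only [sineTerm, mul_pow, Complex.I_sq, div_pow]
    rw [mul_neg_one, neg_neg, div_div]
  · congr 1
    exact_mod_cast Complex.ofReal_re (Real.sinh b / b)

/-- Geometric means of a positive sequence converge to the limit of the sequence. -/
theorem tendsto_prod_range_rpow_inv {r : ℕ → ℝ} (hr : ∀ n, 0 < r n) {L : ℝ} (hL : 0 < L)
    (h : Tendsto r atTop (nhds L)) :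
    Tendsto (fun N : ℕ => (∏ n ∈ Finset.range N, r n) ^ ((N : ℝ)⁻¹)) atTop (nhds L) := by
  have hlog := (h.log hL.ne').cesaro
  have hexp := (Real.continuous_exp.tendsto _).comp hlog
  rw [Real.exp_log hL] at hexp
  refine hexp.congr fun N => ?_
  rw [Function.comp_apply, Real.rpow_def_of_pos (Finset.prod_pos fun n _ => hr n),
    Real.log_prod fun n _ => (hr n).ne', mul_comm]

/-- the Gram determinants `D_N = det[1/(λ_j + conj λ_k)]_{j,k=1}^N`
for `λ_n = (2πin + β)/(2K)`, `Re β > 0`, are positive reals, and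
`D_N^{1/N} → K / sinh(Re β)` as `N → ∞`. -/
theorem stmt19 (K : ℝ) (hK : 0 < K) (β : ℂ) (hβ : 0 < β.re)
    (lam : ℤ → ℂ)
    (hlam : ∀ n : ℤ, lam n = (2 * Real.pi * Complex.I * n + β) / (2 * K))
    (D : ℕ → ℂ)
    (hD : ∀ N : ℕ, D N = Matrix.det (Matrix.of fun j k : Fin N =>
      1 / (lam ((j : ℕ) + 1) + (starRingEnd ℂ) (lam ((k : ℕ) + 1))))) :
    (∀ N : ℕ, 1 ≤ N → (D N).im = 0 ∧ 0 < (D N).re) ∧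
    Filter.Tendsto (fun N : ℕ => (D N).re ^ ((N : ℝ)⁻¹)) Filter.atTop
      (nhds (K / Real.sinh β.re)) := by
  have hK' : (K : ℂ) ≠ 0 := by exact_mod_cast hK.ne'
  set r : ℕ → ℝ := fun n => K / β.re *
    (∏ d ∈ Finset.range n, (1 + (β.re / (Real.pi * (d + 1))) ^ 2))⁻¹ with hr
  have hDr : ∀ N, D N = ((∏ n ∈ Finset.range N, r n : ℝ) : ℂ) := fun N => by
    rw [hD, ← det_toeplitz_cauchy hK hβ]
    congr 2
    ext j k
    have hre : (β.re : ℂ) = (β + (starRingEnd ℂ) β) / 2 := Complex.re_eq_add_conj β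
    rw [hlam, hlam, hre]
    simp only [map_div₀, map_add, map_mul, Complex.conj_I, Complex.conj_ofReal, map_ofNat,
      map_natCast, map_one, Int.cast_add, Int.cast_natCast, Int.cast_one]
    congr 1
    field_simp
    ring
  have hpos : ∀ n, 0 < r n := fun n => by positivity
  have hlim : Tendsto r atTop (nhds (K / Real.sinh β.re)) := by
    have hs := Real.sinh_pos_iff.2 hβ
    have := ((Real.tendsto_euler_sinh_prod hβ.ne').inv₀ (by positivity)).const_mul (K / β.re)
    rwa [inv_div, div_mul_div_cancel₀ hβ.ne'] at this
  simp only [hDr, Complex.ofReal_im, Complex.ofReal_re, true_and]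
  exact ⟨fun N _ => Finset.prod_pos fun n _ => hpos n,
    tendsto_prod_range_rpow_inv hpos (div_pos hK (Real.sinh_pos_iff.2 hβ)) hlim⟩
end
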